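/- Fix nonzero integers m and n, a smooth function W : ℝ → ℝ that is compactly supported in (0, ∞), and ε > 0. Then there exists a constant C = C(W, m, n, ε) such that for all real X ≥ 1, |∑_{c ≥ 1} S(n, m, c) · W(c/X)| ≤ C · X^{1+ε}. -/

import Mathlib

open scoped Real

/-- The Kloosterman sum `S(m, n, c) = ∑_{d mod c, (d,c)=1} e((m d + n d̄)/c)`,
where `d̄` is the multiplicative inverse of `d` modulo `c`. -/
noncomputable def kloostermanSum (m n : ℤ) (c : ℕ) : ℂ :=
  ∑ d ∈ (Finset.range c).filter (fun d => Nat.gcd d c = 1),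
    Complex.exp (2 * π * Complex.I *
      (((m * (d : ℤ) + n * ((((d : ZMod c)⁻¹ : ZMod c)).val : ℤ) : ℤ) : ℂ) / (c : ℂ)))

namespace LinnikSums

open MeasureTheory Set Filter Topology UpperHalfPlane ModularGroup
open scoped MatrixGroups Modular UpperHalfPlane ENNReal NNReal

/-! ### The modular group acting on the upper half-plane -/

instance : Countable SL(2, ℤ) :=
  Function.Injective.countable (f := fun (g : SL(2, ℤ)) (i j : Fin 2) => g i j)
    fun a b h => Matrix.SpecialLinearGroup.ext a b fun i j => congrFun (congrFun h i) j

lemma measurePreserving_smul_modular (g : SL(2, ℤ)) :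
    MeasurePreserving (fun z : ℍ => g • z) volume volume :=
  measurePreserving_smul (g : GL (Fin 2) ℝ) (volume : Measure ℍ)

lemma continuous_smul_modular (g : SL(2, ℤ)) : Continuous (fun z : ℍ => g • z) :=
  continuous_const_smul (g : GL (Fin 2) ℝ)

lemma measurableEmbedding_smul_modular (g : SL(2, ℤ)) : MeasurableEmbedding (fun z : ℍ => g • z) :=
  measurableEmbedding_const_smul (g : GL (Fin 2) ℝ)

lemma finite_setOf_smul_inter {K L : Set ℍ} (hK : IsCompact K) (hL : IsCompact L) :
    {g : SL(2, ℤ) | ∃ z ∈ K, g • z ∈ L}.Finite := by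
  have h := (ProperlyDiscontinuousSMul.finite_disjoint_inter_image (Γ := 𝒮ℒ) hK hL)
  have hinj : Function.Injective (fun g : SL(2, ℤ) => (⟨(g : GL (Fin 2) ℝ), ⟨g, rfl⟩⟩ : 𝒮ℒ)) := by
    intro a b hab
    have h1 : (a : GL (Fin 2) ℝ) = b := congrArg Subtype.val hab
    ext i j
    have h2 := congrArg (fun m : GL (Fin 2) ℝ => m i j) h1
    simpa using h2
  refine (h.preimage hinj.injOn).subset ?_
  rintro g ⟨z, hz, hgz⟩
  exact (⟨g • z, ⟨z, hz, rfl⟩, hgz⟩ : ((fun w : ℍ => g • w) '' K ∩ L).Nonempty)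

lemma volume_eq_zero_of_image {s : Set ℍ} (h : volume ((↑) '' s : Set ℂ) = 0) :
    volume s = 0 := by
  have : (volume : Measure ℍ) ≪ volume.comap UpperHalfPlane.coe :=
    withDensity_absolutelyContinuous _ _
  apply this
  rw [measurableEmbedding_coe.comap_apply]
  exact h

lemma volume_re_eq (a : ℝ) : volume {z : ℂ | z.re = a} = 0 := by
  have := Complex.volume_preserving_equiv_real_prod.measure_preimage
    (s := {a} ×ˢ univ) (by measurability)
  rw [Measure.volume_eq_prod, Measure.prod_prod] at this
  simp only [measure_singleton, zero_mul] at this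
  rw [← this]
  congr 1
  ext z
  simp [Complex.measurableEquivRealProd]

lemma volume_fd_diff_fdo : volume (𝒟 \ 𝒟ᵒ) = 0 := by
  apply volume_eq_zero_of_image
  refine measure_mono_null (t := Metric.sphere (0:ℂ) 1 ∪ {z : ℂ | z.re = 1/2} ∪
    {z : ℂ | z.re = -(1/2)}) ?_ ?_
  · rintro _ ⟨z, ⟨hz, hz'⟩, rfl⟩
    have h1 := hz.1
    have h2 := hz.2
    by_contra hc
    apply hz'
    simp only [mem_union, mem_sphere_iff_norm, sub_zero, mem_ofPred_eq, not_or] at hc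
    obtain ⟨⟨ha, hb⟩, hc⟩ := hc
    refine ⟨lt_of_le_of_ne h1 ?_, lt_of_le_of_ne h2 ?_⟩
    · intro h
      apply ha
      rw [Complex.normSq_eq_norm_sq] at h
      nlinarith [norm_nonneg (z:ℂ)]
    · intro h
      rcases abs_eq (by norm_num : (0:ℝ) ≤ 1/2) |>.1 h with h | h
      · exact hb h
      · exact hc h
  · simp [volume_re_eq, Measure.addHaar_sphere]

/-- Almost every orbit meets the fundamental domain for exactly two group elements. -/
lemma ae_exists_smul_mem_fd : ∀ᵐ z : ℍ, ∃ g : SL(2, ℤ), ∀ γ : SL(2, ℤ), γ⁻¹ • z ∈ 𝒟 ↔ γ = g ∨ γ = -g := by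
  have h : ∀ᵐ z : ℍ, ∀ g : SL(2, ℤ), g • z ∉ 𝒟 \ 𝒟ᵒ := by
    rw [ae_all_iff]
    intro g
    have := (measurePreserving_smul_modular g).quasiMeasurePreserving.preimage_null
      volume_fd_diff_fdo
    exact measure_eq_zero_iff_ae_notMem.1 this
  filter_upwards [h] with z hz
  obtain ⟨g, hg⟩ := exists_smul_mem_fd z
  have hgo : g • z ∈ 𝒟ᵒ := by
    by_contra hc
    exact hz g ⟨hg, hc⟩
  refine ⟨g⁻¹, fun γ => ⟨fun hγ => ?_, ?_⟩⟩
  · have h1 : (γ⁻¹ * g⁻¹) • (g • z) ∈ 𝒟 := by rwa [smul_smul, inv_mul_cancel_right]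
    rcases eq_one_or_neg_one_of_mem_fdo_mem_fd hgo h1 with h | h
    · left; exact inv_mul_eq_one.1 (by simpa using h)
    · right
      have : γ⁻¹ = -g := by
        rw [mul_inv_eq_iff_eq_mul] at h; simpa using h
      rw [← inv_inv γ, this]
      rw [inv_eq_iff_mul_eq_one]; simp
  · rintro (rfl | rfl)
    · simpa using hg
    · have : (-g⁻¹ : SL(2, ℤ))⁻¹ = -g := by rw [inv_eq_iff_mul_eq_one]; simp
      rw [this, ModularGroup.SL_neg_smul]; exact hg

lemma tsum_indicator_fd {E : Type*} [AddCommMonoid E] [TopologicalSpace E] [T2Space E] (w : E) :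
    ∀ᵐ z : ℍ, ∑' γ : SL(2, ℤ), fd.indicator (fun _ => w) (γ⁻¹ • z) = w + w := by
  filter_upwards [ae_exists_smul_mem_fd] with z ⟨g, hg⟩
  have hne : g ≠ -g := by
    intro h
    have h1 := congrArg (fun m : SL(2, ℤ) => m 0 0) h
    have h2 := congrArg (fun m : SL(2, ℤ) => m 0 1) h
    have h3 := g.det_coe
    rw [Matrix.det_fin_two] at h3
    simp at h1 h2
    have h1' : g 0 0 = 0 := by omega
    have h2' : g 0 1 = 0 := by omega
    simp [h1', h2'] at h3
  rw [tsum_eq_sum (s := {g, -g}), Finset.sum_pair hne]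
  · rw [indicator_of_mem ((hg _).2 (Or.inl rfl)), indicator_of_mem ((hg _).2 (Or.inr rfl))]
  · intro γ hγ
    rw [indicator_of_notMem]
    rw [hg]
    simpa using hγ

lemma measurableSet_fd : MeasurableSet 𝒟 := isClosed_fd.measurableSet

lemma lintegral_fd_tsum {J : ℍ → ℝ≥0∞} (hJ : AEMeasurable J) :
    ∑' γ : SL(2, ℤ), ∫⁻ z in 𝒟, J (γ • z) = 2 * ∫⁻ z, J z := by
  have h1 : ∀ γ : SL(2, ℤ), ∫⁻ z in 𝒟, J (γ • z) =
      ∫⁻ z, fd.indicator (fun _ => J z) (γ⁻¹ • z) := by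
    intro γ
    rw [← lintegral_indicator measurableSet_fd,
      ← (measurePreserving_smul_modular γ).lintegral_comp_emb
        (measurableEmbedding_smul_modular γ) (fun z => fd.indicator (fun _ => J z) (γ⁻¹ • z))]
    congr 1
    ext z
    rw [inv_smul_smul]
    rfl
  have hm : ∀ γ : SL(2, ℤ), AEMeasurable (fun z => fd.indicator (fun _ => J z) (γ⁻¹ • z)) := by
    intro γ
    have : (fun z => fd.indicator (fun _ => J z) (γ⁻¹ • z)) =
      ((fun z : ℍ => γ⁻¹ • z) ⁻¹' 𝒟).indicator J := rfl
    rw [this]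
    exact hJ.indicator ((measurableEmbedding_smul_modular γ⁻¹).measurable measurableSet_fd)
  simp_rw [h1]
  rw [← lintegral_tsum hm, ← lintegral_const_mul'' _ hJ]
  apply lintegral_congr_ae
  filter_upwards [tsum_indicator_fd (1 : ℝ≥0∞)] with z hz
  have : ∀ γ : SL(2, ℤ), fd.indicator (fun _ => J z) (γ⁻¹ • z)
      = fd.indicator (fun _ => (1:ℝ≥0∞)) (γ⁻¹ • z) * J z := by
    intro γ
    by_cases h : γ⁻¹ • z ∈ 𝒟
    · rw [indicator_of_mem h, indicator_of_mem h, one_mul]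
    · rw [indicator_of_notMem h, indicator_of_notMem h, zero_mul]
  simp_rw [this]
  rw [ENNReal.tsum_mul_right, hz, one_add_one_eq_two]

/-- Unfolding: integrating an orbit sum over the fundamental domain. -/
lemma integral_fd_tsum {E : Type*} [NormedAddCommGroup E] [NormedSpace ℝ E] 
    {J : ℍ → E} (hJ : Integrable J) :
    ∫ z in 𝒟, ∑' γ : SL(2, ℤ), J (γ • z) = (2:ℝ) • ∫ z, J z := by
  have h1 : ∀ γ : SL(2, ℤ), ∫ z in 𝒟, J (γ • z) =
      ∫ z, fd.indicator (fun _ => J z) (γ⁻¹ • z) := by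
    intro γ
    rw [← integral_indicator measurableSet_fd,
      ← (measurePreserving_smul_modular γ).integral_comp
        (measurableEmbedding_smul_modular γ) (fun z => fd.indicator (fun _ => J z) (γ⁻¹ • z))]
    congr 1
    ext z
    rw [inv_smul_smul]
    rfl
  have hind : ∀ γ : SL(2, ℤ), (fun z => fd.indicator (fun _ => J z) (γ⁻¹ • z)) =
      ((fun z : ℍ => γ⁻¹ • z) ⁻¹' 𝒟).indicator J := fun _ => rfl
  have hm : ∀ γ : SL(2, ℤ), AEStronglyMeasurable
      (fun z => fd.indicator (fun _ => J z) (γ⁻¹ • z)) volume := by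
    intro γ
    rw [hind]
    exact hJ.1.indicator ((measurableEmbedding_smul_modular γ⁻¹).measurable measurableSet_fd)
  have hfin : ∑' γ : SL(2, ℤ), ∫⁻ z in 𝒟, ‖J (γ • z)‖ₑ ≠ ∞ := by
    rw [lintegral_fd_tsum (J := fun z => ‖J z‖ₑ) hJ.1.enorm]
    exact ENNReal.mul_ne_top (by simp) hJ.2.ne
  have hfin2 : ∑' γ : SL(2, ℤ), ∫⁻ z, ‖fd.indicator (fun _ => J z) (γ⁻¹ • z)‖ₑ ≠ ∞ := by
    convert hfin using 3 with γ
    rw [← lintegral_indicator measurableSet_fd,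
      ← (measurePreserving_smul_modular γ).lintegral_comp_emb
        (measurableEmbedding_smul_modular γ) (fun z => ‖fd.indicator (fun _ => J z) (γ⁻¹ • z)‖ₑ)]
    congr 1
    ext z
    rw [inv_smul_smul]
    by_cases h : z ∈ 𝒟 <;> simp [h]
  rw [integral_tsum _ hfin]
  · simp_rw [h1]
    rw [← integral_tsum hm hfin2, ← integral_smul]
    apply integral_congr_ae
    filter_upwards [tsum_indicator_fd (1 : ℝ)] with z hz
    have h2 : ∀ γ : SL(2, ℤ), fd.indicator (fun _ => J z) (γ⁻¹ • z)
        = fd.indicator (fun _ => (1:ℝ)) (γ⁻¹ • z) • J z := by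
      intro γ
      by_cases h : γ⁻¹ • z ∈ 𝒟
      · rw [indicator_of_mem h, indicator_of_mem h, one_smul]
      · rw [indicator_of_notMem h, indicator_of_notMem h, zero_smul]
    simp_rw [h2]
    have hs : Summable fun γ : SL(2, ℤ) => fd.indicator (fun _ => (1:ℝ)) (γ⁻¹ • z) := by
      by_contra hs
      rw [tsum_eq_zero_of_not_summable hs] at hz
      norm_num at hz
    rw [hs.tsum_smul_const, hz, one_add_one_eq_two]
  · intro γ
    exact (hJ.1.comp_quasiMeasurePreserving
      (measurePreserving_smul_modular γ).quasiMeasurePreserving).restrict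

section

variable {E : Type*} [NormedAddCommGroup E]

/-- The sum of `k` over an orbit of the modular group. -/
noncomputable def autom (k : ℂ → E) (z : ℍ) : E := ∑' γ : SL(2, ℤ), k ((γ • z : ℍ) : ℂ)

/-- Continuous functions with compact support in the open upper half-plane. -/
structure IsTest (k : ℂ → E) : Prop where
  cont : Continuous k
  cpt : HasCompactSupport k
  pos : tsupport k ⊆ {z | 0 < z.im}

lemma isCompact_preimage_coe {K : Set ℂ} (hK : IsCompact K) (hpos : K ⊆ {z | 0 < z.im}) :
    IsCompact ((↑) ⁻¹' K : Set ℍ) := by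
  refine isOpenEmbedding_coe.isInducing.isCompact_preimage' hK ?_
  intro z hz
  exact ⟨⟨z, hpos hz⟩, rfl⟩

lemma exists_finset_smul_notMem {K : Set ℂ} (hK : IsCompact K) (hpos : K ⊆ {z | 0 < z.im})
    (z₀ : ℍ) : ∃ U ∈ 𝓝 z₀, ∃ F : Finset SL(2, ℤ), ∀ z ∈ U, ∀ γ ∉ F, ((γ • z : ℍ) : ℂ) ∉ K := by
  obtain ⟨U, hU, hUz⟩ := exists_compact_mem_nhds z₀
  have hf := finite_setOf_smul_inter hU (isCompact_preimage_coe hK hpos)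
  refine ⟨U, hUz, hf.toFinset, fun z hz γ hγ hk => hγ ?_⟩
  rw [Finite.mem_toFinset]
  exact ⟨z, hz, hk⟩

lemma IsTest.exists_finset {k : ℂ → E} (hk : IsTest k) (z₀ : ℍ) :
    ∃ U ∈ 𝓝 z₀, ∃ F : Finset SL(2, ℤ), ∀ z ∈ U, ∀ γ ∉ F, k (γ • z : ℍ) = 0 := by
  obtain ⟨U, hU, F, hF⟩ := exists_finset_smul_notMem hk.cpt hk.pos z₀
  exact ⟨U, hU, F, fun z hz γ hγ => image_eq_zero_of_notMem_tsupport (hF z hz γ hγ)⟩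

lemma IsTest.hasSum {k : ℂ → E} (hk : IsTest k) (z : ℍ) :
    HasSum (fun γ : SL(2, ℤ) => k (γ • z : ℍ)) (autom k z) := by
  obtain ⟨U, hU, F, hF⟩ := hk.exists_finset z
  exact (summable_of_ne_finset_zero (s := F) fun γ hγ => hF z (mem_of_mem_nhds hU) γ hγ).hasSum

lemma IsTest.continuous_autom {k : ℂ → E} (hk : IsTest k) : Continuous (autom k) := by
  rw [continuous_iff_continuousAt]
  intro z₀
  obtain ⟨U, hU, F, hF⟩ := hk.exists_finset z₀
  have : autom k =ᶠ[𝓝 z₀] fun z => ∑ γ ∈ F, k (γ • z : ℍ) := by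
    filter_upwards [hU] with z hz
    exact tsum_eq_sum fun γ hγ => hF z hz γ hγ
  refine ContinuousAt.congr ?_ this.symm
  refine Continuous.continuousAt (continuous_finsetSum _ fun γ _ => ?_)
  exact hk.cont.comp (continuous_coe.comp (continuous_smul_modular γ))

lemma autom_smul (k : ℂ → E) (g : SL(2, ℤ)) (z : ℍ) : autom k (g • z) = autom k z := by
  unfold autom
  rw [← (Equiv.mulRight g).tsum_eq (fun γ : SL(2, ℤ) => k ((γ • z : ℍ) : ℂ))]
  simp only [Equiv.coe_mulRight, mul_smul]

lemma IsTest.add {k l : ℂ → E} (hk : IsTest k) (hl : IsTest l) : IsTest (k + l) :=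
  ⟨hk.cont.add hl.cont, hk.cpt.add hl.cpt,
    (tsupport_add k l).trans (union_subset hk.pos hl.pos)⟩

lemma IsTest.smul [NormedSpace ℝ E] {k : ℂ → E} (hk : IsTest k) (c : ℝ) : IsTest (c • k) :=
  ⟨hk.cont.const_smul c, hk.cpt.mono (Function.support_const_smul_subset c k),
    (closure_mono (Function.support_const_smul_subset c k)).trans hk.pos⟩

lemma autom_add {k l : ℂ → E} (hk : IsTest k) (hl : IsTest l) :
    autom (k + l) = autom k + autom l := by
  ext z
  exact ((hk.hasSum z).add (hl.hasSum z)).tsum_eq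

lemma autom_const_smul [NormedSpace ℝ E] (k : ℂ → E) (c : ℝ) :
    autom (c • k) = c • autom k := by
  ext z
  exact tsum_const_smul'' c

lemma IsTest.integrable_mul {k : ℂ → ℝ} (hk : IsTest k) {G : ℍ → ℝ} (hG : Continuous G) :
    Integrable (fun z : ℍ => k z * G z) := by
  refine Continuous.integrable_of_hasCompactSupport
    ((hk.cont.comp continuous_coe).mul hG) ?_
  refine HasCompactSupport.intro (isCompact_preimage_coe hk.cpt hk.pos) fun z hz => ?_
  rw [image_eq_zero_of_notMem_tsupport hz, zero_mul]

lemma IsTest.integral_autom_mul {k : ℂ → ℝ} (hk : IsTest k) {G : ℍ → ℝ} (hG : Continuous G)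
    (hinv : ∀ (g : SL(2, ℤ)) z, G (g • z) = G z) :
    ∫ z in 𝒟, autom k z * G z = 2 * ∫ z : ℍ, k z * G z := by
  rw [← smul_eq_mul, ← integral_fd_tsum (hk.integrable_mul hG)]
  congr 1
  ext z
  simp_rw [hinv, tsum_mul_right]
  rfl

lemma IsTest.exists_autom_eq_zero {k : ℂ → E} (hk : IsTest k) :
    ∃ Y : ℝ, ∀ z : ℍ, Y < z.im → autom k z = 0 := by
  have hK : IsCompact (Complex.im '' tsupport k) := hk.cpt.image Complex.continuous_im
  obtain ⟨M, hM⟩ := hK.bddAbove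
  obtain ⟨δ, hδ, hδ'⟩ : ∃ δ > 0, ∀ z ∈ tsupport k, δ ≤ z.im := by
    rcases (tsupport k).eq_empty_or_nonempty with h | h
    · exact ⟨1, one_pos, by simp [h]⟩
    · obtain ⟨z, hz, hz'⟩ := hk.cpt.exists_isMinOn h Complex.continuous_im.continuousOn
      exact ⟨z.im, hk.pos hz, hz'⟩
  refine ⟨max M δ⁻¹, fun z hz => ?_⟩
  have hz1 := (max_lt_iff.1 hz).1
  have hz2 := (max_lt_iff.1 hz).2
  unfold autom
  convert tsum_zero with γ
  apply image_eq_zero_of_notMem_tsupport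
  intro hmem
  have h1 : (γ • z : ℍ).im ≤ M := hM ⟨_, hmem, rfl⟩
  have h2 : δ ≤ (γ • z : ℍ).im := hδ' _ hmem
  have hy := z.im_pos
  rw [ModularGroup.im_smul_eq_div_normSq, ModularGroup.denom_apply] at h1 h2
  have hns : Complex.normSq ((γ 1 0 : ℂ) * z + γ 1 1) =
      ((γ 1 0 : ℝ) * z.re + γ 1 1) ^ 2 + (γ 1 0 : ℝ) ^ 2 * z.im ^ 2 := by
    simp [Complex.normSq_apply]; ring
  rw [hns] at h1 h2
  by_cases hc : γ 1 0 = 0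
  · have hd : (γ 1 1 : ℝ) ^ 2 = 1 := by
      have h3 := γ.det_coe
      rw [Matrix.det_fin_two, hc] at h3
      have : γ 0 0 * γ 1 1 = 1 := by simpa using h3
      have h4 : γ 1 1 ^ 2 = 1 := by
        rcases Int.eq_one_or_neg_one_of_mul_eq_one' this with h | h <;> simp [h.2]
      exact_mod_cast h4
    simp [hc, hd] at h1
    linarith
  · have hc1 : (1:ℝ) ≤ (γ 1 0 : ℝ) ^ 2 := by
      have : 1 ≤ γ 1 0 ^ 2 := by
        have := sq_nonneg (γ 1 0)
        have := pow_ne_zero 2 hc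
        omega
      exact_mod_cast this
    have h3 : z.im ^ 2 ≤ ((γ 1 0 : ℝ) * z.re + γ 1 1) ^ 2 + (γ 1 0 : ℝ) ^ 2 * z.im ^ 2 := by
      nlinarith [sq_nonneg ((γ 1 0 : ℝ) * z.re + γ 1 1), sq_nonneg z.im]
    rw [le_div_iff₀ (lt_of_lt_of_le (by positivity) h3)] at h2
    have h4 : δ * z.im ^ 2 ≤ z.im := (mul_le_mul_of_nonneg_left h3 hδ.le).trans h2
    have h5 : 1 < z.im * δ := by rwa [inv_lt_iff_one_lt_mul₀ hδ] at hz2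
    nlinarith

/-! ### A uniform bound for orbit sums -/

lemma summable_one_add_sq_inv : Summable fun n : ℤ => ((1:ℝ) + (n:ℝ) ^ 2)⁻¹ := by
  have h := (Real.summable_one_div_int_pow (p := 2)).2 one_lt_two
  refine h.of_norm_bounded_eventually ?_
  have : ({0}ᶜ : Set ℤ) ∈ cofinite := (finite_singleton 0).compl_mem_cofinite
  filter_upwards [this] with n hn
  have hn' : (n:ℝ) ≠ 0 := by exact_mod_cast hn
  have : 0 < (n:ℝ)^2 := by positivity
  rw [Real.norm_of_nonneg (by positivity), one_div]
  exact inv_anti₀ this (by linarith)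

/-- The majorant used to bound orbit sums. -/
noncomputable def majorant (p : (ℤ × ℤ) × ℤ) : ℝ :=
  8 * (((1:ℝ) + (p.1.1:ℝ) ^ 2)⁻¹ * ((1:ℝ) + (p.1.2:ℝ) ^ 2)⁻¹ *
      if p.2 ∈ Finset.Icc (-2:ℤ) 1 then 1 else 0)

lemma majorant_nonneg (p) : 0 ≤ majorant p := by
  unfold majorant; split_ifs <;> positivity

lemma summable_majorant : Summable majorant := by
  have h0 : (0 : ℤ → ℝ) ≤ fun n : ℤ => ((1:ℝ) + (n:ℝ) ^ 2)⁻¹ := fun n => by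
    simp only [Pi.zero_apply]; positivity
  have h1 := summable_one_add_sq_inv.mul_of_nonneg summable_one_add_sq_inv h0 h0
  have h2 : Summable fun n : ℤ => if n ∈ Finset.Icc (-2:ℤ) 1 then (1:ℝ) else 0 :=
    summable_of_ne_finset_zero (s := Finset.Icc (-2:ℤ) 1) fun n hn => if_neg hn
  have h3 : (0 : ℤ → ℝ) ≤ fun n : ℤ => if n ∈ Finset.Icc (-2:ℤ) 1 then (1:ℝ) else 0 :=
    fun n => by simp only [Pi.zero_apply]; split_ifs <;> norm_num
  have h4 : (0 : ℤ × ℤ → ℝ) ≤ fun p : ℤ × ℤ =>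
      ((1:ℝ) + (p.1:ℝ) ^ 2)⁻¹ * ((1:ℝ) + (p.2:ℝ) ^ 2)⁻¹ := fun n => by
    simp only [Pi.zero_apply]; positivity
  exact (h1.mul_of_nonneg h2 h4 h3).mul_left 8

lemma bottom_row_floor_injective (z : ℍ) : Function.Injective
    (fun γ : SL(2, ℤ) => ((γ 1 0, γ 1 1), ⌊(γ • z : ℍ).re⌋)) := by
  intro γ δ hγδ
  simp only [Prod.mk.injEq] at hγδ
  obtain ⟨⟨hc, hd⟩, hfl⟩ := hγδ
  have e1 := γ.det_coe
  have e2 := δ.det_coe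
  rw [Matrix.det_fin_two] at e1 e2
  rw [← hc, ← hd] at e2
  set n := γ 0 1 * δ 0 0 - γ 0 0 * δ 0 1
  have ha : γ 0 0 = δ 0 0 + n * γ 1 0 := by
    simp only [n]; linear_combination δ 0 0 * e1 - γ 0 0 * e2
  have hb : γ 0 1 = δ 0 1 + n * γ 1 1 := by
    simp only [n]; linear_combination δ 0 1 * e1 - γ 0 1 * e2
  have hden : (γ 1 0 : ℂ) * z + γ 1 1 ≠ 0 := by
    rw [← ModularGroup.denom_apply]; exact denom_ne_zero _ _
  have hz : ((γ • z : ℍ) : ℂ) = (δ • z : ℍ) + (n : ℂ) := by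
    rw [coe_specialLinearGroup_apply, coe_specialLinearGroup_apply, ← hc, ← hd, ha, hb]
    simp only [algebraMap_int_eq, Int.coe_castRingHom, Int.cast_add, Int.cast_mul,
      Complex.ofReal_intCast, Complex.ofReal_add, Complex.ofReal_mul]
    field_simp
    ring
  have hre : (γ • z : ℍ).re = (δ • z : ℍ).re + n := by
    simpa using congrArg Complex.re hz
  rw [hre, Int.floor_add_intCast] at hfl
  have hn : n = 0 := by omega
  ext i j
  fin_cases i <;> fin_cases j
  · simpa [hn] using ha
  · simpa [hn] using hb
  · exact hc
  · exact hd

lemma im_sq_le_of_mem_fd {z : ℍ} (hg : z ∈ 𝒟) (γ : SL(2, ℤ)) (him : (γ • z : ℍ).im ≤ 2) :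
    (γ • z : ℍ).im ^ 2 ≤
      8 * (((1:ℝ) + (γ 1 0 : ℝ) ^ 2)⁻¹ * ((1:ℝ) + (γ 1 1 : ℝ) ^ 2)⁻¹) := by
  rw [ModularGroup.im_smul_eq_div_normSq, ModularGroup.denom_apply] at him ⊢
  have hns : Complex.normSq ((γ 1 0 : ℂ) * z + γ 1 1) =
      (γ 1 0 : ℝ) ^ 2 * Complex.normSq z + 2 * (γ 1 0 * γ 1 1) * z.re + (γ 1 1 : ℝ) ^ 2 := by
    simp [Complex.normSq_apply]; ring
  rw [hns] at him ⊢
  have hN : 1 ≤ Complex.normSq z := hg.1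
  have hx : |z.re| ≤ 1 / 2 := hg.2
  have hy := z.im_pos
  have hNy : z.im ^ 2 ≤ Complex.normSq z := by
    rw [Complex.normSq_apply, coe_re, coe_im]; nlinarith [sq_nonneg z.re]
  by_cases hc : γ 1 0 = 0
  · have hd : (γ 1 1 : ℝ) ^ 2 = 1 := by
      have h3 := γ.det_coe
      rw [Matrix.det_fin_two, hc] at h3
      have : γ 0 0 * γ 1 1 = 1 := by simpa using h3
      have h4 : γ 1 1 ^ 2 = 1 := by
        rcases Int.eq_one_or_neg_one_of_mul_eq_one' this with h | h <;> simp [h.2]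
      exact_mod_cast h4
    simp [hc, hd] at him ⊢
    norm_num
    nlinarith
  · have hc1 : (1:ℝ) ≤ (γ 1 0 : ℝ) ^ 2 := by
      have : 1 ≤ γ 1 0 ^ 2 := by
        have := sq_nonneg (γ 1 0)
        have := pow_ne_zero 2 hc
        omega
      exact_mod_cast this
    set c : ℝ := ((γ 1 0 : ℤ) : ℝ)
    set d : ℝ := ((γ 1 1 : ℤ) : ℝ)
    set N := Complex.normSq z
    have hQ : (c ^ 2 * N + d ^ 2) / 2 ≤ c ^ 2 * N + 2 * (c * d) * z.re + d ^ 2 := by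
      have h1 : -(|c * d|) ≤ 2 * (c * d) * z.re := by
        have : |2 * (c * d) * z.re| ≤ |c * d| := by
          rw [abs_mul, abs_mul, abs_two]
          nlinarith [abs_nonneg (c * d)]
        exact (neg_le_neg this).trans (neg_abs_le _)
      have h2 : |c * d| ≤ (c ^ 2 + d ^ 2) / 2 := by
        rw [abs_le]; constructor <;> nlinarith [sq_nonneg (c + d), sq_nonneg (c - d)]
      nlinarith
    have hP1 : z.im ^ 2 * (1 + c ^ 2) / 2 ≤ c ^ 2 * N + d ^ 2 := by
      nlinarith [sq_nonneg d, sq_nonneg z.im]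
    have hP2 : 1 + d ^ 2 ≤ c ^ 2 * N + d ^ 2 := by nlinarith
    set P := c ^ 2 * N + d ^ 2
    set Q := c ^ 2 * N + 2 * (c * d) * z.re + d ^ 2
    have hP0 : 0 < P := by nlinarith [sq_nonneg d]
    have hPP : z.im ^ 2 * (1 + c ^ 2) / 2 * (1 + d ^ 2) ≤ P * P :=
      mul_le_mul hP1 hP2 (by positivity) hP0.le
    have hQQ : P * P ≤ 4 * (Q * Q) := by nlinarith
    rw [div_pow, ← mul_inv, ← div_eq_mul_inv, div_le_div_iff₀ (by nlinarith) (by positivity)]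
    nlinarith

lemma exists_bound_autom : ∃ C : ℝ, 0 < C ∧ ∀ (k : ℂ → ℝ) (A : ℝ), 0 ≤ A →
    (∀ z : ℂ, 0 < z.im → |k z| ≤ A * z.im ^ 2) →
    (∀ z : ℂ, k z ≠ 0 → |z.re| ≤ 1 ∧ z.im ≤ 2) → ∀ z : ℍ, |autom k z| ≤ C * A := by
  have hsum := summable_majorant
  refine ⟨∑' p, majorant p + 1, by
    have h0 : 0 ≤ ∑' p, majorant p := tsum_nonneg majorant_nonneg
    linarith,
    fun k A hA hk hs z => ?_⟩
  obtain ⟨g, hg⟩ := exists_smul_mem_fd z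
  rw [← autom_smul k g z]
  generalize g • z = z at hg
  have hinj := bottom_row_floor_injective z
  have hb : ∀ γ : SL(2, ℤ), ‖k (γ • z : ℍ)‖ ≤
      A * majorant ((γ 1 0, γ 1 1), ⌊(γ • z : ℍ).re⌋) := by
    intro γ
    by_cases h0 : k (γ • z : ℍ) = 0
    · rw [h0, norm_zero]; exact mul_nonneg hA (majorant_nonneg _)
    obtain ⟨hre, him⟩ := hs _ h0
    have hfl : ⌊(γ • z : ℍ).re⌋ ∈ Finset.Icc (-2:ℤ) 1 := by
      rw [coe_re, abs_le] at hre
      rw [Finset.mem_Icc, Int.le_floor, ← Int.lt_add_one_iff, Int.floor_lt]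
      push_cast
      constructor <;> linarith
    rw [Real.norm_eq_abs]
    refine (hk _ (γ • z : ℍ).im_pos).trans (mul_le_mul_of_nonneg_left ?_ hA)
    simp only [majorant, if_pos hfl, mul_one]
    exact im_sq_le_of_mem_fd hg γ him
  have hs2 : Summable fun γ : SL(2, ℤ) => majorant ((γ 1 0, γ 1 1), ⌊(γ • z : ℍ).re⌋) :=
    hsum.comp_injective hinj
  have h3 := tsum_of_norm_bounded (hs2.mul_left A).hasSum hb
  rw [tsum_mul_left] at h3
  rw [← Real.norm_eq_abs]
  refine h3.trans ?_
  rw [mul_comm]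
  refine mul_le_mul_of_nonneg_right ?_ hA
  have h4 := Summable.tsum_le_tsum_of_inj _ hinj (fun c _ => majorant_nonneg c)
    (fun γ => le_rfl) hs2 hsum
  linarith

end

section

/-! ### The hyperbolic measure in coordinates -/

lemma measurableSet_im_pos : MeasurableSet {z : ℂ | 0 < z.im} :=
  (isOpen_lt continuous_const Complex.continuous_im).measurableSet

lemma range_coe_eq : range (UpperHalfPlane.coe) = {z : ℂ | 0 < z.im} := by
  ext z
  exact ⟨by rintro ⟨w, rfl⟩; exact w.im_pos, fun h => ⟨⟨z, h⟩, rfl⟩⟩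

lemma measurable_hyperbolic_density :
    Measurable fun z : ℍ => (1 / NNReal.mk z.im z.im_pos.le : ℝ≥0) ^ 2 := by
  refine (Measurable.const_div ?_ _).pow_const 2
  exact (continuous_im.subtype_mk _).measurable

variable {E : Type*} [NormedAddCommGroup E] [NormedSpace ℝ E]

lemma integral_uhp (F : ℂ → E) :
    ∫ z : ℍ, F z = ∫ z in {z : ℂ | 0 < z.im}, (z.im ^ 2)⁻¹ • F z := by
  rw [volume_def]
  rw [integral_withDensity_eq_integral_smul measurable_hyperbolic_density]
  rw [← range_coe_eq, ← measurableEmbedding_coe.map_comap,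
    measurableEmbedding_coe.integral_map]
  congr 1
  ext z
  simp [NNReal.smul_def]

lemma integrable_uhp_iff (F : ℂ → E) :
    Integrable (fun z : ℍ => F z) ↔
      IntegrableOn (fun z : ℂ => (z.im ^ 2)⁻¹ • F z) {z : ℂ | 0 < z.im} := by
  rw [volume_def, integrable_withDensity_iff_integrable_smul measurable_hyperbolic_density,
    IntegrableOn, ← range_coe_eq, ← measurableEmbedding_coe.map_comap,
    measurableEmbedding_coe.integrable_map_iff]
  apply iff_of_eq
  congr 1
  ext z
  simp [NNReal.smul_def]

lemma setIntegral_uhp {S : Set ℂ} (hS : MeasurableSet S) (F : ℂ → E) :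
    ∫ z in ((↑) ⁻¹' S : Set ℍ), F z = ∫ z in {z : ℂ | 0 < z.im} ∩ S, (z.im ^ 2)⁻¹ • F z := by
  rw [← integral_indicator (measurable_coe hS), ← setIntegral_indicator hS]
  have := integral_uhp (S.indicator F)
  refine Eq.trans ?_ (this.trans ?_)
  · rfl
  · refine integral_congr_ae (Eventually.of_forall fun z => ?_)
    by_cases h : z ∈ S <;> simp [h]

lemma integral_complex_eq_prod (f : ℂ → E) :
    ∫ z, f z = ∫ p : ℝ × ℝ, f ⟨p.1, p.2⟩ := by
  rw [← Complex.volume_preserving_equiv_real_prod.symm.integral_comp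
    Complex.measurableEquivRealProd.symm.measurableEmbedding]
  rfl

lemma integrable_complex_iff_prod {E : Type*} [NormedAddCommGroup E] (f : ℂ → E) :
    Integrable f ↔ Integrable fun p : ℝ × ℝ => f ⟨p.1, p.2⟩ := by
  rw [← Complex.volume_preserving_equiv_real_prod.symm.integrable_comp_emb
    Complex.measurableEquivRealProd.symm.measurableEmbedding]
  rfl

lemma volume_fd_lt_top : volume 𝒟 < ∞ := by
  set S : Set ℂ := {z | |z.re| ≤ 1 / 2 ∧ 1 / 2 < z.im}
  have hS : MeasurableSet S := by
    refine MeasurableSet.inter ?_ ?_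
    · exact (isClosed_le Complex.continuous_re.abs continuous_const).measurableSet
    · exact (isOpen_lt continuous_const Complex.continuous_im).measurableSet
  have hsub : 𝒟 ⊆ ((↑) ⁻¹' S : Set ℍ) := by
    intro z hz
    have h := three_le_four_mul_im_sq_of_mem_fd hz
    refine ⟨hz.2, ?_⟩
    have := z.im_pos
    rw [coe_im]
    nlinarith
  refine lt_of_le_of_lt (measure_mono hsub) ?_
  have key : Integrable (fun z : ℍ => S.indicator (fun _ => (1:ℝ)) z) := by
    rw [integrable_uhp_iff, ← integrable_indicator_iff measurableSet_im_pos, integrable_complex_iff_prod]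
    have h1 : Integrable (fun x : ℝ => (Icc (-(1/2)) (1/2 : ℝ)).indicator (fun _ => (1:ℝ)) x) := by
      rw [integrable_indicator_iff measurableSet_Icc]
      simp [integrableOn_const_iff]
    have h2 : Integrable (fun y : ℝ => (Ioi (1/2 : ℝ)).indicator (fun y => y ^ (-2:ℝ)) y) := by
      rw [integrable_indicator_iff measurableSet_Ioi]
      exact integrableOn_Ioi_rpow_of_lt (by norm_num) (by norm_num)
    refine (h1.mul_prod h2).congr (Eventually.of_forall fun p => ?_)
    by_cases hx : p.1 ∈ Icc (-(1/2)) (1/2 : ℝ)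
    · by_cases hy : p.2 ∈ Ioi (1/2 : ℝ)
      · have hy0 : 0 < p.2 := lt_trans (by norm_num) hy
        have hmem : (⟨p.1, p.2⟩ : ℂ) ∈ S := ⟨abs_le.2 hx, hy⟩
        have hmem2 : (⟨p.1, p.2⟩ : ℂ) ∈ {z : ℂ | 0 < z.im} := hy0
        simp only [indicator_of_mem hx, indicator_of_mem hy, indicator_of_mem hmem,
          indicator_of_mem hmem2, smul_eq_mul, mul_one, one_mul]
        rw [Real.rpow_neg hy0.le]; norm_cast
      · have hmem : (⟨p.1, p.2⟩ : ℂ) ∉ S := fun h => hy h.2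
        simp only [indicator_of_notMem hy, mul_zero]
        rw [indicator_apply]
        simp [hmem]
    · have hmem : (⟨p.1, p.2⟩ : ℂ) ∉ S := fun h => hx (abs_le.1 h.1)
      simp only [indicator_of_notMem hx, zero_mul]
      rw [indicator_apply]
      simp [hmem]
  have key2 : IntegrableOn (fun _ : ℍ => (1:ℝ)) ((↑) ⁻¹' S : Set ℍ) := by
    rw [← integrable_indicator_iff (measurable_coe hS)]
    refine key.congr (Eventually.of_forall fun z => ?_)
    by_cases h : (z:ℂ) ∈ S <;> simp [h]
  rw [integrableOn_const_iff] at key2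
  simpa using key2

instance : IsFiniteMeasure (volume.restrict 𝒟) := ⟨by simpa using volume_fd_lt_top⟩

end

/-! ### The Dirichlet form of orbit sums -/

/-- The Möbius map of a modular matrix as a map on `ℂ`. -/
noncomputable def mobius (γ : SL(2, ℤ)) (z : ℂ) : ℂ := ((γ • ofComplex z : ℍ) : ℂ)

/-- An orbit sum regarded as a function on `ℂ`. -/
noncomputable def automC (k : ℂ → ℝ) (z : ℂ) : ℝ := autom k (ofComplex z)

lemma automC_coe (k : ℂ → ℝ) (z : ℍ) : automC k z = autom k z := by simp [automC]

lemma mobius_coe (γ : SL(2, ℤ)) (z : ℍ) : mobius γ z = ((γ • z : ℍ) : ℂ) := by simp [mobius]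

lemma det_coe_eq_one (γ : SL(2, ℤ)) : (γ : GL (Fin 2) ℝ).val.det = 1 :=
  Matrix.SpecialLinearGroup.det_coe _

lemma det_coe_pos (γ : SL(2, ℤ)) : 0 < (γ : GL (Fin 2) ℝ).val.det := by
  rw [det_coe_eq_one]; exact one_pos

lemma hasDerivAt_mobius (γ : SL(2, ℤ)) (z : ℍ) :
    HasDerivAt (mobius γ) (1 / denom γ z ^ 2) z := by
  have := (hasStrictDerivAt_smul (det_coe_pos γ) z).hasDerivAt
  rw [det_coe_eq_one, Complex.ofReal_one] at this
  exact this

lemma contDiffAt_mobius (γ : SL(2, ℤ)) (z : ℍ) {n : WithTop ℕ∞} :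
    ContDiffAt ℝ n (mobius γ) z :=
  (analyticAt_smul (det_coe_pos γ) z).contDiffAt.restrict_scalars ℝ

lemma eventually_ofComplex_mem {z₀ : ℍ} {U : Set ℍ} (hU : U ∈ 𝓝 z₀) :
    ∀ᶠ z : ℂ in 𝓝 (z₀ : ℂ), 0 < z.im ∧ ofComplex z ∈ U := by
  rw [← isOpenEmbedding_coe.map_nhds_eq, eventually_map]
  filter_upwards [hU] with z hz
  exact ⟨z.im_pos, by simpa using hz⟩

lemma contDiffOn_automC {k : ℂ → ℝ} (hk : IsTest k) {n : WithTop ℕ∞} (hk2 : ContDiff ℝ n k) :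
    ContDiffOn ℝ n (automC k) {z | 0 < z.im} := by
  intro z hz
  refine ContDiffAt.contDiffWithinAt ?_
  lift z to ℍ using hz
  obtain ⟨U, hU, F, hF⟩ := hk.exists_finset z
  have : automC k =ᶠ[𝓝 (z : ℂ)] fun w => ∑ γ ∈ F, k (mobius γ w) := by
    filter_upwards [eventually_ofComplex_mem hU] with w hw
    exact tsum_eq_sum fun γ hγ => hF _ hw.2 γ hγ
  refine ContDiffAt.congr_of_eventuallyEq ?_ this
  refine ContDiffAt.sum fun γ _ => ?_
  exact hk2.contDiffAt.comp _ (contDiffAt_mobius γ z)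

/-- The Euclidean inner product of gradients. -/
noncomputable def gdot (f g : ℂ → ℝ) (z : ℂ) : ℝ :=
  fderiv ℝ f z 1 * fderiv ℝ g z 1 + fderiv ℝ f z Complex.I * fderiv ℝ g z Complex.I

lemma gdot_comp {f g : ℂ → ℝ} {φ : ℂ → ℂ} {φ' z : ℂ} (hφ : HasDerivAt φ φ' z)
    (hf : DifferentiableAt ℝ f (φ z)) (hg : DifferentiableAt ℝ g (φ z)) :
    gdot (f ∘ φ) (g ∘ φ) z = Complex.normSq φ' * gdot f g (φ z) := by
  have hφ' := hφ.hasFDerivAt.restrictScalars ℝ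
  have h1 := (hf.hasFDerivAt.comp z hφ').fderiv
  have h2 := (hg.hasFDerivAt.comp z hφ').fderiv
  have e : ∀ L : ℂ →L[ℝ] ℝ, ∀ w : ℂ, L w = w.re * L 1 + w.im * L Complex.I := by
    intro L w
    conv_lhs => rw [← Complex.re_add_im w]
    rw [map_add]
    congr 1
    · rw [show (w.re : ℂ) = w.re • (1:ℂ) by simp, map_smul, smul_eq_mul]
    · rw [show (w.im : ℂ) * Complex.I = w.im • Complex.I by simp, map_smul, smul_eq_mul]
  unfold gdot
  rw [h1, h2]
  simp only [ContinuousLinearMap.comp_apply, ContinuousLinearMap.coe_restrictScalars',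
    ContinuousLinearMap.toSpanSingleton_apply, smul_eq_mul, one_mul]
  rw [e (fderiv ℝ f (φ z)) φ', e (fderiv ℝ g (φ z)) φ', e (fderiv ℝ f (φ z)) (Complex.I * φ'),
    e (fderiv ℝ g (φ z)) (Complex.I * φ'), Complex.normSq_apply]
  simp
  ring

lemma gdot_eq_zero_of_eventually {f g : ℂ → ℝ} {z : ℂ} (h : f =ᶠ[𝓝 z] 0) : gdot f g z = 0 := by
  unfold gdot
  rw [h.fderiv_eq]
  simp

lemma im_smul_sq (γ : SL(2, ℤ)) (z : ℍ) :
    (γ • z : ℍ).im ^ 2 = z.im ^ 2 * Complex.normSq (1 / denom γ z ^ 2) := by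
  rw [ModularGroup.im_smul_eq_div_normSq, map_div₀, map_pow, map_one]
  ring

lemma autom_gdot {k : ℂ → ℝ} (hk : IsTest k) (hk2 : ContDiff ℝ 1 k) {v : ℂ → ℝ}
    (hv : ContDiffOn ℝ 1 v {z | 0 < z.im})
    (hinv : ∀ (γ : SL(2, ℤ)) (z : ℍ), v (γ • z : ℍ) = v z) (z : ℍ) :
    autom (fun w => w.im ^ 2 * gdot k v w) z = z.im ^ 2 * gdot (automC k) v z := by
  have hopen : IsOpen {z : ℂ | 0 < z.im} := isOpen_lt continuous_const Complex.continuous_im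
  have hvd : ∀ z : ℍ, DifferentiableAt ℝ v z := fun z =>
    ((hv.contDiffAt (hopen.mem_nhds z.im_pos)).differentiableAt one_ne_zero)
  have hkd : Differentiable ℝ k := hk2.differentiable one_ne_zero
  obtain ⟨U, hU, F, hF⟩ := exists_finset_smul_notMem hk.cpt hk.pos z
  have hev : automC k =ᶠ[𝓝 (z : ℂ)] fun w => ∑ γ ∈ F, (k ∘ mobius γ) w := by
    filter_upwards [eventually_ofComplex_mem hU] with w hw
    exact tsum_eq_sum fun γ hγ => image_eq_zero_of_notMem_tsupport (hF _ hw.2 γ hγ)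
  have hterm : ∀ γ : SL(2, ℤ), (γ • z : ℍ).im ^ 2 * gdot k v (γ • z : ℍ) =
      z.im ^ 2 * gdot (k ∘ mobius γ) v z := by
    intro γ
    have h1 : v =ᶠ[𝓝 (z : ℂ)] v ∘ mobius γ := by
      filter_upwards [eventually_ofComplex_mem (univ_mem : univ ∈ 𝓝 z)] with w hw
      have := hinv γ (ofComplex w)
      have h2 : ((ofComplex w : ℍ) : ℂ) = w := by rw [ofComplex_apply_of_im_pos hw.1]
      rw [h2] at this
      exact this.symm
    have h2 : gdot (k ∘ mobius γ) v z = gdot (k ∘ mobius γ) (v ∘ mobius γ) z := by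
      unfold gdot; rw [h1.fderiv_eq]
    rw [h2, gdot_comp (hasDerivAt_mobius γ z) hkd.differentiableAt
      (by rw [mobius_coe]; exact hvd _), im_smul_sq, mobius_coe]
    ring
  have hsum : gdot (automC k) v z = ∑ γ ∈ F, gdot (k ∘ mobius γ) v z := by
    have hd : ∀ γ ∈ F, DifferentiableAt ℝ (k ∘ mobius γ) (z : ℂ) := fun γ _ =>
      (hk2.contDiffAt.comp _ (contDiffAt_mobius γ z)).differentiableAt one_ne_zero
    unfold gdot
    rw [hev.fderiv_eq, fderiv_fun_sum hd]
    simp only [FunLike.coe_sum, Finset.sum_apply, Finset.sum_mul,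
      ← Finset.sum_add_distrib]
  unfold autom
  simp only [coe_im, hterm]
  rw [hsum, Finset.mul_sum]
  refine tsum_eq_sum fun γ hγ => ?_
  rw [gdot_eq_zero_of_eventually, mul_zero]
  filter_upwards [eventually_ofComplex_mem hU] with w hw
  exact image_eq_zero_of_notMem_tsupport (f := k) (hF _ hw.2 γ hγ)

/-- The hyperbolic Laplacian, normalised to be nonnegative. -/
noncomputable def hypLap (k : ℂ → ℝ) (z : ℂ) : ℝ :=
  -(z.im ^ 2 * (fderiv ℝ (fun w => fderiv ℝ k w 1) z 1 +
    fderiv ℝ (fun w => fderiv ℝ k w Complex.I) z Complex.I))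

lemma contDiff_fderiv_apply {k : ℂ → ℝ} {n : WithTop ℕ∞} (hk : ContDiff ℝ (n + 1) k) (u : ℂ) :
    ContDiff ℝ n (fun w => fderiv ℝ k w u) :=
  (hk.fderiv_right le_rfl).clm_apply contDiff_const

lemma IsTest.mono {E F : Type*} [NormedAddCommGroup E] [NormedAddCommGroup F]
    {k : ℂ → E} {l : ℂ → F} (hk : IsTest k) (hl : Continuous l)
    (h : tsupport l ⊆ tsupport k) : IsTest l :=
  ⟨hl, hk.cpt.of_isClosed_subset (isClosed_tsupport _) h, h.trans hk.pos⟩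

lemma tsupport_fderiv_apply_subset' (k : ℂ → ℝ) (u : ℂ) :
    tsupport (fun w => fderiv ℝ k w u) ⊆ tsupport k := by
  refine (closure_mono ?_).trans (tsupport_fderiv_subset ℝ (f := k))
  intro w hw h
  apply hw
  simp [h]

lemma IsTest.fderiv_apply {k : ℂ → ℝ} (hk : IsTest k) (hk1 : ContDiff ℝ 1 k) (u : ℂ) :
    IsTest (fun w => fderiv ℝ k w u) :=
  hk.mono (contDiff_fderiv_apply (n := 0) (by simpa using hk1) u).continuous
    (tsupport_fderiv_apply_subset' k u)

lemma IsTest.hypLap {k : ℂ → ℝ} (hk : IsTest k) (hk2 : ContDiff ℝ 2 k) : IsTest (hypLap k) := by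
  have h1 : ∀ u : ℂ, ContDiff ℝ 1 (fun w => fderiv ℝ k w u) :=
    contDiff_fderiv_apply (n := 1) (by norm_num; exact hk2)
  have h0 := fun u => ((hk.fderiv_apply (hk2.of_le (by norm_num)) u).fderiv_apply (h1 u) u)
  refine hk.mono ?_ ?_
  · have := (h0 1).cont
    have := (h0 Complex.I).cont
    unfold LinnikSums.hypLap
    fun_prop
  · have hs : ∀ u, tsupport (fun w => fderiv ℝ (fun w => fderiv ℝ k w u) w u) ⊆ tsupport k :=
      fun u => (tsupport_fderiv_apply_subset' _ u).trans (tsupport_fderiv_apply_subset' k u)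
    refine closure_minimal ?_ (isClosed_tsupport k)
    intro w hw
    by_contra hc
    apply hw
    have e1 := image_eq_zero_of_notMem_tsupport (fun h => hc (hs 1 h))
    have e2 := image_eq_zero_of_notMem_tsupport (fun h => hc (hs Complex.I h))
    simp [LinnikSums.hypLap, e1, e2]

/-- A product of a test function with a function continuous on the half-plane is integrable. -/
lemma IsTest.integrable_mul_complex {p q : ℂ → ℝ} (hp : IsTest p)
    (hq : ContinuousOn q {z | 0 < z.im}) : Integrable (fun z => p z * q z) := by
  have hopen : IsOpen {z : ℂ | 0 < z.im} := isOpen_lt continuous_const Complex.continuous_im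
  refine Continuous.integrable_of_hasCompactSupport ?_ hp.cpt.mul_right
  rw [continuous_iff_continuousAt]
  intro z
  by_cases hz : 0 < z.im
  · exact hp.cont.continuousAt.mul (hq.continuousAt (hopen.mem_nhds hz))
  · have : (fun z => p z * q z) =ᶠ[𝓝 z] fun _ => 0 := by
      have h1 : z ∉ tsupport p := fun h => hz (hp.pos h)
      filter_upwards [(isClosed_tsupport p).isOpen_compl.mem_nhds h1] with w hw
      rw [image_eq_zero_of_notMem_tsupport hw, zero_mul]
    exact continuousAt_const.congr this.symm

lemma IsTest.setIntegral_im_pos {p q : ℂ → ℝ} (hp : IsTest p) :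
    ∫ z in {z : ℂ | 0 < z.im}, p z * q z = ∫ z, p z * q z := by
  refine setIntegral_eq_integral_of_forall_compl_eq_zero fun z hz => ?_
  rw [image_eq_zero_of_notMem_tsupport (fun h => hz (hp.pos h)), zero_mul]

lemma integral_fd_gdot {k : ℂ → ℝ} (hk : IsTest k) (hk2 : ContDiff ℝ 2 k) {v : ℂ → ℝ}
    (hv : ContDiffOn ℝ 1 v {z | 0 < z.im})
    (hinv : ∀ (γ : SL(2, ℤ)) (z : ℍ), v (γ • z : ℍ) = v z) :
    ∫ z in 𝒟, z.im ^ 2 * gdot (automC k) v z = ∫ z in 𝒟, autom (hypLap k) z * v z := by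
  have hopen : IsOpen {z : ℂ | 0 < z.im} := isOpen_lt continuous_const Complex.continuous_im
  have hk1 : ContDiff ℝ 1 k := hk2.of_le (by norm_num)
  have h1 : ∀ u : ℂ, ContDiff ℝ 1 (fun w => fderiv ℝ k w u) :=
    contDiff_fderiv_apply (n := 1) (by norm_num; exact hk2)
  have hT1 := fun u => hk.fderiv_apply hk1 u
  have hT2 := fun u => ((hT1 u).fderiv_apply (h1 u) u)
  have hvf : ∀ u : ℂ, ContinuousOn (fun z => fderiv ℝ v z u) {z | 0 < z.im} := fun u =>
    (hv.continuousOn_fderiv_of_isOpen hopen le_rfl).clm_apply continuousOn_const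
  have hi1 := fun u => (hT1 u).integrable_mul_complex (hvf u)
  have hi2 := fun u => (hT1 u).integrable_mul_complex hv.continuousOn
  have hi3 := fun u => (hT2 u).integrable_mul_complex hv.continuousOn
  have ibp : ∀ u : ℂ, ∫ z, fderiv ℝ k z u * fderiv ℝ v z u =
      -∫ z, fderiv ℝ (fun w => fderiv ℝ k w u) z u * v z := fun u =>
    integral_mul_fderiv_eq_neg_fderiv_mul_of_integrable (hi3 u) (hi1 u) (hi2 u)
      (fun z _ => ((h1 u).differentiable one_ne_zero) z)
      (fun z hz => (hv.contDiffAt (hopen.mem_nhds ((hT1 u).pos hz))).differentiableAt one_ne_zero)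
  have eq1 : ∀ z ∈ {z : ℂ | 0 < z.im}, (z.im ^ 2)⁻¹ • (z.im ^ 2 * gdot k v z) = gdot k v z := by
    intro z hz
    rw [smul_eq_mul, inv_mul_cancel_left₀ (pow_ne_zero 2 (ne_of_gt hz))]
  have h_int : IntegrableOn (gdot k v) {z : ℂ | 0 < z.im} := ((hi1 1).add (hi1 Complex.I)).integrableOn
  have hJ : Integrable (fun z : ℍ => ((z:ℂ).im ^ 2 * gdot k v z)) := by
    rw [integrable_uhp_iff (fun z => z.im ^ 2 * gdot k v z)]
    exact h_int.congr_fun (fun z hz => (eq1 z hz).symm) measurableSet_im_pos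
  have hvc : Continuous (fun z : ℍ => v z) :=
    hv.continuousOn.comp_continuous continuous_coe fun z => z.im_pos
  rw [(hk.hypLap hk2).integral_autom_mul hvc hinv]
  simp_rw [← autom_gdot hk hk1 hv hinv]
  unfold autom
  rw [integral_fd_tsum (J := fun z : ℍ => (z:ℂ).im ^ 2 * gdot k v z) hJ, smul_eq_mul]
  congr 1
  rw [integral_uhp (fun z => z.im ^ 2 * gdot k v z), integral_uhp (fun z => hypLap k z * v z),
    setIntegral_congr_fun measurableSet_im_pos eq1]
  have eq2 : ∀ z ∈ {z : ℂ | 0 < z.im}, (z.im ^ 2)⁻¹ • (hypLap k z * v z) =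
      -(fderiv ℝ (fun w => fderiv ℝ k w 1) z 1 * v z +
        fderiv ℝ (fun w => fderiv ℝ k w Complex.I) z Complex.I * v z) := by
    intro z hz
    have : z.im ≠ 0 := ne_of_gt hz
    simp only [hypLap, smul_eq_mul]
    field_simp
  rw [setIntegral_congr_fun measurableSet_im_pos eq2, integral_neg,
    integral_add (hi3 1).integrableOn (hi3 Complex.I).integrableOn,
    (hT2 1).setIntegral_im_pos, (hT2 Complex.I).setIntegral_im_pos]
  unfold gdot
  rw [integral_add (hi1 1).integrableOn (hi1 Complex.I).integrableOn,
    (hT1 1).setIntegral_im_pos, (hT1 Complex.I).setIntegral_im_pos, ibp, ibp]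
  ring

/-! ### One-dimensional inequalities -/

/-- A Hardy-type inequality on `[1, R]` with a boundary term. -/
lemma hardy_interval {R : ℝ} (hR : 1 < R) {w w' : ℝ → ℝ}
    (hw : ∀ r ∈ Icc 1 R, HasDerivAt w (w' r) r) (hw' : ContinuousOn w' (Icc 1 R)) (hwR : w R = 0)
    {a : ℝ} (ha : a = ∫ r in (1:ℝ)..R, w r / r ^ 2) :
    1 / 4 * ((∫ r in (1:ℝ)..R, w r ^ 2 / r ^ 2) - a ^ 2) + 1 / 2 * (w 1 - a) ^ 2 ≤
      ∫ r in (1:ℝ)..R, w' r ^ 2 := by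
  have hR1 : (1:ℝ) ≤ R := hR.le
  have huI : uIcc 1 R = Icc 1 R := uIcc_of_le hR1
  have hwc : ContinuousOn w (Icc 1 R) := fun r hr => (hw r hr).continuousAt.continuousWithinAt
  have hr0 : ∀ r ∈ Icc 1 R, r ≠ 0 := fun r hr => by have := hr.1; linarith
  have hr2 : ∀ r ∈ Icc 1 R, r ^ 2 ≠ 0 := fun r hr => pow_ne_zero 2 (hr0 r hr)
  have hid : ContinuousOn (fun r : ℝ => r) (Icc 1 R) := continuousOn_id
  have hii : ∀ f : ℝ → ℝ, ContinuousOn f (Icc 1 R) → IntervalIntegrable f volume 1 R := fun f hf =>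
    ContinuousOn.intervalIntegrable (by rwa [huI])
  set b := w 1 - a with hb
  have i1 : IntervalIntegrable (fun r => w' r ^ 2) volume 1 R := hii _ (hw'.pow 2)
  have i2 : IntervalIntegrable (fun r => w r ^ 2 / r ^ 2) volume 1 R :=
    hii _ ((hwc.pow 2).div (hid.pow 2) hr2)
  have i3 : IntervalIntegrable (fun r => w r / r ^ 2) volume 1 R :=
    hii _ (hwc.div (hid.pow 2) hr2)
  have i4 : IntervalIntegrable (fun r : ℝ => 1 / r ^ 2) volume 1 R :=
    hii _ (continuousOn_const.div (hid.pow 2) hr2)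
  have e4 : ∫ r in (1:ℝ)..R, 1 / r ^ 2 = 1 - 1 / R := by
    have := intervalIntegral.integral_eq_sub_of_hasDerivAt (a := 1) (b := R)
      (f := fun r : ℝ => - r⁻¹) (f' := fun r => 1 / r ^ 2) (fun r hr => by
        rw [huI] at hr
        refine (hasDerivAt_inv (hr0 r hr)).fun_neg.congr_deriv ?_
        simp) i4
    rw [this]; simp; ring
  have hsq : 0 ≤ ∫ r in (1:ℝ)..R, (w' r - (w r - a) / (2 * r) + b / r) ^ 2 :=
    intervalIntegral.integral_nonneg hR1 fun r _ => sq_nonneg _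
  have hFTC := intervalIntegral.integral_eq_sub_of_hasDerivAt (a := 1) (b := R)
      (f := fun r : ℝ => (w r - a) ^ 2 * (2 * r)⁻¹ - 2 * b * ((w r - a) * r⁻¹))
      (f' := fun r => (2 * (w r - a) * w' r * (2 * r)⁻¹ - (w r - a) ^ 2 * (2 * r ^ 2)⁻¹)
        - 2 * b * (w' r * r⁻¹ - (w r - a) * (r ^ 2)⁻¹)) (fun r hr => by
        rw [huI] at hr
        have h0 := hr0 r hr
        have hu : HasDerivAt (fun r => w r - a) (w' r) r := (hw r hr).sub_const a
        have h1 := hasDerivAt_inv h0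
        have h2 : HasDerivAt (fun r : ℝ => (2 * r)⁻¹) (-(2 * r ^ 2)⁻¹) r := by
          simp only [mul_inv]
          exact (h1.const_mul (2⁻¹ : ℝ)).congr_deriv (by ring)
        refine (((hu.fun_pow 2).fun_mul h2).fun_sub
          ((hu.fun_mul h1).const_mul (2 * b))).congr_deriv ?_
        simp
        ring) (by
        apply hii
        have hi1 : ContinuousOn (fun r : ℝ => r⁻¹) (Icc 1 R) := hid.inv₀ hr0
        have hi2 : ContinuousOn (fun r : ℝ => (r ^ 2)⁻¹) (Icc 1 R) := (hid.pow 2).inv₀ hr2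
        have hi3 : ContinuousOn (fun r : ℝ => (2 * r)⁻¹) (Icc 1 R) :=
          (continuousOn_const.mul hid).inv₀ fun r hr => mul_ne_zero two_ne_zero (hr0 r hr)
        have hi4 : ContinuousOn (fun r : ℝ => (2 * r ^ 2)⁻¹) (Icc 1 R) :=
          (continuousOn_const.mul (hid.pow 2)).inv₀
            fun r hr => mul_ne_zero two_ne_zero (hr2 r hr)
        fun_prop)
  have hpt : ∀ r ∈ uIcc 1 R, (w' r - (w r - a) / (2 * r) + b / r) ^ 2 +
      ((2 * (w r - a) * w' r * (2 * r)⁻¹ - (w r - a) ^ 2 * (2 * r ^ 2)⁻¹)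
        - 2 * b * (w' r * r⁻¹ - (w r - a) * (r ^ 2)⁻¹)) =
      w' r ^ 2 + (-(1/4)) * (w r ^ 2 / r ^ 2) + (a / 2 + b) * (w r / r ^ 2)
        + (b ^ 2 - a ^ 2 / 4 - b * a) * (1 / r ^ 2) := by
    intro r hr
    rw [huI] at hr
    have h0 := hr0 r hr
    field_simp
    ring
  have hsum := intervalIntegral.integral_congr (μ := volume) hpt
  rw [intervalIntegral.integral_add, intervalIntegral.integral_add, intervalIntegral.integral_add,
    intervalIntegral.integral_add, intervalIntegral.integral_const_mul,
    intervalIntegral.integral_const_mul, intervalIntegral.integral_const_mul, ← ha, e4,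
    hFTC, hwR] at hsum
  · have hRi : 0 < 1 / R := by positivity
    have e5 : (2 * R)⁻¹ = 1 / R / 2 := by field_simp
    have e6 : R⁻¹ = 1 / R := by simp
    simp only [e5, e6] at hsum
    have hbw : w 1 = b + a := by rw [hb]; ring
    rw [hbw] at hsum
    have : 0 ≤ (1 / R) * (b + a / 2) ^ 2 := by positivity
    norm_num at hsum ⊢
    nlinarith
  · exact i1
  · exact i2.const_mul _
  · exact i1.add (i2.const_mul _)
  · exact i3.const_mul _
  · exact (i1.add (i2.const_mul _)).add (i3.const_mul _)
  · exact i4.const_mul _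
  · apply hii
    have hi1 : ContinuousOn (fun r : ℝ => b / r) (Icc 1 R) := continuousOn_const.div hid hr0
    have hi2 : ContinuousOn (fun r : ℝ => (w r - a) / (2 * r)) (Icc 1 R) :=
      (hwc.sub continuousOn_const).div (continuousOn_const.mul hid)
        fun r hr => mul_ne_zero two_ne_zero (hr0 r hr)
    fun_prop
  · apply hii
    have hi1 : ContinuousOn (fun r : ℝ => r⁻¹) (Icc 1 R) := hid.inv₀ hr0
    have hi2 : ContinuousOn (fun r : ℝ => (r ^ 2)⁻¹) (Icc 1 R) := (hid.pow 2).inv₀ hr2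
    have hi3 : ContinuousOn (fun r : ℝ => (2 * r)⁻¹) (Icc 1 R) :=
      (continuousOn_const.mul hid).inv₀ fun r hr => mul_ne_zero two_ne_zero (hr0 r hr)
    have hi4 : ContinuousOn (fun r : ℝ => (2 * r ^ 2)⁻¹) (Icc 1 R) :=
      (continuousOn_const.mul (hid.pow 2)).inv₀
        fun r hr => mul_ne_zero two_ne_zero (hr2 r hr)
    fun_prop

lemma sq_integral_div_sq_le {R : ℝ} (hR : 1 < R) {p : ℝ → ℝ} (hp : ContinuousOn p (Icc 1 R)) :
    (∫ r in (1:ℝ)..R, p r / r ^ 2) ^ 2 ≤ ∫ r in (1:ℝ)..R, p r ^ 2 := by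
  have hR1 : (1:ℝ) ≤ R := hR.le
  have huI : uIcc 1 R = Icc 1 R := uIcc_of_le hR1
  have hr0 : ∀ r ∈ Icc 1 R, r ≠ 0 := fun r hr => by have := hr.1; linarith
  have hr2 : ∀ r ∈ Icc 1 R, r ^ 2 ≠ 0 := fun r hr => pow_ne_zero 2 (hr0 r hr)
  have hid : ContinuousOn (fun r : ℝ => r) (Icc 1 R) := continuousOn_id
  have hii : ∀ f : ℝ → ℝ, ContinuousOn f (Icc 1 R) → IntervalIntegrable f volume 1 R := fun f hf =>
    ContinuousOn.intervalIntegrable (by rwa [huI])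
  have i4 : IntervalIntegrable (fun r : ℝ => 1 / r ^ 2) volume 1 R :=
    hii _ (continuousOn_const.div (hid.pow 2) hr2)
  have e4 : ∫ r in (1:ℝ)..R, 1 / r ^ 2 = 1 - 1 / R := by
    have := intervalIntegral.integral_eq_sub_of_hasDerivAt (a := 1) (b := R)
      (f := fun r : ℝ => - r⁻¹) (f' := fun r => 1 / r ^ 2) (fun r hr => by
        rw [huI] at hr
        refine (hasDerivAt_inv (hr0 r hr)).fun_neg.congr_deriv ?_
        simp) i4
    rw [this]; simp; ring
  set q := ∫ r in (1:ℝ)..R, p r / r ^ 2 with hq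
  have hpq : ContinuousOn (fun r => p r / r ^ 2) (Icc 1 R) := hp.div (hid.pow 2) hr2
  have hle : ∫ r in (1:ℝ)..R, (2 * q * (p r / r ^ 2) + (-q ^ 2) * (1 / r ^ 2)) ≤
      ∫ r in (1:ℝ)..R, p r ^ 2 := by
    refine intervalIntegral.integral_mono_on hR1 ?_ (hii _ (hp.pow 2)) fun r hr => ?_
    · exact ((hii _ hpq).const_mul _).add (i4.const_mul _)
    · have h1 : 1 / r ^ 2 ≤ 1 := by
        rw [div_le_one (by have := hr.1; positivity)]
        have := hr.1
        nlinarith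
      have h2 : 0 ≤ 1 / r ^ 2 := by positivity
      have e : p r / r ^ 2 = p r * (1 / r ^ 2) := by ring
      rw [e]
      set t := 1 / r ^ 2
      nlinarith [sq_nonneg (p r - q * t), mul_nonneg h2 (sub_nonneg.2 h1), sq_nonneg q,
        mul_nonneg (sq_nonneg q) (mul_nonneg h2 (sub_nonneg.2 h1))]
  rw [intervalIntegral.integral_add ((hii _ hpq).const_mul _) (i4.const_mul _),
    intervalIntegral.integral_const_mul, intervalIntegral.integral_const_mul, ← hq, e4] at hle
  have : 0 ≤ q ^ 2 * (1 / R) := by positivity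
  nlinarith

/-- On an interval of length one, a function vanishing somewhere is controlled by its derivative. -/
lemma sq_le_integral_sq_deriv {a a' : ℝ → ℝ}
    (ha : ∀ x ∈ Icc (-(1/2)) (1/2 : ℝ), HasDerivAt a (a' x) x)
    (ha' : ContinuousOn a' (Icc (-(1/2)) (1/2 : ℝ))) {x₀ : ℝ} (hx₀ : x₀ ∈ Icc (-(1/2)) (1/2 : ℝ))
    (h0 : a x₀ = 0) {x : ℝ} (hx : x ∈ Icc (-(1/2)) (1/2 : ℝ)) :
    a x ^ 2 ≤ ∫ t in (-(1/2) : ℝ)..(1/2), a' t ^ 2 := by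
  set D := ∫ t in (-(1/2) : ℝ)..(1/2), a' t ^ 2 with hD
  have hle : (-(1/2) : ℝ) ≤ 1/2 := by norm_num
  have key : ∀ x₁ ∈ Icc (-(1/2)) (1/2 : ℝ), ∀ x₂ ∈ Icc (-(1/2)) (1/2 : ℝ), x₁ ≤ x₂ →
      (a x₂ - a x₁) ^ 2 ≤ D := by
    intro x₁ h1 x₂ h2 h12
    have hsub : Icc x₁ x₂ ⊆ Icc (-(1/2)) (1/2 : ℝ) := Icc_subset_Icc h1.1 h2.2
    have hc : ContinuousOn a' (uIcc x₁ x₂) := by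
      rw [uIcc_of_le h12]; exact ha'.mono hsub
    have hF := intervalIntegral.integral_eq_sub_of_hasDerivAt (a := x₁) (b := x₂)
      (fun x hx => ha x (hsub (by rwa [uIcc_of_le h12] at hx))) hc.intervalIntegrable
    set q := a x₂ - a x₁
    have hp : 0 ≤ ∫ t in x₁..x₂, (a' t - q) ^ 2 :=
      intervalIntegral.integral_nonneg h12 fun t _ => sq_nonneg _
    have hi2 : IntervalIntegrable (fun t => a' t ^ 2) volume x₁ x₂ := (hc.pow 2).intervalIntegrable
    have e : ∫ t in x₁..x₂, (a' t - q) ^ 2 =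
        (∫ t in x₁..x₂, a' t ^ 2) - 2 * q * q + (x₂ - x₁) * q ^ 2 := by
      have : ∀ t, (a' t - q) ^ 2 = a' t ^ 2 - 2 * q * a' t + q ^ 2 := fun t => by ring
      simp_rw [this]
      rw [intervalIntegral.integral_add (hi2.sub (hc.intervalIntegrable.const_mul _))
        intervalIntegrable_const, intervalIntegral.integral_sub hi2
        (hc.intervalIntegrable.const_mul _), intervalIntegral.integral_const_mul, hF]
      simp
    have hm : ∫ t in x₁..x₂, a' t ^ 2 ≤ D := by
      refine intervalIntegral.integral_mono_interval h1.1 h12 h2.2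
        (Eventually.of_forall fun t => sq_nonneg _) ?_
      refine ContinuousOn.intervalIntegrable ?_
      rw [uIcc_of_le hle]
      exact ha'.pow 2
    have : (x₂ - x₁) * q ^ 2 ≤ 1 * q ^ 2 :=
      mul_le_mul_of_nonneg_right (by linarith [h1.1, h2.2]) (sq_nonneg q)
    nlinarith
  rcases le_total x₀ x with h | h
  · have := key _ hx₀ _ hx h
    rwa [h0, sub_zero] at this
  · have := key _ hx _ hx₀ h
    rw [h0] at this
    nlinarith

lemma continuousOn_parametric_integral {α β R : ℝ} (hαβ : α ≤ β) (hR : 1 ≤ R) {f : ℝ → ℝ → ℝ}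
    (hf : ContinuousOn (Function.uncurry f) (Icc α β ×ˢ Icc 1 R)) :
    ContinuousOn (fun x => ∫ r in (1:ℝ)..R, f x r) (Icc α β) := by
  have hc : Continuous (Function.uncurry fun x r : ℝ =>
      f (projIcc α β hαβ x) (projIcc 1 R hR r)) := by
    refine hf.comp_continuous (f := fun p : ℝ × ℝ =>
      (((projIcc α β hαβ p.1 : Icc α β) : ℝ), ((projIcc 1 R hR p.2 : Icc 1 R) : ℝ))) ?_ ?_
    · exact (continuous_subtype_val.comp (continuous_projIcc.comp continuous_fst)).prodMk
        (continuous_subtype_val.comp (continuous_projIcc.comp continuous_snd))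
    · intro p
      exact ⟨Subtype.mem _, Subtype.mem _⟩
  refine (intervalIntegral.continuous_parametric_intervalIntegral_of_continuous' (μ := volume) hc 1 R
    ).continuousOn.congr fun x hx => ?_
  refine intervalIntegral.integral_congr fun r hr => ?_
  rw [uIcc_of_le hR] at hr
  simp only [projIcc_of_mem hαβ hx, projIcc_of_mem hR hr]

lemma hasDerivAt_parametric_integral {α β R : ℝ} (hR : 1 ≤ R) {f f' : ℝ → ℝ → ℝ}
    (hf : ContinuousOn (Function.uncurry f) (Icc α β ×ˢ Icc 1 R))
    (hf' : ContinuousOn (Function.uncurry f') (Icc α β ×ˢ Icc 1 R))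
    (hd : ∀ x ∈ Icc α β, ∀ r ∈ Icc 1 R, HasDerivAt (fun x => f x r) (f' x r) x)
    {x : ℝ} (hx : x ∈ Ioo α β) :
    HasDerivAt (fun x => ∫ r in (1:ℝ)..R, f x r) (∫ r in (1:ℝ)..R, f' x r) x := by
  obtain ⟨M, hM⟩ := (isCompact_Icc.prod isCompact_Icc).exists_bound_of_continuousOn hf'
  have hsl : ∀ (g : ℝ → ℝ → ℝ), ContinuousOn (Function.uncurry g) (Icc α β ×ˢ Icc 1 R) →
      ∀ y ∈ Icc α β, ContinuousOn (g y) (uIcc 1 R) := by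
    intro g hg y hy
    rw [uIcc_of_le hR]
    exact hg.comp (f := fun r => (y, r)) (by fun_prop) fun r hr => ⟨hy, hr⟩
  have hms : ∀ (g : ℝ → ℝ → ℝ), ContinuousOn (Function.uncurry g) (Icc α β ×ˢ Icc 1 R) →
      ∀ y ∈ Icc α β, AEStronglyMeasurable (g y) (volume.restrict (uIoc 1 R)) := fun g hg y hy =>
    ((hsl g hg y hy).mono uIoc_subset_uIcc).aestronglyMeasurable measurableSet_uIoc
  refine (intervalIntegral.hasDerivAt_integral_of_dominated_loc_of_deriv_le
    (s := Ioo α β) (bound := fun _ => M) (isOpen_Ioo.mem_nhds hx) ?_ ?_ ?_ ?_ ?_ ?_).2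
  · filter_upwards [isOpen_Ioo.mem_nhds hx] with y hy
    exact hms f hf y (Ioo_subset_Icc_self hy)
  · exact (hsl f hf x (Ioo_subset_Icc_self hx)).intervalIntegrable
  · exact hms f' hf' x (Ioo_subset_Icc_self hx)
  · refine Eventually.of_forall fun r hr y hy => ?_
    have hr' := uIoc_subset_uIcc hr
    rw [uIcc_of_le hR] at hr'
    exact hM (y, r) ⟨Ioo_subset_Icc_self hy, hr'⟩
  · exact intervalIntegrable_const
  · refine Eventually.of_forall fun r hr y hy => ?_
    have hr' := uIoc_subset_uIcc hr
    rw [uIcc_of_le hR] at hr'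
    exact hd y (Ioo_subset_Icc_self hy) r hr'

/-- The pointwise inequality behind the spectral gap. -/
lemma spectral_gap_pointwise {h q b x : ℝ} (h1 : 4 / 5 ≤ h) (hx : |x| ≤ 1 / 2) :
    (q + x / h ^ 2 * b) ^ 2 ≤ 12 / 5 * (h * q ^ 2 + b ^ 2 / (2 * h)) := by
  have h0 : 0 < h := by linarith
  obtain ⟨t, ht⟩ : ∃ t, t = 1 / h := ⟨_, rfl⟩
  have ht0 : 0 < t := by rw [ht]; positivity
  have ht1 : t ≤ 5 / 4 := by rw [ht, div_le_iff₀ h0]; linarith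
  have hht : h * t = 1 := by rw [ht]; field_simp
  have hx2 : x ^ 2 ≤ 1 / 4 := by rw [← sq_abs]; nlinarith [abs_nonneg x]
  have e1 : x / h ^ 2 * b = t ^ 2 * (x * b) := by rw [ht]; field_simp
  have e2 : h * q ^ 2 + b ^ 2 / (2 * h) = h * q ^ 2 + t * b ^ 2 / 2 := by rw [ht]; field_simp
  rw [e1, e2]
  have e3 : (q + t ^ 2 * (x * b)) ^ 2 ≤ (h * q ^ 2 + t * b ^ 2 / 2) * (t + 2 * x ^ 2 * t ^ 3) := by
    have : (h * q ^ 2 + t * b ^ 2 / 2) * (t + 2 * x ^ 2 * t ^ 3) - (q + t ^ 2 * (x * b)) ^ 2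
        = (h * t - 1) * q ^ 2 + (h * t - 1) * (2 * x ^ 2 * t ^ 2 * q ^ 2) +
          1 / 2 * t ^ 2 * (2 * x * q - b) ^ 2 := by ring
    rw [hht] at this
    have : 0 ≤ 1 / 2 * t ^ 2 * (2 * x * q - b) ^ 2 := by positivity
    linarith
  refine e3.trans ?_
  rw [mul_comm]
  refine mul_le_mul_of_nonneg_right ?_ (by positivity)
  have : t ^ 3 ≤ (5 / 4) ^ 3 := pow_le_pow_left₀ ht0.le ht1 3
  have : x ^ 2 * t ^ 3 ≤ 1 / 4 * (5 / 4) ^ 3 := mul_le_mul hx2 this (by positivity) (by norm_num)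
  nlinarith

/-- A spectral gap for functions given in coordinates adapted to the fundamental domain. -/
lemma spectral_gap_coordinates {R : ℝ} (hR : 1 < R) {h : ℝ → ℝ} {V Vr P : ℝ → ℝ → ℝ}
    (hhc : ContinuousOn h (Icc (-(3/5)) (3/5))) (hh : ∀ x ∈ Icc (-(3/5)) (3/5 : ℝ), 4 / 5 ≤ h x)
    (hV : ContinuousOn (Function.uncurry V) (Icc (-(3/5)) (3/5) ×ˢ Icc 1 R))
    (hVr : ContinuousOn (Function.uncurry Vr) (Icc (-(3/5)) (3/5) ×ˢ Icc 1 R))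
    (hP : ContinuousOn (Function.uncurry P) (Icc (-(3/5)) (3/5) ×ˢ Icc 1 R))
    (hdr : ∀ x ∈ Icc (-(3/5)) (3/5 : ℝ), ∀ r ∈ Icc 1 R, HasDerivAt (V x) (Vr x r) r)
    (hdx : ∀ x ∈ Icc (-(3/5)) (3/5 : ℝ), ∀ r ∈ Icc 1 R,
      HasDerivAt (fun x => V x r) (P x r - x / h x ^ 2 * (r * Vr x r)) x)
    (hVR : ∀ x ∈ Icc (-(3/5)) (3/5 : ℝ), V x R = 0)
    (hmean : ∫ x in (-(1/2) : ℝ)..(1/2), (∫ r in (1:ℝ)..R, V x r / r ^ 2) / h x = 0) :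
    1 / 4 * ∫ x in (-(1/2) : ℝ)..(1/2), (∫ r in (1:ℝ)..R, V x r ^ 2 / r ^ 2) / h x ≤
      ∫ x in (-(1/2) : ℝ)..(1/2),
        (h x * (∫ r in (1:ℝ)..R, P x r ^ 2) + (∫ r in (1:ℝ)..R, Vr x r ^ 2) / h x) := by
  have hR1 : (1:ℝ) ≤ R := hR.le
  have hle : (-(1/2) : ℝ) ≤ 1/2 := by norm_num
  have hle' : (-(3/5) : ℝ) ≤ 3/5 := by norm_num
  have hsub : Icc (-(1/2) : ℝ) (1/2) ⊆ Icc (-(3/5)) (3/5) := Icc_subset_Icc (by norm_num) (by norm_num)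
  have hsub' : Icc (-(1/2) : ℝ) (1/2) ⊆ Ioo (-(3/5)) (3/5) :=
    fun x hx => ⟨by linarith [hx.1], by linarith [hx.2]⟩
  have hh0 : ∀ x ∈ Icc (-(3/5)) (3/5 : ℝ), h x ≠ 0 := fun x hx => by linarith [hh x hx]
  have hsnd : ContinuousOn (fun p : ℝ × ℝ => p.2) (Icc (-(3/5)) (3/5) ×ˢ Icc 1 R) :=
    continuous_snd.continuousOn
  have hfst : ContinuousOn (fun p : ℝ × ℝ => p.1) (Icc (-(3/5)) (3/5) ×ˢ Icc 1 R) :=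
    continuous_fst.continuousOn
  have hr0 : ∀ p ∈ Icc (-(3/5) : ℝ) (3/5) ×ˢ Icc 1 R, p.2 ^ 2 ≠ 0 := fun p hp => by
    have := hp.2.1
    positivity
  have hV2 : ContinuousOn (Function.uncurry fun x r => V x r / r ^ 2)
      (Icc (-(3/5)) (3/5) ×ˢ Icc 1 R) := hV.div (hsnd.pow 2) hr0
  have hhp : ContinuousOn (fun p : ℝ × ℝ => h p.1) (Icc (-(3/5)) (3/5) ×ˢ Icc 1 R) :=
    hhc.comp hfst fun p hp => hp.1
  have hD2 : ContinuousOn (Function.uncurry fun x r =>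
      (P x r - x / h x ^ 2 * (r * Vr x r)) / r ^ 2) (Icc (-(3/5)) (3/5) ×ˢ Icc 1 R) :=
    (hP.sub ((hfst.div (hhp.pow 2) fun p hp => pow_ne_zero 2 (hh0 _ hp.1)).mul
      (hsnd.mul hVr))).div (hsnd.pow 2) hr0
  have hP2 : ContinuousOn (Function.uncurry fun x r => P x r / r ^ 2)
      (Icc (-(3/5)) (3/5) ×ˢ Icc 1 R) := hP.div (hsnd.pow 2) hr0
  set a : ℝ → ℝ := fun x => ∫ r in (1:ℝ)..R, V x r / r ^ 2 with ha
  set q : ℝ → ℝ := fun x => ∫ r in (1:ℝ)..R, P x r / r ^ 2 with hq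
  set b : ℝ → ℝ := fun x => V x 1 - a x with hb
  set I : ℝ → ℝ := fun x => ∫ r in (1:ℝ)..R, V x r ^ 2 / r ^ 2 with hI
  set A : ℝ → ℝ := fun x => ∫ r in (1:ℝ)..R, P x r ^ 2 with hA
  set B : ℝ → ℝ := fun x => ∫ r in (1:ℝ)..R, Vr x r ^ 2 with hB
  have hac : ContinuousOn a (Icc (-(3/5)) (3/5)) := continuousOn_parametric_integral hle' hR1 hV2
  have hqc : ContinuousOn q (Icc (-(3/5)) (3/5)) := continuousOn_parametric_integral hle' hR1 hP2
  have hIc : ContinuousOn I (Icc (-(3/5)) (3/5)) := continuousOn_parametric_integral hle' hR1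
    ((hV.pow 2).div (hsnd.pow 2) hr0)
  have hAc : ContinuousOn A (Icc (-(3/5)) (3/5)) :=
    continuousOn_parametric_integral hle' hR1 (hP.pow 2)
  have hBc : ContinuousOn B (Icc (-(3/5)) (3/5)) :=
    continuousOn_parametric_integral hle' hR1 (hVr.pow 2)
  have hbc : ContinuousOn b (Icc (-(3/5)) (3/5)) :=
    (hV.comp (f := fun x => (x, (1:ℝ))) (by fun_prop) fun x hx => ⟨hx, left_mem_Icc.2 hR1⟩).sub hac
  have hslice : ∀ (g : ℝ → ℝ → ℝ),
      ContinuousOn (Function.uncurry g) (Icc (-(3/5)) (3/5) ×ˢ Icc 1 R) →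
      ∀ x ∈ Icc (-(3/5)) (3/5 : ℝ), ContinuousOn (g x) (Icc 1 R) := fun g hg x hx =>
    hg.comp (f := fun r => (x, r)) (by fun_prop) fun r hr => ⟨hx, hr⟩
  have hii : ∀ g : ℝ → ℝ, ContinuousOn g (Icc (-(3/5)) (3/5)) →
      IntervalIntegrable g volume (-(1/2)) (1/2) := fun g hg =>
    ContinuousOn.intervalIntegrable (by rw [uIcc_of_le hle]; exact hg.mono hsub)
  -- the derivative of `a`
  have hda : ∀ x ∈ Icc (-(1/2) : ℝ) (1/2), HasDerivAt a (q x + x / h x ^ 2 * b x) x := by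
    intro x hx
    have hx' := hsub hx
    have h1 := hasDerivAt_parametric_integral hR1 hV2 hD2
      (fun x hx r hr => (hdx x hx r hr).div_const _) (hsub' hx)
    have hrr : ∀ r ∈ uIcc 1 R, r ≠ 0 := fun r hr => by
      rw [uIcc_of_le hR1] at hr; linarith [hr.1]
    have hri : ContinuousOn (fun r : ℝ => r⁻¹) (uIcc 1 R) := continuousOn_id.inv₀ hrr
    have hri2 : ContinuousOn (fun r : ℝ => (r ^ 2)⁻¹) (uIcc 1 R) :=
      (continuousOn_id.pow 2).inv₀ fun r hr => pow_ne_zero 2 (hrr r hr)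
    have hVrs : ContinuousOn (Vr x) (uIcc 1 R) := by
      rw [uIcc_of_le hR1]; exact hslice _ hVr x hx'
    have hVs : ContinuousOn (V x) (uIcc 1 R) := by
      rw [uIcc_of_le hR1]; exact hslice _ hV x hx'
    have hPs : ContinuousOn (P x) (uIcc 1 R) := by
      rw [uIcc_of_le hR1]; exact hslice _ hP x hx'
    have hF := intervalIntegral.integral_eq_sub_of_hasDerivAt (a := 1) (b := R)
      (f := fun r => V x r * r⁻¹) (f' := fun r => Vr x r * r⁻¹ + V x r * (-(r ^ 2)⁻¹))
      (fun r hr => (hdr x hx' r (by rwa [uIcc_of_le hR1] at hr)).fun_mul (hasDerivAt_inv (hrr r hr)))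
      ((hVrs.mul hri).add (hVs.mul hri2.neg)).intervalIntegrable
    have ji1 : IntervalIntegrable (fun r => Vr x r * r⁻¹) volume 1 R :=
      (hVrs.mul hri).intervalIntegrable
    have ji2 : IntervalIntegrable (fun r => V x r * (-(r ^ 2)⁻¹)) volume 1 R :=
      (hVs.mul hri2.neg).intervalIntegrable
    rw [intervalIntegral.integral_add ji1 ji2] at hF
    have e1 : ∫ r in (1:ℝ)..R, V x r * (-(r ^ 2)⁻¹) = - a x := by
      rw [ha, ← intervalIntegral.integral_neg]
      refine intervalIntegral.integral_congr fun r _ => ?_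
      simp [div_eq_mul_inv]
    have e2 : ∫ r in (1:ℝ)..R, Vr x r * r⁻¹ = - b x := by
      rw [e1, hVR x hx'] at hF
      rw [hb]
      simp only
      norm_num at hF
      linarith
    refine h1.congr_deriv ?_
    have e3 : ∫ r in (1:ℝ)..R, (P x r - x / h x ^ 2 * (r * Vr x r)) / r ^ 2 =
        ∫ r in (1:ℝ)..R, (P x r / r ^ 2 - x / h x ^ 2 * (Vr x r * r⁻¹)) := by
      refine intervalIntegral.integral_congr fun r hr => ?_
      have := hrr r hr
      field_simp
    rw [e3, intervalIntegral.integral_sub, intervalIntegral.integral_const_mul, e2]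
    · ring
    · exact (hPs.div (continuousOn_id.pow 2)
        fun r hr => pow_ne_zero 2 (hrr r hr)).intervalIntegrable
    · exact ji1.const_mul _
  have hda_c : ContinuousOn (fun x => q x + x / h x ^ 2 * b x) (Icc (-(3/5)) (3/5)) :=
    hqc.add ((continuousOn_id.div (hhc.pow 2) fun x hx => pow_ne_zero 2 (hh0 x hx)).mul hbc)
  -- `a` vanishes somewhere
  obtain ⟨x₀, hx₀, hax₀⟩ : ∃ x₀ ∈ Icc (-(1/2)) (1/2 : ℝ), a x₀ = 0 := by
    by_contra! hne
    have hpre : IsPreconnected (a '' Icc (-(1/2) : ℝ) (1/2)) :=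
      isPreconnected_Icc.image a (hac.mono hsub)
    have hahc : ContinuousOn (fun x => a x / h x) (Icc (-(1/2)) (1/2)) :=
      (hac.div hhc hh0).mono hsub
    have hmem : (-(1/2) : ℝ) ∈ Icc (-(1/2)) (1/2 : ℝ) := left_mem_Icc.2 hle
    rcases lt_or_gt_of_ne (hne _ hmem) with h1 | h1
    · have hneg : ∀ x ∈ Icc (-(1/2) : ℝ) (1/2), a x < 0 := by
        intro x hx
        by_contra! hx0
        obtain ⟨y, hy, hy0⟩ := hpre.ordConnected.out ⟨_, hmem, rfl⟩ ⟨x, hx, rfl⟩ ⟨h1.le, hx0⟩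
        exact hne y hy hy0
      have : 0 < ∫ x in (-(1/2) : ℝ)..(1/2), -(a x / h x) := by
        refine intervalIntegral.intervalIntegral_pos_of_pos_on ?_ ?_ (by norm_num)
        · exact (hii _ (hac.div hhc hh0)).neg
        · intro x hx
          have hx' := Ioo_subset_Icc_self hx
          have := hneg x hx'
          have h3 := hh x (hsub hx')
          rw [← neg_div]
          exact div_pos (by linarith) (by linarith)
      rw [intervalIntegral.integral_neg, hmean] at this
      simp at this
    · have hpos : ∀ x ∈ Icc (-(1/2) : ℝ) (1/2), 0 < a x := by
        intro x hx
        by_contra! hx0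
        obtain ⟨y, hy, hy0⟩ := hpre.ordConnected.out ⟨x, hx, rfl⟩ ⟨_, hmem, rfl⟩ ⟨hx0, h1.le⟩
        exact hne y hy hy0
      have : 0 < ∫ x in (-(1/2) : ℝ)..(1/2), a x / h x := by
        refine intervalIntegral.intervalIntegral_pos_of_pos_on (hii _ (hac.div hhc hh0)) ?_
          (by norm_num)
        intro x hx
        have hx' := Ioo_subset_Icc_self hx
        have h3 := hh x (hsub hx')
        exact div_pos (hpos x hx') (by linarith)
      rw [hmean] at this
      exact lt_irrefl _ this
  -- the Poincaré step
  set J := ∫ x in (-(1/2) : ℝ)..(1/2), (h x * q x ^ 2 + b x ^ 2 / (2 * h x)) with hJ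
  have hJc : ContinuousOn (fun x => h x * q x ^ 2 + b x ^ 2 / (2 * h x)) (Icc (-(3/5)) (3/5)) :=
    (hhc.mul (hqc.pow 2)).add ((hbc.pow 2).div (continuousOn_const.mul hhc)
      fun x hx => mul_ne_zero two_ne_zero (hh0 x hx))
  have hder : ∫ x in (-(1/2) : ℝ)..(1/2), (q x + x / h x ^ 2 * b x) ^ 2 ≤ 12 / 5 * J := by
    rw [hJ, ← intervalIntegral.integral_const_mul]
    refine intervalIntegral.integral_mono_on hle (hii _ (hda_c.pow 2)) ((hii _ hJc).const_mul _)
      fun x hx => spectral_gap_pointwise (hh x (hsub hx)) (abs_le.2 ⟨hx.1, hx.2⟩)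
  have ha2 : ∀ x ∈ Icc (-(1/2) : ℝ) (1/2), a x ^ 2 ≤ 12 / 5 * J := fun x hx =>
    (sq_le_integral_sq_deriv hda (hda_c.mono hsub) hx₀ hax₀ hx).trans hder
  have hJ0 : 0 ≤ J := intervalIntegral.integral_nonneg hle fun x hx => by
    have := hh x (hsub hx)
    positivity
  have ha3 : ∫ x in (-(1/2) : ℝ)..(1/2), 1 / 4 * (a x ^ 2 / h x) ≤ 3 / 4 * J := by
    have : ∫ x in (-(1/2) : ℝ)..(1/2), 1 / 4 * (a x ^ 2 / h x) ≤
        ∫ x in (-(1/2) : ℝ)..(1/2), 3 / 4 * J := by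
      refine intervalIntegral.integral_mono_on hle
        ((hii _ ((hac.pow 2).div hhc hh0)).const_mul _) intervalIntegrable_const fun x hx => ?_
      have h1 := ha2 x hx
      have h2 := hh x (hsub hx)
      have h3 : a x ^ 2 / h x ≤ 12 / 5 * J / (4 / 5) :=
        div_le_div₀ (by positivity) h1 (by norm_num) h2
      linarith
    simpa using this.trans_eq (by norm_num)
  have hfin : ∫ x in (-(1/2) : ℝ)..(1/2), ((1 / 4 * (I x / h x) - 1 / 4 * (a x ^ 2 / h x)) +
      (h x * q x ^ 2 + b x ^ 2 / (2 * h x))) ≤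
      ∫ x in (-(1/2) : ℝ)..(1/2), (h x * A x + B x / h x) := by
    refine intervalIntegral.integral_mono_on hle ?_ ?_ fun x hx => ?_
    · exact (((hii _ (hIc.div hhc hh0)).const_mul _).sub
        ((hii _ ((hac.pow 2).div hhc hh0)).const_mul _)).add (hii _ hJc)
    · exact hii _ ((hhc.mul hAc).add (hBc.div hhc hh0))
    · have hx' := hsub hx
      have h1 : 1 / 4 * (I x - a x ^ 2) + 1 / 2 * b x ^ 2 ≤ B x :=
        hardy_interval hR (hdr x hx') (hslice _ hVr x hx') (hVR x hx') rfl
      have h2 : q x ^ 2 ≤ A x := sq_integral_div_sq_le hR (hslice _ hP x hx')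
      have h3 : 0 < h x := by linarith [hh x hx']
      have h4 := mul_le_mul_of_nonneg_left h2 h3.le
      have h5 := div_le_div_of_nonneg_right h1 h3.le
      have e : (1 / 4 * (I x - a x ^ 2) + 1 / 2 * b x ^ 2) / h x =
        1 / 4 * (I x / h x) - 1 / 4 * (a x ^ 2 / h x) + b x ^ 2 / (2 * h x) := by
        field_simp
      linarith
  rw [intervalIntegral.integral_add, intervalIntegral.integral_sub,
    intervalIntegral.integral_const_mul, ← hJ] at hfin
  · linarith
  · exact (hii _ (hIc.div hhc hh0)).const_mul _
  · exact (hii _ ((hac.pow 2).div hhc hh0)).const_mul _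
  · exact ((hii _ (hIc.div hhc hh0)).const_mul _).sub
        ((hii _ ((hac.pow 2).div hhc hh0)).const_mul _)
  · exact hii _ hJc

lemma sqrt_one_sub_sq_bounds {x : ℝ} (hx : x ∈ Icc (-(3/5)) (3/5 : ℝ)) :
    4 / 5 ≤ √(1 - x ^ 2) ∧ √(1 - x ^ 2) ≤ 1 := by
  have : x ^ 2 ≤ 9 / 25 := by nlinarith [hx.1, hx.2]
  constructor
  · apply Real.le_sqrt_of_sq_le; linarith
  · rw [Real.sqrt_le_left zero_le_one]; nlinarith

/-- Integration over the fundamental domain in coordinates `x + i r √(1 - x²)`. -/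
lemma integral_fd_eq {F : ℂ → ℝ} (hF : ContinuousOn F {z | 0 < z.im}) {Y : ℝ} (hY0 : 0 ≤ Y)
    (hY : ∀ z : ℂ, Y < z.im → F z = 0) :
    ∫ z : ℍ in 𝒟, F z = ∫ x in (-(1/2) : ℝ)..(1/2), (∫ r in (1:ℝ)..(2 * Y + 2),
      F ⟨x, √(1 - x ^ 2) * r⟩ / r ^ 2) / √(1 - x ^ 2) := by
  set h : ℝ → ℝ := fun x => √(1 - x ^ 2) with hh
  set R := 2 * Y + 2 with hR
  have hhb : ∀ x ∈ Icc (-(1/2)) (1/2 : ℝ), 4 / 5 ≤ h x ∧ h x ≤ 1 := fun x hx =>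
    sqrt_one_sub_sq_bounds ⟨by linarith [hx.1], by linarith [hx.2]⟩
  set g : ℝ × ℝ → ℝ := fun p => (p.2 ^ 2)⁻¹ * F ⟨p.1, p.2⟩ with hg
  set T : Set (ℝ × ℝ) := {p | p.1 ∈ Icc (-(1/2)) (1/2 : ℝ) ∧ h p.1 ≤ p.2} with hT
  have hTm : MeasurableSet T := by
    refine MeasurableSet.inter (measurable_fst measurableSet_Icc) ?_
    exact (isClosed_le (by fun_prop) continuous_snd).measurableSet
  have hg0 : ∀ p : ℝ × ℝ, Y < p.2 → g p = 0 := fun p hp => by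
    rw [hg]
    simp only
    rw [hY _ hp, mul_zero]
  have hgc : ContinuousOn g {p | 0 < p.2} := by
    refine ContinuousOn.mul ?_ ?_
    · exact (continuous_snd.pow 2).continuousOn.inv₀ fun p hp => pow_ne_zero 2 (ne_of_gt hp)
    · refine hF.comp (f := fun p : ℝ × ℝ => (⟨p.1, p.2⟩ : ℂ)) ?_ fun p hp => hp
      exact (Complex.equivRealProdCLM.symm.continuous).continuousOn
  have hGi : Integrable (T.indicator g) := by
    set K : Set (ℝ × ℝ) := Icc (-(1/2)) (1/2) ×ˢ Icc (1/2) R with hK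
    have h1 : IntegrableOn g K := by
      refine ContinuousOn.integrableOn_compact (isCompact_Icc.prod isCompact_Icc)
        (hgc.mono fun p hp => ?_)
      have := hp.2.1
      show 0 < p.2
      linarith
    have h2 : IntegrableOn g (T ∩ K) := h1.mono_set inter_subset_right
    rw [← integrable_indicator_iff (hTm.inter (measurableSet_Icc.prod measurableSet_Icc))] at h2
    refine h2.congr (Eventually.of_forall fun p => ?_)
    by_cases hp : p ∈ T
    · by_cases hk : p ∈ K
      · rw [indicator_of_mem hp, indicator_of_mem (mem_inter hp hk)]
      · rw [indicator_of_mem hp, indicator_of_notMem (fun h => hk h.2), hg0]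
        by_contra! hpy
        exact hk ⟨hp.1, by have := (hhb _ hp.1).1; linarith [hp.2], by linarith⟩
    · rw [indicator_of_notMem hp, indicator_of_notMem (fun h => hp h.1)]
  set S : Set ℂ := {z | 1 ≤ Complex.normSq z ∧ |z.re| ≤ 1 / 2} with hS
  have hSm : MeasurableSet S := by
    refine MeasurableSet.inter ?_ ?_
    · exact (isClosed_le continuous_const Complex.continuous_normSq).measurableSet
    · exact (isClosed_le Complex.continuous_re.abs continuous_const).measurableSet
  have e1 : ∫ z : ℍ in 𝒟, F z = ∫ z in {z : ℂ | 0 < z.im} ∩ S, (z.im ^ 2)⁻¹ • F z :=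
    setIntegral_uhp hSm F
  rw [e1, ← integral_indicator (measurableSet_im_pos.inter hSm), integral_complex_eq_prod]
  have e2 : ∀ p : ℝ × ℝ, ({z : ℂ | 0 < z.im} ∩ S).indicator (fun z => (z.im ^ 2)⁻¹ • F z)
      ⟨p.1, p.2⟩ = T.indicator g p := by
    intro p
    have hiff : (⟨p.1, p.2⟩ : ℂ) ∈ {z : ℂ | 0 < z.im} ∩ S ↔ p ∈ T := by
      constructor
      · rintro ⟨h1, h2, h3⟩
        refine ⟨abs_le.1 h3, ?_⟩
        have h1 : 0 < p.2 := h1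
        rw [Complex.normSq_mk] at h2
        rw [hh]
        simp only
        rw [Real.sqrt_le_left h1.le]
        nlinarith
      · rintro ⟨h1, h2⟩
        have h3 := (hhb _ h1).1
        have h4 : 0 < p.2 := by linarith
        refine ⟨h4, ?_, abs_le.2 h1⟩
        rw [Complex.normSq_mk]
        rw [hh] at h2
        simp only at h2
        rw [Real.sqrt_le_left h4.le] at h2
        nlinarith
    by_cases hp : p ∈ T
    · rw [indicator_of_mem hp, indicator_of_mem (hiff.2 hp)]; rfl
    · rw [indicator_of_notMem hp, indicator_of_notMem (fun h => hp (hiff.1 h))]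
  have e3 : ∀ x : ℝ, ∫ y, T.indicator g (x, y) = (Icc (-(1/2)) (1/2 : ℝ)).indicator (fun x =>
      (∫ r in (1:ℝ)..R, F ⟨x, h x * r⟩ / r ^ 2) / h x) x := by
    intro x
    by_cases hx : x ∈ Icc (-(1/2)) (1/2 : ℝ)
    · rw [indicator_of_mem hx]
      obtain ⟨hx1, hx2⟩ := hhb x hx
      have hx0 : 0 < h x := by linarith
      have f1 : ∀ y, T.indicator g (x, y) = (Ici (h x)).indicator (fun y => g (x, y)) y := by
        intro y
        by_cases hy : h x ≤ y
        · rw [indicator_of_mem (show (x, y) ∈ T from ⟨hx, hy⟩), indicator_of_mem (mem_Ici.2 hy)]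
        · rw [indicator_of_notMem (fun h : (x, y) ∈ T => hy h.2), indicator_of_notMem (s := Ici (h x)) hy]
      simp_rw [f1]
      rw [integral_indicator measurableSet_Ici, integral_Ici_eq_integral_Ioi]
      have hle : h x ≤ h x * R := by nlinarith
      rw [setIntegral_eq_of_subset_of_forall_sdiff_eq_zero measurableSet_Ioi
        (Ioc_subset_Ioi_self : Ioc (h x) (h x * R) ⊆ _), ← intervalIntegral.integral_of_le hle]
      · have := intervalIntegral.integral_comp_mul_left (a := 1) (b := R)
          (fun y => g (x, y)) hx0.ne'
        rw [mul_one, smul_eq_mul] at this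
        have h5 : ∫ y in h x..h x * R, g (x, y) = h x * ∫ r in (1:ℝ)..R, g (x, h x * r) := by
          rw [this]; field_simp
        rw [h5, ← intervalIntegral.integral_const_mul, ← intervalIntegral.integral_div]
        refine intervalIntegral.integral_congr fun r _ => ?_
        simp only [hg]
        field_simp
      · intro y hy
        apply hg0
        have h6 := hy.2
        rw [mem_Ioc, not_and, not_le] at h6
        have := h6 hy.1
        show Y < y
        nlinarith
    · rw [indicator_of_notMem hx]
      rw [integral_eq_zero_of_ae]
      exact Eventually.of_forall fun y => indicator_of_notMem (fun h => hx h.1) _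
  simp_rw [e2]
  rw [Measure.volume_eq_prod, integral_prod _ hGi]
  simp_rw [e3]
  rw [integral_indicator measurableSet_Icc, integral_Icc_eq_integral_Ioc,
    intervalIntegral.integral_of_le (by norm_num)]

lemma hasDerivAt_vertical {v : ℂ → ℝ} {x y : ℝ} (hv : DifferentiableAt ℝ v ⟨x, y⟩)
    {f g : ℝ → ℝ} {f' g' t : ℝ} (hf : HasDerivAt f f' t) (hg : HasDerivAt g g' t)
    (hx : f t = x) (hy : g t = y) :
    HasDerivAt (fun s => v ⟨f s, g s⟩) (f' * fderiv ℝ v ⟨x, y⟩ 1 +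
      g' * fderiv ℝ v ⟨x, y⟩ Complex.I) t := by
  have h1 : HasDerivAt (fun s => (⟨f s, g s⟩ : ℂ)) (⟨f', g'⟩ : ℂ) t := by
    have := Complex.equivRealProdCLM.symm.hasFDerivAt.comp_hasDerivAt t (hf.prodMk hg)
    exact this
  have h2 : HasFDerivAt v (fderiv ℝ v ⟨x, y⟩) ⟨f t, g t⟩ := by
    rw [hx, hy]; exact hv.hasFDerivAt
  refine (h2.comp_hasDerivAt t h1).congr_deriv ?_
  have : (⟨f', g'⟩ : ℂ) = f' • (1:ℂ) + g' • Complex.I := by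
    apply Complex.ext <;> simp
  rw [this, map_add, map_smul, map_smul]
  rfl

/-- A lower bound `1/4` for the bottom of the mean-zero spectrum, for functions vanishing high in
the cusp; no periodicity is needed. -/
theorem spectral_gap {v : ℂ → ℝ} (hv : ContDiffOn ℝ 1 v {z | 0 < z.im}) {Y : ℝ} (hY0 : 0 ≤ Y)
    (hY : ∀ z : ℂ, Y < z.im → v z = 0) (hmean : ∫ z : ℍ in 𝒟, v z = 0) :
    1 / 4 * ∫ z : ℍ in 𝒟, v z ^ 2 ≤ ∫ z : ℍ in 𝒟, z.im ^ 2 * gdot v v z := by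
  have hopen : IsOpen {z : ℂ | 0 < z.im} := isOpen_lt continuous_const Complex.continuous_im
  have hvc := hv.continuousOn
  have hfd : ContinuousOn (fderiv ℝ v) {z | 0 < z.im} :=
    hv.continuousOn_fderiv_of_isOpen hopen le_rfl
  have hfd1 : ContinuousOn (fun z => fderiv ℝ v z 1) {z | 0 < z.im} :=
    hfd.clm_apply continuousOn_const
  have hfdI : ContinuousOn (fun z => fderiv ℝ v z Complex.I) {z | 0 < z.im} :=
    hfd.clm_apply continuousOn_const
  have hgY : ∀ z : ℂ, Y < z.im → z.im ^ 2 * gdot v v z = 0 := by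
    intro z hz
    rw [gdot_eq_zero_of_eventually, mul_zero]
    filter_upwards [(isOpen_lt continuous_const Complex.continuous_im).mem_nhds hz] with w hw
    exact hY w hw
  have hgc : ContinuousOn (fun z : ℂ => z.im ^ 2 * gdot v v z) {z | 0 < z.im} := by
    unfold gdot
    exact (Complex.continuous_im.pow 2).continuousOn.mul ((hfd1.mul hfd1).add (hfdI.mul hfdI))
  rw [integral_fd_eq hvc hY0 hY] at hmean
  have e1 := integral_fd_eq (hvc.pow 2) hY0 (fun z hz => by simp [hY z hz])
  have e2 := integral_fd_eq hgc hY0 hgY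
  refine (congrArg (1 / 4 * ·) e1).le.trans (le_trans ?_ e2.symm.le)
  set R := 2 * Y + 2 with hR
  set h : ℝ → ℝ := fun x => √(1 - x ^ 2) with hh
  have hcont : ∀ f : ℂ → ℝ, ContinuousOn f {z | 0 < z.im} →
      ContinuousOn (Function.uncurry fun x r => f ⟨x, h x * r⟩)
        (Icc (-(3/5)) (3/5) ×ˢ Icc 1 R) := by
    intro f hf
    refine hf.comp (f := fun p : ℝ × ℝ => (⟨p.1, h p.1 * p.2⟩ : ℂ)) ?_ ?_
    · refine Continuous.continuousOn ?_
      exact Complex.equivRealProdCLM.symm.continuous.comp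
        (f := fun p : ℝ × ℝ => (p.1, h p.1 * p.2)) (by fun_prop)
    · rintro p ⟨h1, h2⟩
      have h3 := (sqrt_one_sub_sq_bounds h1).1
      have h4 : 0 < h p.1 := by rw [hh]; simp only; linarith
      exact mul_pos h4 (by linarith [h2.1])
  have hpos : ∀ x ∈ Icc (-(3/5)) (3/5 : ℝ), ∀ r ∈ Icc 1 R,
      (⟨x, h x * r⟩ : ℂ) ∈ {z : ℂ | 0 < z.im} := by
    intro x hx r hr
    have h3 : 4 / 5 ≤ h x := (sqrt_one_sub_sq_bounds hx).1
    exact mul_pos (by linarith : 0 < h x) (by linarith [hr.1])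
  have hhc : Continuous h := by fun_prop
  have hdiff : ∀ z ∈ {z : ℂ | 0 < z.im}, DifferentiableAt ℝ v z := fun z hz =>
    (hv.differentiableOn one_ne_zero).differentiableAt (hopen.mem_nhds hz)
  have key := spectral_gap_coordinates (R := R) (by linarith) (h := h)
    (V := fun x r => v ⟨x, h x * r⟩)
    (Vr := fun x r => h x * fderiv ℝ v ⟨x, h x * r⟩ Complex.I)
    (P := fun x r => fderiv ℝ v ⟨x, h x * r⟩ 1) hhc.continuousOn
    (fun x hx => (sqrt_one_sub_sq_bounds hx).1) (hcont v hvc)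
    ((hhc.comp continuous_fst).continuousOn.mul (hcont _ hfdI)) (hcont _ hfd1) ?_ ?_ ?_ hmean
  · refine key.trans_eq ?_
    refine intervalIntegral.integral_congr fun x hx => ?_
    rw [uIcc_of_le (by norm_num)] at hx
    have hx' : x ∈ Icc (-(3/5)) (3/5 : ℝ) := ⟨by linarith [hx.1], by linarith [hx.2]⟩
    have h0 : 0 < h x := by
      have := (sqrt_one_sub_sq_bounds hx').1
      rw [hh]; simp only; linarith
    have hR1 : (1:ℝ) ≤ R := by linarith
    have hsl : ∀ f : ℂ → ℝ, ContinuousOn f {z | 0 < z.im} →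
        ContinuousOn (fun r => f ⟨x, h x * r⟩) (uIcc 1 R) := fun f hf => by
      rw [uIcc_of_le hR1]
      exact (hcont f hf).comp (f := fun r => (x, r)) (by fun_prop) fun r hr => ⟨hx', hr⟩
    have i1 : IntervalIntegrable (fun r => h x * fderiv ℝ v ⟨x, h x * r⟩ 1 ^ 2) volume 1 R :=
      (continuousOn_const.mul ((hsl _ hfd1).pow 2)).intervalIntegrable
    have i2 : IntervalIntegrable (fun r => (h x * fderiv ℝ v ⟨x, h x * r⟩ Complex.I) ^ 2 / h x)
        volume 1 R :=
      (((continuousOn_const.mul (hsl _ hfdI)).pow 2).div_const _).intervalIntegrable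
    simp only
    rw [← intervalIntegral.integral_const_mul, ← intervalIntegral.integral_div,
      ← intervalIntegral.integral_div, ← intervalIntegral.integral_add i1 i2]
    refine intervalIntegral.integral_congr fun r hr => ?_
    rw [uIcc_of_le hR1] at hr
    have : r ≠ 0 := by linarith [hr.1]
    simp only [gdot, show √(1 - x ^ 2) = h x from rfl]
    generalize fderiv ℝ v ⟨x, h x * r⟩ 1 = A
    generalize fderiv ℝ v ⟨x, h x * r⟩ Complex.I = B
    field_simp
  · intro x hx r hr
    have h1 : HasDerivAt (fun r => h x * r) (h x) r := by
      simpa using (hasDerivAt_id r).const_mul (h x)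
    refine (hasDerivAt_vertical (hdiff _ (hpos x hx r hr)) (hasDerivAt_const r x) h1 rfl
      rfl).congr_deriv ?_
    ring
  · intro x hx r hr
    have h3 := (sqrt_one_sub_sq_bounds hx).1
    have hx2 : 0 < 1 - x ^ 2 := by nlinarith [hx.1, hx.2]
    have h1 : HasDerivAt h (-(2 * x) / (2 * h x)) x := by
      have := ((hasDerivAt_pow 2 x).const_sub 1).sqrt hx2.ne'
      refine this.congr_deriv ?_
      norm_num [hh]
    refine (hasDerivAt_vertical (hdiff _ (hpos x hx r hr)) (hasDerivAt_id x) (h1.mul_const r) rfl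
      rfl).congr_deriv ?_
    have h4 : h x ≠ 0 := by rw [hh]; simp only; linarith
    field_simp
    ring
  · intro x hx
    apply hY
    have h3 := (sqrt_one_sub_sq_bounds hx).1
    show Y < √(1 - x ^ 2) * R
    nlinarith

/-! ### An energy estimate in Hilbert space -/

section Energy

variable {H : Type*} [NormedAddCommGroup H] [InnerProductSpace ℝ H]

/-- If `v'' + u = v / 4 + O(e^{-s/2})` where `u` plays the role of a symmetric operator applied to
`v` and bounded below by `1 / 4`, then `v` grows at most linearly. -/
lemma energy_growth {v v' v'' u u' : ℝ → H}
    (hv : ∀ s, HasDerivAt v (v' s) s) (hv' : ∀ s, HasDerivAt v' (v'' s) s)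
    (hu : ∀ s, HasDerivAt u (u' s) s) (hsymm : ∀ s, inner ℝ (u' s) (v s) = inner ℝ (u s) (v' s))
    (hpos : ∀ s, 1 / 4 * ‖v s‖ ^ 2 ≤ inner ℝ (u s) (v s)) {C : ℝ} (hC : 0 ≤ C)
    (herr : ∀ s, ‖v'' s + u s - (1 / 4 : ℝ) • v s‖ ≤ C * Real.exp (-s / 2)) :
    ∃ M : ℝ, 0 ≤ M ∧ ∀ s, 0 ≤ s → ‖v s‖ ≤ M * (1 + s) := by
  set e : ℝ → ℝ := fun s => inner ℝ (v' s) (v' s) + inner ℝ (u s) (v s) -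
    1 / 4 * inner ℝ (v s) (v s) with he
  have hde : ∀ s, HasDerivAt e (2 * inner ℝ (v'' s + u s - (1 / 4 : ℝ) • v s) (v' s)) s := by
    intro s
    refine ((((hv' s).inner ℝ (hv' s)).fun_add ((hu s).inner ℝ (hv s))).fun_sub
      (((hv s).inner ℝ (hv s)).const_mul (1 / 4))).congr_deriv ?_
    rw [hsymm, inner_sub_left, inner_add_left, inner_smul_left, real_inner_comm (v'' s),
      real_inner_comm (v s) (v' s)]
    simp only [conj_trivial]
    ring
  have hle : ∀ s, ‖v' s‖ ^ 2 ≤ e s := by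
    intro s
    have := hpos s
    rw [he]
    simp only [real_inner_self_eq_norm_sq]
    linarith
  set φ : ℝ → ℝ := fun s => (1 + e s) * Real.exp (2 * C * Real.exp (-s / 2)) with hφ
  have hdx : ∀ s, HasDerivAt (fun s => Real.exp (2 * C * Real.exp (-s / 2)))
      (Real.exp (2 * C * Real.exp (-s / 2)) * (2 * C * (Real.exp (-s / 2) * (-1 / 2)))) s :=
    fun s => ((((hasDerivAt_id s).fun_neg.div_const 2).exp).const_mul (2 * C)).exp
  have hdφ : ∀ s, HasDerivAt φ (2 * inner ℝ (v'' s + u s - (1 / 4 : ℝ) • v s) (v' s) *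
      Real.exp (2 * C * Real.exp (-s / 2)) + (1 + e s) *
      (Real.exp (2 * C * Real.exp (-s / 2)) * (2 * C * (Real.exp (-s / 2) * (-1 / 2))))) s :=
    fun s => ((hde s).const_add 1).mul (hdx s)
  have hanti : Antitone φ := by
    refine antitone_of_hasDerivAt_nonpos hdφ fun s => ?_
    have h1 := (real_inner_le_norm (v'' s + u s - (1 / 4 : ℝ) • v s) (v' s)).trans
      (mul_le_mul_of_nonneg_right (herr s) (norm_nonneg (v' s)))
    set X := Real.exp (-s / 2)
    set Z := Real.exp (2 * C * X)
    have hX : 0 < X := Real.exp_pos _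
    have hZ : 0 < Z := Real.exp_pos _
    have h2 : 2 * ‖v' s‖ ≤ 1 + e s := by
      have := hle s
      nlinarith [sq_nonneg (‖v' s‖ - 1)]
    have h3 := mul_le_mul_of_nonneg_left h2 (mul_nonneg hC hX.le)
    have h4 : 2 * inner ℝ (v'' s + u s - (1 / 4 : ℝ) • v s) (v' s) ≤ C * X * (1 + e s) := by
      linarith
    have h5 := mul_le_mul_of_nonneg_right h4 hZ.le
    simp only [Pi.zero_apply]
    linarith
  have hφ0 : 0 ≤ φ 0 := by
    have := hle 0
    have : 0 ≤ e 0 := by nlinarith [norm_nonneg (v' 0)]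
    rw [hφ]
    positivity
  have hv'b : ∀ s, 0 ≤ s → ‖v' s‖ ≤ 1 + φ 0 := by
    intro s hs
    have h1 := hanti hs
    have h2 : 1 + e s ≤ φ s := by
      have h3 : 0 ≤ 1 + e s := by nlinarith [hle s, norm_nonneg (v' s)]
      have h4 : 1 ≤ Real.exp (2 * C * Real.exp (-s / 2)) := by
        apply Real.one_le_exp; positivity
      calc 1 + e s = (1 + e s) * 1 := (mul_one _).symm
        _ ≤ _ := mul_le_mul_of_nonneg_left h4 h3
    nlinarith [hle s, sq_nonneg (‖v' s‖ - 1)]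
  refine ⟨‖v 0‖ + (1 + φ 0), by positivity, fun s hs => ?_⟩
  have := norm_image_sub_le_of_norm_deriv_le_segment' (f := v) (f' := v') (a := 0) (b := s)
    (C := 1 + φ 0) (fun x _ => (hv x).hasDerivWithinAt) (fun x hx => hv'b x hx.1) s ⟨hs, le_rfl⟩
  have h2 : ‖v s‖ ≤ ‖v 0‖ + ‖v s - v 0‖ := by
    have := norm_add_le (v 0) (v s - v 0)
    rwa [add_sub_cancel] at this
  have h3 : 0 ≤ ‖v 0‖ * s := by positivity
  nlinarith

end Energy

/-! ### The automorphization in `L²` of the fundamental domain -/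

lemma IsTest.exists_bound_fd {k : ℂ → ℝ} (hk : IsTest k) : ∃ C, ∀ z ∈ 𝒟, |autom k z| ≤ C := by
  obtain ⟨Y, hY⟩ := hk.exists_autom_eq_zero
  have hK : IsCompact (Icc (-(1/2)) (1/2) ×ℂ Icc (1/2) (max Y 1)) :=
    isCompact_Icc.reProdIm isCompact_Icc
  have hK2 := isCompact_preimage_coe hK fun z hz => lt_of_lt_of_le (by norm_num) hz.2.1
  obtain ⟨C, hC⟩ := hK2.exists_bound_of_continuousOn hk.continuous_autom.continuousOn
  refine ⟨max C 0, fun z hz => ?_⟩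
  by_cases h : Y < z.im
  · rw [hY z h]; simp
  · refine (hC z ⟨abs_le.1 hz.2, ?_, ?_⟩).trans (le_max_left _ _)
    · have h1 := three_le_four_mul_im_sq_of_mem_fd hz
      have h2 := z.im_pos
      show 1 / 2 ≤ z.im
      nlinarith
    · exact (not_lt.1 h).trans (le_max_left _ _)

lemma IsTest.memLp {k : ℂ → ℝ} (hk : IsTest k) :
    MemLp (autom k) 2 (volume.restrict 𝒟) := by
  obtain ⟨C, hC⟩ := hk.exists_bound_fd
  refine MemLp.of_bound hk.continuous_autom.aestronglyMeasurable C ?_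
  exact (ae_restrict_iff' measurableSet_fd).2 (Eventually.of_forall hC)

open Classical in
/-- The automorphization of a test function as an element of `L²` (zero for other functions). -/
noncomputable def automL2 (k : ℂ → ℝ) : Lp ℝ 2 (volume.restrict (𝒟 : Set ℍ)) :=
  if h : IsTest k then h.memLp.toLp else 0

lemma automL2_eq {k : ℂ → ℝ} (hk : IsTest k) : automL2 k = hk.memLp.toLp := by
  simp [automL2, hk]

lemma coeFn_automL2 {k : ℂ → ℝ} (hk : IsTest k) :
    automL2 k =ᵐ[volume.restrict 𝒟] autom k := by
  rw [automL2_eq hk]; exact hk.memLp.coeFn_toLp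

lemma automL2_add {k l : ℂ → ℝ} (hk : IsTest k) (hl : IsTest l) :
    automL2 (k + l) = automL2 k + automL2 l := by
  refine Lp.ext ?_
  filter_upwards [coeFn_automL2 (hk.add hl), Lp.coeFn_add (automL2 k) (automL2 l),
    coeFn_automL2 hk, coeFn_automL2 hl] with z h1 h2 h3 h4
  rw [h1, h2, Pi.add_apply, h3, h4, autom_add hk hl, Pi.add_apply]

lemma automL2_smul {k : ℂ → ℝ} (hk : IsTest k) (c : ℝ) : automL2 (c • k) = c • automL2 k := by
  refine Lp.ext ?_
  filter_upwards [coeFn_automL2 (hk.smul c), Lp.coeFn_smul c (automL2 k),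
    coeFn_automL2 hk] with z h1 h2 h3
  rw [h1, h2, Pi.smul_apply, h3, autom_const_smul, Pi.smul_apply]

lemma inner_automL2 {k l : ℂ → ℝ} (hk : IsTest k) (hl : IsTest l) :
    inner ℝ (automL2 k) (automL2 l) = ∫ z in 𝒟, autom k z * autom l z := by
  rw [L2.inner_def]
  refine integral_congr_ae ?_
  filter_upwards [coeFn_automL2 hk, coeFn_automL2 hl] with z h1 h2
  rw [h1, h2]
  simp [mul_comm]

lemma exists_bound_automL2 : ∃ C : ℝ, 0 < C ∧ ∀ (k : ℂ → ℝ) (A : ℝ), IsTest k → 0 ≤ A →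
    (∀ z : ℂ, 0 < z.im → |k z| ≤ A * z.im ^ 2) →
    (∀ z : ℂ, k z ≠ 0 → |z.re| ≤ 1 ∧ z.im ≤ 2) → ‖automL2 k‖ ≤ C * A := by
  obtain ⟨C, hC0, hC⟩ := exists_bound_autom
  set D : ℝ := (measureUnivNNReal (volume.restrict (𝒟 : Set ℍ)) : ℝ) ^ (2 : ℝ≥0∞).toReal⁻¹ with hD
  have hD0 : 0 ≤ D := by positivity
  refine ⟨D * C + 1, by positivity, fun k A hk hA h1 h2 => ?_⟩
  have h3 : ‖automL2 k‖ ≤ D * (C * A) := by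
    refine Lp.norm_le_of_ae_bound (by positivity) ?_
    filter_upwards [coeFn_automL2 hk] with z hz
    rw [hz]
    exact hC k A hA h1 h2 z
  nlinarith

lemma gdot_comm (f g : ℂ → ℝ) (z : ℂ) : gdot f g z = gdot g f z := by
  unfold gdot; ring

lemma automC_smul (k : ℂ → ℝ) (γ : SL(2, ℤ)) (z : ℍ) :
    automC k ((γ • z : ℍ) : ℂ) = automC k z := by
  rw [automC_coe, automC_coe, autom_smul]

lemma inner_hypLap {k l : ℂ → ℝ} (hk : IsTest k) (hk2 : ContDiff ℝ 2 k) (hl : IsTest l)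
    (hl2 : ContDiff ℝ 2 l) : inner ℝ (automL2 (hypLap k)) (automL2 l) =
      ∫ z : ℍ in 𝒟, z.im ^ 2 * gdot (automC k) (automC l) z := by
  rw [inner_automL2 (hk.hypLap hk2) hl, integral_fd_gdot hk hk2
    (contDiffOn_automC hl (hl2.of_le (by norm_num))) (automC_smul l)]
  simp_rw [automC_coe]

lemma inner_hypLap_comm {k l : ℂ → ℝ} (hk : IsTest k) (hk2 : ContDiff ℝ 2 k) (hl : IsTest l)
    (hl2 : ContDiff ℝ 2 l) : inner ℝ (automL2 (hypLap k)) (automL2 l) =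
      inner ℝ (automL2 (hypLap l)) (automL2 k) := by
  rw [inner_hypLap hk hk2 hl hl2, inner_hypLap hl hl2 hk hk2]
  simp_rw [gdot_comm (automC k)]

lemma quarter_norm_sq_le {k : ℂ → ℝ} (hk : IsTest k) (hk2 : ContDiff ℝ 2 k)
    (hmean : ∫ z : ℍ, k z = 0) :
    1 / 4 * ‖automL2 k‖ ^ 2 ≤ inner ℝ (automL2 (hypLap k)) (automL2 k) := by
  rw [← real_inner_self_eq_norm_sq, inner_automL2 hk hk, inner_hypLap hk hk2 hk hk2]
  obtain ⟨Y, hY⟩ := hk.exists_autom_eq_zero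
  have hm : ∫ z : ℍ in 𝒟, automC k z = 0 := by
    have := hk.integral_autom_mul (G := fun _ => 1) continuous_const fun _ _ => rfl
    simp only [mul_one] at this
    simp_rw [automC_coe]
    rw [this, hmean, mul_zero]
  have := spectral_gap (v := automC k) (contDiffOn_automC hk (hk2.of_le (by norm_num)))
    (Y := max Y 0) (le_max_right _ _) (fun z hz => by
      have h0 : 0 < z.im := (le_max_right _ _).trans_lt hz
      have := automC_coe k ⟨z, h0⟩
      exact this.trans (hY ⟨z, h0⟩ ((le_max_left _ _).trans_lt hz))) hm
  refine le_trans (le_of_eq ?_) this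
  simp_rw [automC_coe, sq]

open scoped ContDiff

/-! ### Families of test functions -/

/-- Smooth functions supported on `[-1, 1]`. -/
structure IsBump (α : ℝ → ℝ) : Prop where
  smooth : ContDiff ℝ ∞ α
  zero : ∀ x, 1 ≤ |x| → α x = 0

/-- Functions on `(0, ∞)`, smooth and vanishing beyond `2`. -/
structure IsCut (β : ℝ → ℝ) : Prop where
  smooth : ContDiffOn ℝ ∞ β (Ioi 0)
  zero : ∀ y, 2 ≤ y → β y = 0

/-- Functions of class `C^n` vanishing far to the right. -/
structure IsProf (n : ℕ) (g : ℝ → ℝ) : Prop where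
  smooth : ContDiff ℝ n g
  zero : ∃ u₀ : ℝ, 0 < u₀ ∧ ∀ u, u₀ ≤ u → g u = 0

/-- The test function `α(x) β(y) e^{-s/2} g(e^{-s}/y)`. -/
noncomputable def profKernel (α β g : ℝ → ℝ) (s : ℝ) (z : ℂ) : ℝ :=
  if 0 < z.im then α z.re * β z.im * (Real.exp (-s / 2) * g (Real.exp (-s) / z.im)) else 0

/-- The Euler operator in the variable `1 / u`. -/
noncomputable def euler (g : ℝ → ℝ) (u : ℝ) : ℝ := -u * deriv g u

/-- The generator of `s ↦ e^{-s/2} g(e^{-s}/y)`. -/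
noncomputable def dil (g : ℝ → ℝ) (u : ℝ) : ℝ := euler g u - 1 / 2 * g u

lemma deriv_eq_zero_of_eventually {f : ℝ → ℝ} {x : ℝ} (h : f =ᶠ[𝓝 x] 0) : deriv f x = 0 := by
  rw [h.deriv_eq]; simp

lemma IsBump.deriv {α : ℝ → ℝ} (hα : IsBump α) : IsBump (deriv α) := by
  refine ⟨(contDiff_infty_iff_deriv.1 hα.smooth).2, ?_⟩
  have h1 : ∀ x, 1 < |x| → _root_.deriv α x = 0 := fun x hx => by
    apply deriv_eq_zero_of_eventually
    filter_upwards [(isOpen_lt continuous_const continuous_abs).mem_nhds hx] with y hy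
    exact hα.zero y (le_of_lt hy)
  intro x hx
  have hc : IsClosed {y | _root_.deriv α y = 0} :=
    isClosed_eq (contDiff_infty_iff_deriv.1 hα.smooth).2.continuous continuous_const
  have hx0 : x ≠ 0 := by rintro rfl; norm_num at hx
  have ht : Tendsto (fun t : ℝ => t * x) (𝓝[>] 1) (𝓝 x) := by
    have : Tendsto (fun t : ℝ => t * x) (𝓝 1) (𝓝 (1 * x)) := tendsto_id.mul_const x
    rw [one_mul] at this
    exact this.mono_left nhdsWithin_le_nhds
  refine hc.mem_of_tendsto ht ?_
  filter_upwards [self_mem_nhdsWithin] with t ht1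
  apply h1
  have ht1 : 1 < t := ht1
  rw [abs_mul, abs_of_pos (by linarith)]
  nlinarith

lemma IsBump.exists_bound {α : ℝ → ℝ} (hα : IsBump α) : ∃ M, 0 ≤ M ∧ ∀ x, |α x| ≤ M := by
  obtain ⟨M, hM⟩ := (isCompact_Icc (a := (-1:ℝ)) (b := 1)).exists_bound_of_continuousOn
    hα.smooth.continuous.continuousOn
  refine ⟨max M 0, le_max_right _ _, fun x => ?_⟩
  by_cases h : 1 ≤ |x|
  · rw [hα.zero x h]; simp
  · exact (hM x (abs_le.1 (not_le.1 h).le)).trans (le_max_left _ _)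

lemma IsCut.deriv {β : ℝ → ℝ} (hβ : IsCut β) : IsCut (deriv β) := by
  have hs : ContDiffOn ℝ ∞ (_root_.deriv β) (Ioi 0) :=
    ((contDiffOn_infty_iff_deriv_of_isOpen isOpen_Ioi).1 hβ.smooth).2
  refine ⟨hs, fun y hy => ?_⟩
  have h1 : ∀ y, 2 < y → _root_.deriv β y = 0 := fun y hy => by
    apply deriv_eq_zero_of_eventually
    filter_upwards [isOpen_Ioi.mem_nhds hy] with x hx
    exact hβ.zero x (le_of_lt hx)
  rcases eq_or_lt_of_le hy with rfl | h
  · have hc : ContinuousAt (_root_.deriv β) 2 :=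
      hs.continuousOn.continuousAt (isOpen_Ioi.mem_nhds (by norm_num))
    have h2 : Tendsto (_root_.deriv β) (𝓝[>] 2) (𝓝 0) :=
      tendsto_const_nhds.congr' (by
        filter_upwards [self_mem_nhdsWithin] with x hx
        exact (h1 x hx).symm)
    exact tendsto_nhds_unique (hc.tendsto.mono_left nhdsWithin_le_nhds) h2
  · exact h1 y h

lemma IsCut.mul {β : ℝ → ℝ} (hβ : IsCut β) {f : ℝ → ℝ} (hf : ContDiffOn ℝ ∞ f (Ioi 0)) :
    IsCut (fun y => f y * β y) :=
  ⟨hf.mul hβ.smooth, fun y hy => by rw [hβ.zero y hy, mul_zero]⟩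

lemma IsProf.euler {n : ℕ} {g : ℝ → ℝ} (hg : IsProf (n + 1) g) : IsProf n (euler g) := by
  obtain ⟨u₀, h0, hu⟩ := hg.zero
  refine ⟨?_, u₀ + 1, by linarith, fun u hu' => ?_⟩
  · have h1 : ContDiff ℝ n (deriv g) := by
      have := hg.smooth
      push_cast at this
      exact (contDiff_succ_iff_deriv.1 this).2.2
    exact contDiff_neg.mul h1
  · have : deriv g u = 0 := by
      apply deriv_eq_zero_of_eventually
      filter_upwards [isOpen_Ioi.mem_nhds (show u₀ < u by linarith)] with x hx
      exact hu x (le_of_lt hx)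
    rw [LinnikSums.euler, this, mul_zero]

lemma IsProf.mono {m n : ℕ} {g : ℝ → ℝ} (hg : IsProf n g) (h : m ≤ n) : IsProf m g :=
  ⟨hg.smooth.of_le (by exact_mod_cast h), hg.zero⟩

lemma IsProf.add {n : ℕ} {f g : ℝ → ℝ} (hf : IsProf n f) (hg : IsProf n g) (a b : ℝ) :
    IsProf n (fun u => a * f u + b * g u) := by
  obtain ⟨u₀, h0, hu⟩ := hf.zero
  obtain ⟨u₁, h1, hu₁⟩ := hg.zero
  refine ⟨(contDiff_const.mul hf.smooth).add (contDiff_const.mul hg.smooth), max u₀ u₁,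
    lt_max_of_lt_left h0, fun u hu' => ?_⟩
  rw [hu u ((le_max_left _ _).trans hu'), hu₁ u ((le_max_right _ _).trans hu')]
  ring

lemma IsProf.dil {n : ℕ} {g : ℝ → ℝ} (hg : IsProf (n + 1) g) : IsProf n (dil g) := by
  have := hg.euler.add (hg.mono n.le_succ) 1 (-(1/2))
  convert this using 1
  funext u
  rw [LinnikSums.dil]; ring

lemma IsProf.exists_bound {g : ℝ → ℝ} {n : ℕ} (hg : IsProf n g) :
    ∃ M, 0 ≤ M ∧ ∀ u, 0 ≤ u → |g u| ≤ M := by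
  obtain ⟨u₀, h0, hu⟩ := hg.zero
  obtain ⟨M, hM⟩ := (isCompact_Icc (a := (0:ℝ)) (b := u₀)).exists_bound_of_continuousOn
    hg.smooth.continuous.continuousOn
  refine ⟨max M 0, le_max_right _ _, fun u hu' => ?_⟩
  by_cases h : u₀ ≤ u
  · rw [hu u h]; simp
  · exact (hM u ⟨hu', (not_le.1 h).le⟩).trans (le_max_left _ _)

section

variable {α β g : ℝ → ℝ} {n : ℕ} (s : ℝ)

lemma profKernel_of_pos {z : ℂ} (hz : 0 < z.im) : profKernel α β g s z =
    α z.re * β z.im * (Real.exp (-s / 2) * g (Real.exp (-s) / z.im)) := by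
  simp [profKernel, hz]

lemma profKernel_eq_zero {u₀ : ℝ} (h0 : 0 < u₀) (hu : ∀ u, u₀ ≤ u → g u = 0) {z : ℂ}
    (hz : z.im ≤ Real.exp (-s) / u₀) : profKernel α β g s z = 0 := by
  rw [profKernel]
  split_ifs with h
  · rw [hu, mul_zero, mul_zero]
    rw [le_div_iff₀ h0] at hz
    rw [le_div_iff₀ h]
    linarith
  · rfl

lemma profKernel_eventually_zero (hg : IsProf n g) {z : ℂ} (hz : z.im ≤ 0) :
    profKernel α β g s =ᶠ[𝓝 z] 0 := by
  obtain ⟨u₀, h0, hu⟩ := hg.zero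
  have h1 : z.im < Real.exp (-s) / u₀ := hz.trans_lt (by positivity)
  filter_upwards [(isOpen_lt Complex.continuous_im continuous_const).mem_nhds h1] with w hw
  exact profKernel_eq_zero s h0 hu (le_of_lt hw)

lemma profKernel_support (hα : ∀ x, 1 ≤ |x| → α x = 0) (hβ : ∀ y, 2 ≤ y → β y = 0) {z : ℂ}
    (h : profKernel α β g s z ≠ 0) : |z.re| ≤ 1 ∧ z.im ≤ 2 := by
  constructor
  · by_contra! hx
    apply h
    rw [profKernel, hα _ hx.le]; simp
  · by_contra! hx
    apply h
    rw [profKernel, hβ _ hx.le]; simp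

lemma contDiff_profKernel (hα : IsBump α) (hβ : IsCut β) (hg : IsProf n g) :
    ContDiff ℝ n (profKernel α β g s) := by
  rw [contDiff_iff_contDiffAt]
  intro z
  by_cases hz : 0 < z.im
  · have he : profKernel α β g s =ᶠ[𝓝 z] fun z =>
        α z.re * β z.im * (Real.exp (-s / 2) * g (Real.exp (-s) / z.im)) := by
      filter_upwards [(isOpen_lt continuous_const Complex.continuous_im).mem_nhds hz] with w hw
      exact profKernel_of_pos s hw
    refine ContDiffAt.congr_of_eventuallyEq ?_ he
    have hre : ContDiffAt ℝ n (fun z : ℂ => z.re) z := Complex.reCLM.contDiff.contDiffAt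
    have him : ContDiffAt ℝ n (fun z : ℂ => z.im) z := Complex.imCLM.contDiff.contDiffAt
    have hn : (n : WithTop ℕ∞) ≤ ((⊤ : ℕ∞) : WithTop ℕ∞) := by exact_mod_cast le_top
    refine ((hα.smooth.of_le hn).contDiffAt.comp z hre |>.mul ?_).mul (contDiffAt_const.mul ?_)
    · exact ((hβ.smooth.of_le hn).contDiffAt (isOpen_Ioi.mem_nhds hz)).comp z him
    · exact hg.smooth.contDiffAt.comp z (contDiffAt_const.div him hz.ne')
  · exact contDiffAt_const.congr_of_eventuallyEq
      (profKernel_eventually_zero s hg (not_lt.1 hz))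

lemma isTest_profKernel (hα : IsBump α) (hβ : IsCut β) (hg : IsProf n g) :
    IsTest (profKernel α β g s) := by
  obtain ⟨u₀, h0, hu⟩ := hg.zero
  set K : Set ℂ := Icc (-1) 1 ×ℂ Icc (Real.exp (-s) / u₀) 2 with hK
  have hKc : IsCompact K := isCompact_Icc.reProdIm isCompact_Icc
  have hsub : ∀ z ∉ K, profKernel α β g s z = 0 := by
    intro z hz
    by_contra h
    obtain ⟨h1, h2⟩ := profKernel_support s hα.zero hβ.zero h
    refine hz ⟨abs_le.1 h1, ?_, h2⟩
    by_contra! h3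
    exact h (profKernel_eq_zero s h0 hu h3.le)
  refine ⟨(contDiff_profKernel s hα hβ (hg.mono n.zero_le)).continuous,
    HasCompactSupport.intro hKc hsub, ?_⟩
  refine (closure_minimal (fun z hz => ?_) hKc.isClosed).trans
    fun z hz => lt_of_lt_of_le (by positivity : 0 < Real.exp (-s) / u₀) hz.2.1
  by_contra h
  exact hz (hsub z h)

lemma hasDerivAt_re {k : ℂ → ℝ} (z : ℂ) (hk : DifferentiableAt ℝ k z) :
    HasDerivAt (fun x => k ⟨x, z.im⟩) (fderiv ℝ k z 1) z.re := by
  refine (hasDerivAt_vertical (v := k) (x := z.re) (y := z.im) hk (hasDerivAt_id _)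
    (hasDerivAt_const _ z.im) rfl rfl).congr_deriv ?_
  simp

lemma hasDerivAt_im {k : ℂ → ℝ} (z : ℂ) (hk : DifferentiableAt ℝ k z) :
    HasDerivAt (fun y => k ⟨z.re, y⟩) (fderiv ℝ k z Complex.I) z.im := by
  refine (hasDerivAt_vertical (v := k) (x := z.re) (y := z.im) hk (hasDerivAt_const _ z.re)
    (hasDerivAt_id _) rfl rfl).congr_deriv ?_
  simp

lemma fderiv_profKernel_one (hα : IsBump α) (hβ : IsCut β) (hg : IsProf 1 g) (z : ℂ) :
    fderiv ℝ (profKernel α β g s) z 1 = profKernel (deriv α) β g s z := by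
  by_cases hz : 0 < z.im
  · have h1 := hasDerivAt_re z
      ((contDiff_profKernel s hα hβ hg).differentiable (by norm_num)).differentiableAt
    have hd : HasDerivAt α (deriv α z.re) z.re :=
      (hα.smooth.differentiable (by simp)).differentiableAt.hasDerivAt
    have h2 := (hd.mul_const (β z.im)).mul_const
      (Real.exp (-s / 2) * g (Real.exp (-s) / z.im))
    rw [profKernel_of_pos s hz]
    refine h1.unique (h2.congr_of_eventuallyEq (Eventually.of_forall fun x => ?_))
    exact profKernel_of_pos s (z := ⟨x, z.im⟩) hz
  · rw [(profKernel_eventually_zero s hg (not_lt.1 hz)).fderiv_eq, profKernel, if_neg hz]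
    simp

lemma fderiv_profKernel_I (hα : IsBump α) (hβ : IsCut β) (hg : IsProf 1 g) (z : ℂ) :
    fderiv ℝ (profKernel α β g s) z Complex.I = profKernel α (deriv β) g s z +
      profKernel α (fun y => y⁻¹ * β y) (euler g) s z := by
  by_cases hz : 0 < z.im
  · have h1 := hasDerivAt_im z
      ((contDiff_profKernel s hα hβ hg).differentiable (by norm_num)).differentiableAt
    have hd : HasDerivAt β (deriv β z.im) z.im :=
      ((hβ.smooth.differentiableOn (by simp)).differentiableAt
        (isOpen_Ioi.mem_nhds hz)).hasDerivAt
    have hgd : HasDerivAt g (deriv g (Real.exp (-s) / z.im)) (Real.exp (-s) / z.im) :=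
      (hg.smooth.differentiable (by norm_num)).differentiableAt.hasDerivAt
    have hinv : HasDerivAt (fun y => Real.exp (-s) / y) (Real.exp (-s) * (-(z.im ^ 2)⁻¹)) z.im := by
      simp only [div_eq_mul_inv]
      exact (hasDerivAt_inv hz.ne').const_mul _
    have h2 := (hd.const_mul (α z.re)).fun_mul
      ((hgd.comp z.im hinv).const_mul (Real.exp (-s / 2)))
    rw [profKernel_of_pos s hz, profKernel_of_pos s hz]
    refine (h1.unique (h2.congr_of_eventuallyEq ?_)).trans ?_
    · filter_upwards [isOpen_Ioi.mem_nhds hz] with y hy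
      exact profKernel_of_pos s (z := ⟨z.re, y⟩) hy
    · have := hz.ne'
      simp only [euler, Function.comp]
      field_simp
  · rw [(profKernel_eventually_zero s hg (not_lt.1 hz)).fderiv_eq, profKernel, if_neg hz,
      profKernel, if_neg hz]
    simp

lemma isCut_inv_mul (hβ : IsCut β) : IsCut (fun y => y⁻¹ * β y) :=
  hβ.mul (contDiffOn_id.inv fun _ hy => ne_of_gt hy)

lemma hypLap_profKernel (hα : IsBump α) (hβ : IsCut β) (hg : IsProf 2 g) :
    hypLap (profKernel α β g s) = (-1 : ℝ) •
      (profKernel (deriv (deriv α)) (fun y => y ^ 2 * β y) g s +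
      profKernel α (fun y => y ^ 2 * deriv (deriv β) y) g s +
      profKernel α (fun y => 2 * y * deriv β y) (euler g) s +
      profKernel α β (fun u => 1 * euler (euler g) u + (-1) * euler g u) s) := by
  have hg1 : IsProf 1 g := hg.mono (by norm_num)
  funext z
  have e1 : (fun w => fderiv ℝ (profKernel α β g s) w 1) = profKernel (deriv α) β g s :=
    funext fun w => fderiv_profKernel_one s hα hβ hg1 w
  have e2 : (fun w => fderiv ℝ (profKernel α β g s) w Complex.I) =
      profKernel α (deriv β) g s + profKernel α (fun y => y⁻¹ * β y) (euler g) s :=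
    funext fun w => fderiv_profKernel_I s hα hβ hg1 w
  have d1 : DifferentiableAt ℝ (profKernel α (deriv β) g s) z :=
    ((contDiff_profKernel s hα hβ.deriv hg1).differentiable (by norm_num)).differentiableAt
  have d2 : DifferentiableAt ℝ (profKernel α (fun y => y⁻¹ * β y) (euler g) s) z :=
    ((contDiff_profKernel s hα (isCut_inv_mul hβ) (hg.euler (n := 1))).differentiable
      (by norm_num)).differentiableAt
  rw [hypLap, e1, e2, fderiv_add d1 d2, add_apply,
    fderiv_profKernel_one s hα.deriv hβ hg1, fderiv_profKernel_I s hα hβ.deriv hg1,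
    fderiv_profKernel_I s hα (isCut_inv_mul hβ) (hg.euler (n := 1))]
  simp only [Pi.smul_apply, Pi.add_apply]
  by_cases hz : 0 < z.im
  · have hd : HasDerivAt β (deriv β z.im) z.im :=
      ((hβ.smooth.differentiableOn (by simp)).differentiableAt
        (isOpen_Ioi.mem_nhds hz)).hasDerivAt
    have h3 : deriv (fun y => y⁻¹ * β y) z.im =
        -(z.im ^ 2)⁻¹ * β z.im + z.im⁻¹ * deriv β z.im :=
      ((hasDerivAt_inv hz.ne').fun_mul hd).deriv
    simp only [profKernel_of_pos s hz, h3]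
    have := hz.ne'
    simp only [smul_eq_mul]
    field_simp
    ring
  · simp [profKernel, hz]

end

lemma abs_taylor_le {f f' f'' : ℝ → ℝ} (hf : ∀ s, HasDerivAt f (f' s) s)
    (hf' : ∀ s, HasDerivAt f' (f'' s) s) {s N : ℝ} (hN : ∀ r ∈ Icc (s - 1) (s + 1), |f'' r| ≤ N)
    {t : ℝ} (ht : |t| ≤ 1) : |f (s + t) - f s - t * f' s| ≤ N * t ^ 2 := by
  have hs : s ∈ Icc (s - 1) (s + 1) := ⟨by linarith, by linarith⟩
  have hN0 : 0 ≤ N := (abs_nonneg _).trans (hN s hs)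
  have hst : s + t ∈ Icc (s - 1) (s + 1) := by
    rw [abs_le] at ht
    exact ⟨by linarith [ht.1], by linarith [ht.2]⟩
  have hsub : uIcc s (s + t) ⊆ Icc (s - 1) (s + 1) := by
    rw [← uIcc_of_le (show s - 1 ≤ s + 1 by linarith)] at hs hst ⊢
    exact uIcc_subset_uIcc hs hst
  have h1 : ∀ r ∈ uIcc s (s + t), ‖f' r - f' s‖ ≤ N * |t| := by
    intro r hr
    have := (convex_Icc (s - 1) (s + 1)).norm_image_sub_le_of_norm_hasDerivWithin_le
      (fun x _ => (hf' x).hasDerivWithinAt) hN hs (hsub hr)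
    refine this.trans (mul_le_mul_of_nonneg_left ?_ hN0)
    rw [Real.norm_eq_abs]
    simpa using abs_sub_left_of_mem_uIcc hr
  have h2 := (convex_uIcc s (s + t)).norm_image_sub_le_of_norm_hasDerivWithin_le
    (f := fun r => f r - r * f' s) (f' := fun r => f' r - f' s)
    (fun x _ => (((hf x).fun_sub ((hasDerivAt_id x).mul_const (f' s))).congr_deriv
      (by simp)).hasDerivWithinAt) h1 left_mem_uIcc right_mem_uIcc
  have h3 : f (s + t) - (s + t) * f' s - (f s - s * f' s) = f (s + t) - f s - t * f' s := by ring
  rw [h3, Real.norm_eq_abs, add_sub_cancel_left, Real.norm_eq_abs, mul_assoc, abs_mul_abs_self] at h2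
  rwa [pow_two]

lemma hasDerivAt_profile {g : ℝ → ℝ} (hg : IsProf 1 g) (y s : ℝ) :
    HasDerivAt (fun s => Real.exp (-s / 2) * g (Real.exp (-s) / y))
      (Real.exp (-s / 2) * dil g (Real.exp (-s) / y)) s := by
  have h1 : HasDerivAt (fun s : ℝ => Real.exp (-s / 2)) (Real.exp (-s / 2) * (-1 / 2)) s :=
    (((hasDerivAt_id s).fun_neg).div_const 2).exp
  have h2 : HasDerivAt (fun s : ℝ => Real.exp (-s) / y) (Real.exp (-s) * (-1) / y) s :=
    ((hasDerivAt_id s).fun_neg).exp.div_const y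
  have hgd : HasDerivAt g (deriv g (Real.exp (-s) / y)) (Real.exp (-s) / y) :=
    (hg.smooth.differentiable (by norm_num)).differentiableAt.hasDerivAt
  refine (h1.fun_mul (hgd.comp s h2)).congr_deriv ?_
  simp only [dil, euler, Function.comp]
  ring

section

variable {α β g : ℝ → ℝ}

lemma profKernel_linear (f g : ℝ → ℝ) (a b s : ℝ) :
    profKernel α β (fun u => a * f u + b * g u) s =
      a • profKernel α β f s + b • profKernel α β g s := by
  funext z
  simp only [profKernel, Pi.add_apply, Pi.smul_apply, smul_eq_mul]
  split_ifs <;> ring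

lemma abs_profKernel_le {Ma Mb Mg : ℝ} (hMa : ∀ x, |α x| ≤ Ma) {z : ℂ} (hz : 0 < z.im)
    (hMb : |β z.im| ≤ Mb) (hMg : ∀ u, 0 ≤ u → |g u| ≤ Mg) (s : ℝ) :
    |profKernel α β g s z| ≤ Ma * Mb * (Real.exp (-s / 2) * Mg) := by
  rw [profKernel_of_pos s hz, abs_mul, abs_mul, abs_mul, abs_of_pos (Real.exp_pos _)]
  have h1 := hMg (Real.exp (-s) / z.im) (by positivity)
  have h2 := (abs_nonneg _).trans (hMa z.re)
  have h3 := (abs_nonneg _).trans hMb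
  gcongr
  exact hMa _

lemma hasDerivAt_automL2_profKernel (hα : IsBump α) (hβ : IsCut β) {Mb : ℝ}
    (hMb : ∀ y, 0 < y → |β y| ≤ Mb) (hg : IsProf 2 g) (s : ℝ) :
    HasDerivAt (fun s => automL2 (profKernel α β g s))
      (automL2 (profKernel α β (dil g) s)) s := by
  obtain ⟨C, hC, hbd⟩ := exists_bound_automL2
  obtain ⟨Ma, hMa0, hMa⟩ := hα.exists_bound
  have hg1 : IsProf 1 (dil g) := hg.dil
  obtain ⟨N, hN0, hN⟩ := (IsProf.dil (n := 0) hg1).exists_bound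
  obtain ⟨u₀, h0, hu⟩ := hg.zero
  obtain ⟨u₁, h1, hu₁⟩ := hg1.zero
  have hMb0 : 0 ≤ Mb := (abs_nonneg _).trans (hMb 1 one_pos)
  set y₀ := Real.exp (-(s + 1)) / max u₀ u₁ with hy₀
  have hU : 0 < max u₀ u₁ := lt_max_of_lt_left h0
  have hy0 : 0 < y₀ := by positivity
  set N' := Real.exp (-(s - 1) / 2) * N with hN'
  set A := Ma * Mb * N' / y₀ ^ 2 with hA
  have hA0 : 0 ≤ A := by positivity
  have key : ∀ t, |t| ≤ 1 → ‖automL2 (profKernel α β g (s + t)) - automL2 (profKernel α β g s) -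
      t • automL2 (profKernel α β (dil g) s)‖ ≤ C * (A * t ^ 2) := by
    intro t ht
    have T1 := isTest_profKernel (s + t) hα hβ hg
    have T2 := isTest_profKernel s hα hβ hg
    have T3 := isTest_profKernel s hα hβ hg1
    have e : automL2 (profKernel α β g (s + t)) - automL2 (profKernel α β g s) -
        t • automL2 (profKernel α β (dil g) s) = automL2 (profKernel α β g (s + t) +
          ((-1 : ℝ) • profKernel α β g s + (-t) • profKernel α β (dil g) s)) := by
      rw [automL2_add T1 ((T2.smul _).add (T3.smul _)), automL2_add (T2.smul _) (T3.smul _),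
        automL2_smul T2, automL2_smul T3]
      module
    rw [e]
    refine hbd _ _ (T1.add ((T2.smul _).add (T3.smul _))) (by positivity) ?_ ?_
    · intro z hz
      rw [abs_le] at ht
      simp only [Pi.add_apply, Pi.smul_apply, smul_eq_mul]
      have hle : Real.exp (-(s + 1)) ≤ Real.exp (-(s + t)) := Real.exp_le_exp.2 (by linarith)
      have hle' : Real.exp (-(s + 1)) ≤ Real.exp (-s) := Real.exp_le_exp.2 (by linarith)
      by_cases hzy : z.im ≤ y₀
      · rw [profKernel_eq_zero (s + t) hU (fun u h => hu u ((le_max_left _ _).trans h)),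
          profKernel_eq_zero s hU (fun u h => hu u ((le_max_left _ _).trans h)),
          profKernel_eq_zero s hU (fun u h => hu₁ u ((le_max_right _ _).trans h))]
        · simp only [mul_zero, add_zero, abs_zero]; positivity
        · exact hzy.trans (by rw [hy₀]; gcongr)
        · exact hzy.trans (by rw [hy₀]; gcongr)
        · exact hzy.trans (by rw [hy₀]; gcongr)
      · have hzy := not_le.1 hzy
        have ht' := abs_taylor_le (hasDerivAt_profile (hg.mono one_le_two) z.im)
          (hasDerivAt_profile hg1 z.im) (s := s) (N := N') (t := t) (fun r hr => by
            rw [abs_mul, abs_of_pos (Real.exp_pos _), hN']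
            have := hN (Real.exp (-r) / z.im) (by positivity)
            have h2 : Real.exp (-r / 2) ≤ Real.exp (-(s - 1) / 2) :=
              Real.exp_le_exp.2 (by linarith [hr.1])
            gcongr) (abs_le.2 ht)
        rw [profKernel_of_pos _ hz, profKernel_of_pos _ hz, profKernel_of_pos _ hz]
        have e2 : ∀ a b p q r : ℝ, a * b * p + (-1 * (a * b * q) + -t * (a * b * r)) =
            a * b * (p - q - t * r) := fun a b p q r => by ring
        rw [e2, abs_mul, abs_mul]
        calc _ ≤ Ma * Mb * (N' * t ^ 2) := by
              gcongr
              · exact hMa _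
              · exact hMb _ hz
          _ = A * t ^ 2 * y₀ ^ 2 := by rw [hA]; field_simp
          _ ≤ _ := by gcongr
    · intro z hz
      by_contra hcon
      apply hz
      have hsup : ∀ r f, profKernel α β f r z = 0 := fun r f => by
        by_contra h
        exact hcon (profKernel_support r hα.zero hβ.zero h)
      simp [hsup]
  rw [hasDerivAt_iff_isLittleO_nhds_zero]
  refine Asymptotics.IsBigO.trans_isLittleO (g := fun t : ℝ => t ^ 2) ?_ ?_
  · refine Asymptotics.IsBigO.of_bound (C * A) ?_
    filter_upwards [Metric.ball_mem_nhds (0 : ℝ) one_pos] with t ht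
    have := key t (by simpa using (mem_ball_zero_iff.1 ht).le)
    rwa [Real.norm_of_nonneg (sq_nonneg t), mul_assoc]
  · simpa using Asymptotics.isLittleO_pow_pow (𝕜 := ℝ) (m := 1) (n := 2) (by norm_num)

end

/-- A smooth cutoff, `1` on `(-∞, 1]` and `0` on `[2, ∞)`. -/
noncomputable def cutoff (y : ℝ) : ℝ := 1 - Real.smoothTransition (y - 1)

lemma cutoff_of_le_one {y : ℝ} (hy : y ≤ 1) : cutoff y = 1 := by
  rw [cutoff, Real.smoothTransition.zero_of_nonpos (by linarith), sub_zero]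

lemma cutoff_of_two_le {y : ℝ} (hy : 2 ≤ y) : cutoff y = 0 := by
  rw [cutoff, Real.smoothTransition.one_of_one_le (by linarith), sub_self]

lemma cutoff_nonneg (y : ℝ) : 0 ≤ cutoff y := by
  have := Real.smoothTransition.le_one (y - 1)
  rw [cutoff]; linarith

lemma cutoff_le_one (y : ℝ) : cutoff y ≤ 1 := by
  have := Real.smoothTransition.nonneg (y - 1)
  rw [cutoff]; linarith

lemma contDiff_cutoff : ContDiff ℝ ∞ cutoff :=
  contDiff_const.sub (Real.smoothTransition.contDiff.comp (contDiff_id.sub contDiff_const))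

lemma isCut_cutoff : IsCut cutoff := ⟨contDiff_cutoff.contDiffOn, fun _ => cutoff_of_two_le⟩

lemma deriv_cutoff_eq_zero {y : ℝ} (hy : y < 1) : deriv cutoff y = 0 := by
  have : cutoff =ᶠ[𝓝 y] fun _ => 1 := by
    filter_upwards [Iio_mem_nhds hy] with x hx
    exact cutoff_of_le_one (le_of_lt hx)
  rw [this.deriv_eq]; simp

lemma deriv_deriv_cutoff_eq_zero {y : ℝ} (hy : y < 1) : deriv (deriv cutoff) y = 0 := by
  apply deriv_eq_zero_of_eventually
  filter_upwards [Iio_mem_nhds hy] with x hx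
  exact deriv_cutoff_eq_zero hx

lemma IsCut.exists_bound {β : ℝ → ℝ} (hβ : IsCut β) (h1 : ∀ y < 1, β y = 0) :
    ∃ M, 0 ≤ M ∧ ∀ y, |β y| ≤ M := by
  obtain ⟨M, hM⟩ := (isCompact_Icc (a := (1:ℝ)) (b := 2)).exists_bound_of_continuousOn
    (hβ.smooth.continuousOn.mono fun y hy => lt_of_lt_of_le one_pos hy.1)
  refine ⟨max M 0, le_max_right _ _, fun y => ?_⟩
  by_cases hy : y ∈ Icc (1:ℝ) 2
  · exact (hM y hy).trans (le_max_left _ _)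
  · have : β y = 0 := by
      rw [mem_Icc, not_and_or, not_le, not_le] at hy
      exact hy.elim (h1 y) fun h => hβ.zero y h.le
    rw [this]; simp

lemma bounded_of_le_sq {β : ℝ → ℝ} (hβ : IsCut β) {M : ℝ} (hM0 : 0 ≤ M)
    (hM : ∀ y, 0 < y → |β y| ≤ M * y ^ 2) : ∀ y, 0 < y → |β y| ≤ 4 * M := by
  intro y hy
  by_cases h : 2 ≤ y
  · rw [hβ.zero y h]; simpa using hM0
  · refine (hM y hy).trans ?_
    have h := not_le.1 h
    have : y ^ 2 ≤ 4 := by nlinarith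
    nlinarith

lemma euler_linear {f g : ℝ → ℝ} (hf : Differentiable ℝ f) (hg : Differentiable ℝ g) (a b : ℝ) :
    euler (fun u => a * f u + b * g u) = fun u => a * euler f u + b * euler g u := by
  funext u
  have h : deriv (fun u => a * f u + b * g u) u = a * deriv f u + b * deriv g u :=
    (((hf u).hasDerivAt.const_mul a).fun_add ((hg u).hasDerivAt.const_mul b)).deriv
  rw [euler, h, euler, euler]
  ring

lemma dil_eq (g : ℝ → ℝ) : dil g = fun u => 1 * euler g u + (-(1 / 2)) * g u := by
  funext u; rw [dil]; ring

lemma IsProf.differentiable {n : ℕ} {g : ℝ → ℝ} (hg : IsProf (n + 1) g) : Differentiable ℝ g :=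
  (hg.smooth.of_le (m := 1) (by exact_mod_cast Nat.le_add_left 1 n)).differentiable (by norm_num)

lemma euler_dil {g : ℝ → ℝ} (hg : IsProf 2 g) : euler (dil g) = dil (euler g) := by
  rw [dil_eq g, euler_linear (IsProf.differentiable (n := 0) (hg.euler (n := 1)))
    (IsProf.differentiable (n := 1) hg), dil_eq (euler g)]

section

variable {η g : ℝ → ℝ}

/-- The vectors `u(s)` in the evolution equation. -/
lemma automL2_hypLap_profKernel (hη : IsBump η) (hg : IsProf 2 g) (s : ℝ) :
    automL2 (hypLap (profKernel η cutoff g s)) = (-1 : ℝ) •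
      (automL2 (profKernel (deriv (deriv η)) (fun y => y ^ 2 * cutoff y) g s) +
      automL2 (profKernel η (fun y => y ^ 2 * deriv (deriv cutoff) y) g s) +
      automL2 (profKernel η (fun y => 2 * y * deriv cutoff y) (euler g) s) +
      automL2 (profKernel η cutoff (fun u => 1 * euler (euler g) u + (-1) * euler g u) s)) := by
  have hp : ContDiff ℝ ∞ fun y : ℝ => y ^ 2 := contDiff_id.pow 2
  have hp' : ContDiff ℝ ∞ fun y : ℝ => 2 * y := contDiff_const.mul contDiff_id
  have T1 := isTest_profKernel s hη.deriv.deriv (isCut_cutoff.mul hp.contDiffOn) hg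
  have T2 := isTest_profKernel s hη (isCut_cutoff.deriv.deriv.mul hp.contDiffOn) hg
  have T3 := isTest_profKernel s hη (isCut_cutoff.deriv.mul hp'.contDiffOn) (hg.euler (n := 1))
  have T4 := isTest_profKernel s hη isCut_cutoff
    (((hg.euler (n := 1)).euler (n := 0)).add ((hg.euler (n := 1)).mono zero_le_one) 1 (-1))
  rw [hypLap_profKernel s hη isCut_cutoff hg, automL2_smul (((T1.add T2).add T3).add T4),
    automL2_add ((T1.add T2).add T3) T4, automL2_add (T1.add T2) T3, automL2_add T1 T2]

lemma exists_le_sq_cutoff : ∃ M, 0 ≤ M ∧ (∀ y, 0 < y → |y ^ 2 * cutoff y| ≤ M * y ^ 2) ∧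
    (∀ y, 0 < y → |y ^ 2 * deriv (deriv cutoff) y| ≤ M * y ^ 2) ∧
    ∀ y, 0 < y → |2 * y * deriv cutoff y| ≤ M * y ^ 2 := by
  obtain ⟨M1, hM1, h1⟩ := isCut_cutoff.deriv.exists_bound fun y => deriv_cutoff_eq_zero
  obtain ⟨M2, hM2, h2⟩ := isCut_cutoff.deriv.deriv.exists_bound fun y => deriv_deriv_cutoff_eq_zero
  refine ⟨1 + 2 * M1 + M2, by positivity, fun y hy => ?_, fun y hy => ?_, fun y hy => ?_⟩
  · rw [abs_mul, abs_of_nonneg (sq_nonneg y), abs_of_nonneg (cutoff_nonneg y), mul_comm]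
    have := cutoff_le_one y
    gcongr
    linarith
  · rw [abs_mul, abs_of_nonneg (sq_nonneg y), mul_comm]
    have := h2 y
    gcongr
    linarith
  · by_cases hy1 : y < 1
    · rw [deriv_cutoff_eq_zero hy1]; simp; positivity
    · have hy1 := not_lt.1 hy1
      rw [abs_mul, abs_of_nonneg (by positivity)]
      have h3 : y ≤ y ^ 2 := by nlinarith
      calc 2 * y * |deriv cutoff y| ≤ 2 * y ^ 2 * M1 := by gcongr; exact h1 y
        _ ≤ _ := by nlinarith [sq_nonneg y]

lemma integral_profKernel_eq_zero (h0 : ∫ x, η x = 0) (s : ℝ) :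
    ∫ z : ℍ, profKernel η cutoff g s z = 0 := by
  rw [integral_uhp (profKernel η cutoff g s)]
  have e : ∀ z : ℂ, ({z : ℂ | 0 < z.im}.indicator
      (fun z => (z.im ^ 2)⁻¹ • profKernel η cutoff g s z)) z =
      η z.re * (Ioi (0:ℝ)).indicator (fun y => (y ^ 2)⁻¹ * (cutoff y * (Real.exp (-s / 2) *
        g (Real.exp (-s) / y)))) z.im := by
    intro z
    by_cases hz : 0 < z.im
    · rw [indicator_of_mem (by exact hz), indicator_of_mem (by exact hz), profKernel_of_pos s hz,
        smul_eq_mul]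
      ring
    · rw [indicator_of_notMem (by exact hz), indicator_of_notMem (by exact hz), mul_zero]
  rw [← integral_indicator measurableSet_im_pos]
  simp_rw [e]
  rw [integral_complex_eq_prod, Measure.volume_eq_prod]
  dsimp only
  rw [integral_prod_mul (f := η), h0, zero_mul]

/-- Polynomial growth of the incomplete Poincaré-type series in `s`. -/
theorem exists_automL2_growth (hη : IsBump η) (h0 : ∫ x, η x = 0) (hg : IsProf 4 g) :
    ∃ M, 0 ≤ M ∧ ∀ s, 0 ≤ s → ‖automL2 (profKernel η cutoff g s)‖ ≤ M * (1 + s) := by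
  have hg3 : IsProf 3 (dil g) := hg.dil
  have hg2 : IsProf 2 (dil (dil g)) := hg3.dil
  have hE : IsProf 3 (euler g) := hg.euler
  have hEE : IsProf 2 (euler (euler g)) := hE.euler
  have hp : ContDiff ℝ ∞ fun y : ℝ => y ^ 2 := contDiff_id.pow 2
  have hp' : ContDiff ℝ ∞ fun y : ℝ => 2 * y := contDiff_const.mul contDiff_id
  have c1 := isCut_cutoff.mul hp.contDiffOn
  have c2 := isCut_cutoff.deriv.deriv.mul hp.contDiffOn
  have c3 := isCut_cutoff.deriv.mul hp'.contDiffOn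
  obtain ⟨M, hM0, hM1, hM2, hM3⟩ := exists_le_sq_cutoff
  have hb : ∀ y, 0 < y → |cutoff y| ≤ 1 := fun y _ => by
    rw [abs_of_nonneg (cutoff_nonneg y)]; exact cutoff_le_one y
  obtain ⟨Ma, hMa0, hMa⟩ := hη.exists_bound
  obtain ⟨Mb, hMb0, hMb⟩ := hη.deriv.deriv.exists_bound
  obtain ⟨Mg, hMg0, hMg⟩ := hg.exists_bound
  obtain ⟨Me, hMe0, hMe⟩ := hE.exists_bound
  obtain ⟨C, hC0, hC⟩ := exists_bound_automL2
  refine energy_growth (v := fun s => automL2 (profKernel η cutoff g s))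
    (v' := fun s => automL2 (profKernel η cutoff (dil g) s))
    (v'' := fun s => automL2 (profKernel η cutoff (dil (dil g)) s))
    (u := fun s => automL2 (hypLap (profKernel η cutoff g s)))
    (u' := fun s => automL2 (hypLap (profKernel η cutoff (dil g) s)))
    (C := C * (Mb * M * Mg + Ma * M * Mg + Ma * M * Me))
    (fun s => hasDerivAt_automL2_profKernel hη isCut_cutoff hb (hg.mono (by norm_num)) s)
    (fun s => hasDerivAt_automL2_profKernel hη isCut_cutoff hb (hg3.mono (by norm_num)) s)
    ?_ ?_ ?_ (by positivity) ?_
  · intro s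
    have hd2 : IsProf 2 (dil g) := hg3.mono (by norm_num)
    have eL : euler (dil g) = dil (euler g) := euler_dil (hg.mono (by norm_num))
    have eLL : (fun u => 1 * euler (euler (dil g)) u + (-1) * euler (dil g) u) =
        dil (fun u => 1 * euler (euler g) u + (-1) * euler g u) := by
      rw [eL, euler_dil (hE.mono (by norm_num)), dil_eq (fun u => _ + _),
        euler_linear (IsProf.differentiable (n := 1) hEE) (IsProf.differentiable (n := 2) hE),
        dil_eq, dil_eq]
      funext u; ring
    simp_rw [automL2_hypLap_profKernel hη (hg.mono (by norm_num : 2 ≤ 4)),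
      automL2_hypLap_profKernel hη hd2]
    rw [eLL, eL]
    exact ((((hasDerivAt_automL2_profKernel hη.deriv.deriv c1 (bounded_of_le_sq c1 hM0 hM1)
      (hg.mono (by norm_num)) s).fun_add
      (hasDerivAt_automL2_profKernel hη c2 (bounded_of_le_sq c2 hM0 hM2)
      (hg.mono (by norm_num)) s)).fun_add
      (hasDerivAt_automL2_profKernel hη c3 (bounded_of_le_sq c3 hM0 hM3)
      (hE.mono (by norm_num)) s)).fun_add
      (hasDerivAt_automL2_profKernel hη isCut_cutoff hb
      (hEE.add (hE.mono (by norm_num)) 1 (-1)) s)).fun_const_smul (-1 : ℝ)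
  · intro s
    exact inner_hypLap_comm (isTest_profKernel s hη isCut_cutoff hg3)
      (contDiff_profKernel s hη isCut_cutoff (hg3.mono (n := 3) (m := 2) (by norm_num)))
      (isTest_profKernel s hη isCut_cutoff hg)
      (contDiff_profKernel s hη isCut_cutoff (hg.mono (m := 2) (by norm_num)))
  · intro s
    exact quarter_norm_sq_le (isTest_profKernel s hη isCut_cutoff hg)
      (contDiff_profKernel s hη isCut_cutoff (hg.mono (m := 2) (by norm_num)))
      (integral_profKernel_eq_zero h0 s)
  · intro s
    have T1 := isTest_profKernel s hη.deriv.deriv c1 hg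
    have T2 := isTest_profKernel s hη c2 hg
    have T3 := isTest_profKernel s hη c3 hE
    have T := isTest_profKernel s hη isCut_cutoff hg
    have TE := isTest_profKernel s hη isCut_cutoff hE
    have TEE := isTest_profKernel s hη isCut_cutoff hEE
    have e1 : dil (dil g) = fun u => 1 * euler (euler g) u +
        1 * ((-1) * euler g u + (1/4) * g u) := by
      rw [dil_eq (dil g), dil_eq g, euler_linear (IsProf.differentiable (n := 2) hE)
        (IsProf.differentiable (n := 3) hg)]
      funext u; ring
    have e2 : automL2 (profKernel η cutoff (dil (dil g)) s) +
        automL2 (hypLap (profKernel η cutoff g s)) - (1/4 : ℝ) • automL2 (profKernel η cutoff g s)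
        = -(automL2 (profKernel (deriv (deriv η)) (fun y => y ^ 2 * cutoff y) g s) +
        automL2 (profKernel η (fun y => y ^ 2 * deriv (deriv cutoff) y) g s) +
        automL2 (profKernel η (fun y => 2 * y * deriv cutoff y) (euler g) s)) := by
      rw [automL2_hypLap_profKernel hη (hg.mono (by norm_num)), e1]
      simp only [profKernel_linear]
      rw [automL2_add (TEE.smul _) (((TE.smul _).add (T.smul _)).smul _),
        automL2_smul ((TE.smul _).add (T.smul _)), automL2_add (TE.smul _) (T.smul _),
        automL2_add (TEE.smul _) (TE.smul _), automL2_smul TEE, automL2_smul TE, automL2_smul T]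
      module
    rw [e2, norm_neg]
    have bd : ∀ {α β f : ℝ → ℝ} {A G : ℝ}, IsBump α → IsCut β → IsTest (profKernel α β f s) →
        0 ≤ A → 0 ≤ G → (∀ x, |α x| ≤ A) → (∀ y, 0 < y → |β y| ≤ M * y ^ 2) →
        (∀ u, 0 ≤ u → |f u| ≤ G) →
        ‖automL2 (profKernel α β f s)‖ ≤ C * (A * M * G * Real.exp (-s / 2)) := by
      intro α β f A G hα hβ hT hA hG h1 h2 h3
      refine hC _ _ hT (by positivity) (fun z hz => ?_)
        (fun z hz => profKernel_support s hα.zero hβ.zero hz)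
      refine (abs_profKernel_le h1 hz (h2 _ hz) h3 s).trans (le_of_eq ?_)
      ring
    refine (norm_add₃_le).trans ?_
    have b1 := bd hη.deriv.deriv c1 T1 hMb0 hMg0 hMb hM1 hMg
    have b2 := bd hη c2 T2 hMa0 hMg0 hMa hM2 hMg
    have b3 := bd hη c3 T3 hMa0 hMe0 hMa hM3 hMe
    refine (add_le_add (add_le_add b1 b2) b3).trans (le_of_eq ?_)
    ring

end

/-! ### A partition of unity on the circle -/

/-- A bump function whose integer translates sum to `1`. -/
noncomputable def unitBump (x : ℝ) : ℝ := Real.smoothTransition (x + 1) - Real.smoothTransition x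

lemma contDiff_unitBump : ContDiff ℝ ∞ unitBump :=
  (Real.smoothTransition.contDiff.comp (contDiff_id.add contDiff_const)).sub
    Real.smoothTransition.contDiff

lemma unitBump_eq_zero {x : ℝ} (hx : 1 ≤ |x|) : unitBump x = 0 := by
  rcases le_abs.1 hx with h | h
  · rw [unitBump, Real.smoothTransition.one_of_one_le (by linarith),
      Real.smoothTransition.one_of_one_le (by linarith), sub_self]
  · rw [unitBump, Real.smoothTransition.zero_of_nonpos (by linarith),
      Real.smoothTransition.zero_of_nonpos (by linarith), sub_self]

lemma unitBump_add_unitBump {x : ℝ} (h0 : 0 ≤ x) (h1 : x ≤ 1) :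
    unitBump x + unitBump (x - 1) = 1 := by
  rw [unitBump, unitBump, Real.smoothTransition.one_of_one_le (by linarith : 1 ≤ x + 1),
    Real.smoothTransition.zero_of_nonpos (by linarith : x - 1 ≤ 0), sub_add_cancel]
  ring

lemma hasSum_unitBump (x : ℝ) : HasSum (fun n : ℤ => unitBump (x + n)) 1 := by
  have h := Int.fract_nonneg x
  have h' := (Int.fract_lt_one x).le
  have hx : (⌊x⌋ : ℝ) + Int.fract x = x := Int.floor_add_fract x
  have hs : HasSum (fun n : ℤ => unitBump (x + n)) (∑ n ∈ {-⌊x⌋, -⌊x⌋ - 1}, unitBump (x + n)) :=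
    hasSum_sum_of_ne_finset_zero (fun n hn => by
      apply unitBump_eq_zero
      simp only [Finset.mem_insert, Finset.mem_singleton, not_or] at hn
      have hh : 1 ≤ n + ⌊x⌋ ∨ n + ⌊x⌋ ≤ -2 := by omega
      rcases hh with h1 | h1
      · have : (1:ℝ) ≤ n + ⌊x⌋ := by exact_mod_cast h1
        exact le_abs.2 (Or.inl (by linarith))
      · have : (n:ℝ) + ⌊x⌋ ≤ -2 := by exact_mod_cast h1
        exact le_abs.2 (Or.inr (by linarith)))
  rw [Finset.sum_pair (by omega)] at hs
  push_cast at hs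
  rw [show x + (-(⌊x⌋:ℝ)) = Int.fract x by linarith,
    show x + (-(⌊x⌋:ℝ) - 1) = Int.fract x - 1 by linarith, unitBump_add_unitBump h h'] at hs
  exact hs

lemma integral_unitBump_mul {φ : ℝ → ℝ} (hφ : Continuous φ) (hper : ∀ x, φ (x - 1) = φ x)
    (h0 : ∫ x in (0:ℝ)..1, φ x = 0) : ∫ x, unitBump x * φ x = 0 := by
  have hc : Continuous fun x => unitBump x * φ x := contDiff_unitBump.continuous.mul hφ
  have h1 : ∫ x, unitBump x * φ x = ∫ x in (-1:ℝ)..1, unitBump x * φ x := by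
    rw [intervalIntegral.integral_of_le (by norm_num), ← integral_indicator measurableSet_Ioc]
    congr 1
    ext x
    by_cases hx : x ∈ Ioc (-1:ℝ) 1
    · rw [indicator_of_mem hx]
    · rw [indicator_of_notMem hx, unitBump_eq_zero, zero_mul]
      rw [mem_Ioc, not_and_or, not_lt, not_le] at hx
      exact le_abs.2 (hx.elim (fun h => Or.inr (by linarith)) fun h => Or.inl h.le)
  have h2 : ∫ x in (-1:ℝ)..0, unitBump x * φ x = ∫ x in (0:ℝ)..1, unitBump (x - 1) * φ x := by
    have := intervalIntegral.integral_comp_sub_right (a := 0) (b := 1)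
      (fun x => unitBump x * φ x) 1
    simp only [hper] at this
    rw [this]; norm_num
  have h3 : IntervalIntegrable (fun x => unitBump (x - 1) * φ x) volume 0 1 :=
    ((contDiff_unitBump.continuous.comp (continuous_sub_right 1)).mul hφ).intervalIntegrable _ _
  rw [h1, ← intervalIntegral.integral_add_adjacent_intervals (hc.intervalIntegrable (-1) 0)
    (hc.intervalIntegrable 0 1), h2, ← intervalIntegral.integral_add h3
    (hc.intervalIntegrable 0 1)]
  refine (intervalIntegral.integral_congr fun x hx => ?_).trans h0
  rw [uIcc_of_le zero_le_one] at hx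
  have := unitBump_add_unitBump hx.1 hx.2
  linear_combination φ x * this

/-- Real part of the modulated bump. -/
noncomputable def cosBump (μ : ℤ) (x : ℝ) : ℝ := unitBump x * Real.cos (2 * π * μ * x)

/-- Imaginary part of the modulated bump. -/
noncomputable def sinBump (μ : ℤ) (x : ℝ) : ℝ := unitBump x * Real.sin (2 * π * μ * x)

lemma isBump_cosBump (μ : ℤ) : IsBump (cosBump μ) :=
  ⟨contDiff_unitBump.mul (Real.contDiff_cos.comp (contDiff_const.mul contDiff_id)),
    fun x hx => by rw [cosBump, unitBump_eq_zero hx, zero_mul]⟩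

lemma isBump_sinBump (μ : ℤ) : IsBump (sinBump μ) :=
  ⟨contDiff_unitBump.mul (Real.contDiff_sin.comp (contDiff_const.mul contDiff_id)),
    fun x hx => by rw [sinBump, unitBump_eq_zero hx, zero_mul]⟩

lemma integral_cosBump {μ : ℤ} (hμ : μ ≠ 0) : ∫ x, cosBump μ x = 0 := by
  have hμ' : (2 * π * μ : ℝ) ≠ 0 := by
    have : (μ : ℝ) ≠ 0 := by exact_mod_cast hμ
    positivity
  refine integral_unitBump_mul (by fun_prop) (fun x => ?_) ?_
  · rw [show 2 * π * μ * (x - 1) = 2 * π * μ * x - μ * (2 * π) by ring, Real.cos_sub_int_mul_two_pi]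
  · rw [intervalIntegral.integral_comp_mul_left (fun x => Real.cos x) hμ', integral_cos]
    rw [show 2 * π * μ * 1 = ((2 * μ : ℤ) : ℝ) * π by push_cast; ring, Real.sin_int_mul_pi]
    simp

lemma integral_sinBump {μ : ℤ} (hμ : μ ≠ 0) : ∫ x, sinBump μ x = 0 := by
  have hμ' : (2 * π * μ : ℝ) ≠ 0 := by
    have : (μ : ℝ) ≠ 0 := by exact_mod_cast hμ
    positivity
  refine integral_unitBump_mul (by fun_prop) (fun x => ?_) ?_
  · rw [show 2 * π * μ * (x - 1) = 2 * π * μ * x - μ * (2 * π) by ring, Real.sin_sub_int_mul_two_pi]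
  · rw [intervalIntegral.integral_comp_mul_left (fun x => Real.sin x) hμ', integral_sin]
    rw [show 2 * π * μ * 1 = μ * (2 * π) by ring, Real.cos_int_mul_two_pi]
    simp

/-! ### Pairings of orbit sums -/

lemma IsTest.exists_finset_pairing {E F : Type*} [NormedAddCommGroup E] [NormedAddCommGroup F]
    {k : ℂ → E} {l : ℂ → F} (hk : IsTest k) (hl : IsTest l) :
    ∃ S : Finset SL(2, ℤ), ∀ γ ∉ S, ∀ z : ℍ, k z = 0 ∨ l (γ • z : ℍ) = 0 := by
  have hf := finite_setOf_smul_inter (isCompact_preimage_coe hk.cpt hk.pos)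
    (isCompact_preimage_coe hl.cpt hl.pos)
  refine ⟨hf.toFinset, fun γ hγ z => ?_⟩
  by_contra! h
  rw [Finite.mem_toFinset] at hγ
  exact hγ ⟨z, subset_tsupport _ h.1, subset_tsupport _ h.2⟩

lemma IsTest.hasSum_pairing {k l : ℂ → ℝ} (hk : IsTest k) (hl : IsTest l) :
    HasSum (fun γ : SL(2, ℤ) => ∫ z : ℍ, k z * l (γ • z : ℍ)) (∫ z : ℍ, k z * autom l z) := by
  obtain ⟨S, hS⟩ := hk.exists_finset_pairing hl
  have hS' : ∀ γ ∉ S, ∀ z : ℍ, k z * l (γ • z : ℍ) = 0 := fun γ hγ z => by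
    rcases hS γ hγ z with h | h <;> rw [h] <;> ring
  have h1 : ∀ z : ℍ, k z * autom l z = ∑ γ ∈ S, k z * l (γ • z : ℍ) := fun z => by
    rw [autom, ← tsum_mul_left, tsum_eq_sum fun γ hγ => hS' γ hγ z]
  simp_rw [h1]
  have hi : ∀ γ ∈ S, Integrable (fun z : ℍ => k z * l (γ • z : ℍ)) := fun γ _ =>
    hk.integrable_mul (hl.cont.comp (continuous_coe.comp (continuous_smul_modular γ)))
  rw [integral_finsetSum _ hi]
  refine hasSum_sum_of_ne_finset_zero fun γ hγ => ?_
  simp_rw [hS' γ hγ]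
  simp

lemma exists_pairing_growth {α β f g : ℝ → ℝ} (hα : IsBump α) (hα0 : ∫ x, α x = 0)
    (hβ : IsBump β) (hβ0 : ∫ x, β x = 0) (hf : IsProf 4 f) (hg : IsProf 4 g) :
    ∃ C, 0 ≤ C ∧ ∀ s, 0 ≤ s → |∑' γ : SL(2, ℤ), ∫ z : ℍ, profKernel α cutoff f s z *
      profKernel β cutoff g s (γ • z : ℍ)| ≤ C * (1 + s) ^ 2 := by
  obtain ⟨M, hM0, hM⟩ := exists_automL2_growth hα hα0 hf
  obtain ⟨N, hN0, hN⟩ := exists_automL2_growth hβ hβ0 hg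
  refine ⟨M * N, by positivity, fun s hs => ?_⟩
  have T1 := isTest_profKernel s hα isCut_cutoff hf
  have T2 := isTest_profKernel s hβ isCut_cutoff hg
  have h1 := inner_automL2 T1 T2
  rw [T1.integral_autom_mul T2.continuous_autom fun γ z => autom_smul _ γ z] at h1
  rw [(T1.hasSum_pairing T2).tsum_eq]
  have h2 := abs_real_inner_le_norm (automL2 (profKernel α cutoff f s))
    (automL2 (profKernel β cutoff g s))
  rw [h1, abs_mul, abs_two] at h2
  have h3 := mul_le_mul (hM s hs) (hN s hs) (norm_nonneg _) (by positivity)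
  nlinarith [abs_nonneg (∫ z : ℍ, profKernel α cutoff f s z * autom (profKernel β cutoff g s) z)]

/-- The modulated test function. -/
noncomputable def wave (μ : ℤ) (g : ℝ → ℝ) (s : ℝ) (z : ℂ) : ℂ :=
  (profKernel (cosBump μ) cutoff g s z : ℂ) +
    Complex.I * (profKernel (sinBump μ) cutoff g s z : ℂ)

/-- The vertical profile of the test functions. -/
noncomputable def weight (g : ℝ → ℝ) (s y : ℝ) : ℝ :=
  cutoff y * (Real.exp (-s / 2) * g (Real.exp (-s) / y))

lemma wave_of_pos (μ : ℤ) (g : ℝ → ℝ) (s : ℝ) {z : ℂ} (hz : 0 < z.im) : wave μ g s z =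
    unitBump z.re * Complex.exp (2 * π * Complex.I * (μ * z.re)) * weight g s z.im := by
  have : (2 * π * Complex.I * (μ * z.re) : ℂ) = ((2 * π * μ * z.re : ℝ) : ℂ) * Complex.I := by
    push_cast; ring
  rw [this, Complex.exp_mul_I, wave, profKernel_of_pos s hz, profKernel_of_pos s hz, cosBump,
    sinBump, weight]
  push_cast
  ring

lemma isTest_wave (μ : ℤ) {g : ℝ → ℝ} {n : ℕ} (hg : IsProf n g) (s : ℝ) :
    IsTest (wave μ g s) := by
  have T1 := isTest_profKernel s (isBump_cosBump μ) isCut_cutoff hg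
  have T2 := isTest_profKernel s (isBump_sinBump μ) isCut_cutoff hg
  have hzero : ∀ z, z ∉ tsupport (profKernel (cosBump μ) cutoff g s) ∪
      tsupport (profKernel (sinBump μ) cutoff g s) → wave μ g s z = 0 := by
    intro z hz
    rw [mem_union, not_or] at hz
    rw [wave, image_eq_zero_of_notMem_tsupport hz.1, image_eq_zero_of_notMem_tsupport hz.2]
    simp
  refine ⟨?_, HasCompactSupport.intro (T1.cpt.union T2.cpt) hzero, ?_⟩
  · exact (Complex.continuous_ofReal.comp T1.cont).add
      (continuous_const.mul (Complex.continuous_ofReal.comp T2.cont))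
  · refine (closure_minimal (fun z hz => ?_) (T1.cpt.union T2.cpt).isClosed).trans
      (union_subset T1.pos T2.pos)
    by_contra h
    exact hz (hzero z h)

lemma integral_combination {a b c d : ℍ → ℝ} (ha : Integrable a) (hb : Integrable b)
    (hc : Integrable c) (hd : Integrable d) :
    ∫ z, (((a z : ℂ) - (b z : ℂ)) + Complex.I * ((c z : ℂ) + (d z : ℂ))) =
      ((∫ z, a z : ℝ) : ℂ) - ((∫ z, b z : ℝ) : ℂ) +
        Complex.I * (((∫ z, c z : ℝ) : ℂ) + ((∫ z, d z : ℝ) : ℂ)) := by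
  have ha' : Integrable fun z => (a z : ℂ) := ha.ofReal
  have hb' : Integrable fun z => (b z : ℂ) := hb.ofReal
  have hc' : Integrable fun z => (c z : ℂ) := hc.ofReal
  have hd' : Integrable fun z => (d z : ℂ) := hd.ofReal
  have h1 : Integrable fun z => (a z : ℂ) - (b z : ℂ) := ha'.sub hb'
  have h2 : Integrable fun z => Complex.I * ((c z : ℂ) + (d z : ℂ)) := (hc'.add hd').const_mul _
  rw [integral_add h1 h2, integral_sub ha' hb', integral_const_mul, integral_add hc' hd']
  simp only [integral_complex_ofReal]

lemma integral_wave_mul {f g : ℝ → ℝ} {n : ℕ} (hf : IsProf n f) (hg : IsProf n g) (μ ν : ℤ)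
    (s : ℝ) (γ : SL(2, ℤ)) : ∫ z : ℍ, wave μ f s z * wave ν g s (γ • z : ℍ) =
      ((∫ z : ℍ, profKernel (cosBump μ) cutoff f s z *
        profKernel (cosBump ν) cutoff g s (γ • z : ℍ) : ℝ) : ℂ) -
      ((∫ z : ℍ, profKernel (sinBump μ) cutoff f s z *
        profKernel (sinBump ν) cutoff g s (γ • z : ℍ) : ℝ) : ℂ) + Complex.I *
      (((∫ z : ℍ, profKernel (cosBump μ) cutoff f s z *
        profKernel (sinBump ν) cutoff g s (γ • z : ℍ) : ℝ) : ℂ) +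
      ((∫ z : ℍ, profKernel (sinBump μ) cutoff f s z *
        profKernel (cosBump ν) cutoff g s (γ • z : ℍ) : ℝ) : ℂ)) := by
  have I : ∀ {α β : ℝ → ℝ}, IsBump α → IsBump β → Integrable (fun z : ℍ =>
      profKernel α cutoff f s z * profKernel β cutoff g s (γ • z : ℍ)) :=
    fun hα hβ => (isTest_profKernel s hα isCut_cutoff hf).integrable_mul
      ((isTest_profKernel s hβ isCut_cutoff hg).cont.comp
        (continuous_coe.comp (continuous_smul_modular γ)))
  have C1 := isBump_cosBump μ
  have C2 := isBump_cosBump ν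
  have S1 := isBump_sinBump μ
  have S2 := isBump_sinBump ν
  rw [← integral_combination (I C1 C2) (I S1 S2) (I C1 S2) (I S1 C2)]
  refine integral_congr_ae (Eventually.of_forall fun z => ?_)
  simp only [wave, Complex.ofReal_mul]
  linear_combination (profKernel (sinBump μ) cutoff f s z *
    profKernel (sinBump ν) cutoff g s (γ • z : ℍ) : ℂ) * Complex.I_sq

theorem exists_wave_pairing_growth {f g : ℝ → ℝ} (hf : IsProf 4 f) (hg : IsProf 4 g) {μ ν : ℤ}
    (hμ : μ ≠ 0) (hν : ν ≠ 0) : ∃ C, 0 ≤ C ∧ ∀ s, 0 ≤ s →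
      ‖∑' γ : SL(2, ℤ), ∫ z : ℍ, wave μ f s z * wave ν g s (γ • z : ℍ)‖ ≤ C * (1 + s) ^ 2 := by
  have C1 := isBump_cosBump μ
  have C2 := isBump_cosBump ν
  have S1 := isBump_sinBump μ
  have S2 := isBump_sinBump ν
  obtain ⟨A, hA, hA'⟩ := exists_pairing_growth C1 (integral_cosBump hμ) C2 (integral_cosBump hν) hf hg
  obtain ⟨B, hB, hB'⟩ := exists_pairing_growth S1 (integral_sinBump hμ) S2 (integral_sinBump hν) hf hg
  obtain ⟨C, hC, hC'⟩ := exists_pairing_growth C1 (integral_cosBump hμ) S2 (integral_sinBump hν) hf hg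
  obtain ⟨D, hD, hD'⟩ := exists_pairing_growth S1 (integral_sinBump hμ) C2 (integral_cosBump hν) hf hg
  refine ⟨A + B + (C + D), by positivity, fun s hs => ?_⟩
  have H : ∀ {α β : ℝ → ℝ}, IsBump α → IsBump β → Summable (fun γ : SL(2, ℤ) =>
      ((∫ z : ℍ, profKernel α cutoff f s z * profKernel β cutoff g s (γ • z : ℍ) : ℝ) : ℂ)) :=
    fun hα hβ => Complex.ofRealCLM.summable ((isTest_profKernel s hα isCut_cutoff hf).hasSum_pairing
      (isTest_profKernel s hβ isCut_cutoff hg)).summable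
  simp_rw [integral_wave_mul hf hg]
  rw [((H C1 C2).sub (H S1 S2)).tsum_add (((H C1 S2).add (H S1 C2)).mul_left _),
    (H C1 C2).tsum_sub (H S1 S2), tsum_mul_left, (H C1 S2).tsum_add (H S1 C2)]
  simp_rw [← Complex.ofReal_tsum]
  refine (norm_add_le _ _).trans ?_
  rw [norm_mul, Complex.norm_I, one_mul]
  refine (add_le_add (norm_sub_le _ _) (norm_add_le _ _)).trans ?_
  simp only [Complex.norm_real, Real.norm_eq_abs]
  have := hA' s hs
  have := hB' s hs
  have := hC' s hs
  have := hD' s hs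
  linarith

/-! ### Coordinates on the orbit -/

lemma coe_smul_eq (γ : SL(2, ℤ)) (hc : γ 1 0 ≠ 0) (z : ℍ) : ((γ • z : ℍ) : ℂ) =
    (γ 0 0 : ℂ) / (γ 1 0 : ℂ) -
      1 / ((γ 1 0 : ℂ) ^ 2 * ((z : ℂ) + (γ 1 1 : ℂ) / (γ 1 0 : ℂ))) := by
  have hdet : (γ 0 0 : ℂ) * γ 1 1 - γ 0 1 * γ 1 0 = 1 := by
    have := γ.det_coe
    rw [Matrix.det_fin_two] at this
    exact_mod_cast this
  have hc' : (γ 1 0 : ℂ) ≠ 0 := by exact_mod_cast hc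
  have hz : (z : ℂ) + (γ 1 1 : ℂ) / (γ 1 0 : ℂ) ≠ 0 := by
    intro h
    have h1 := congrArg Complex.im h
    have h2 : ((γ 1 1 : ℂ) / (γ 1 0 : ℂ)).im = 0 := by
      have : (γ 1 1 : ℂ) / (γ 1 0 : ℂ) = ((γ 1 1 / γ 1 0 : ℝ) : ℂ) := by push_cast; rfl
      rw [this, Complex.ofReal_im]
    rw [Complex.add_im, h2, add_zero] at h1
    exact z.im_pos.ne' h1
  have hz' : (γ 1 0 : ℂ) * z + γ 1 1 ≠ 0 := by
    intro h
    apply hz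
    field_simp
    linear_combination h
  rw [coe_specialLinearGroup_apply]
  simp only [algebraMap_int_eq, eq_intCast, Complex.ofReal_intCast]
  have e : (z : ℂ) + (γ 1 1 : ℂ) / (γ 1 0 : ℂ) = ((γ 1 0 : ℂ) * z + γ 1 1) / γ 1 0 := by
    field_simp
  have e0 : (γ 0 0 : ℂ) * z + γ 0 1 = γ 0 0 / γ 1 0 * (γ 1 0 * z + γ 1 1) - 1 / γ 1 0 := by
    field_simp
    linear_combination (-1 : ℂ) * hdet
  rw [e, e0]
  generalize (γ 1 0 : ℂ) * z + γ 1 1 = D at hz'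
  field_simp

/-- Real part of `1 / (c² z)`. -/
noncomputable def invRe (c : ℕ) (z : ℂ) : ℝ := z.re / (c ^ 2 * (z.re ^ 2 + z.im ^ 2))

/-- Imaginary part of `-1 / (c² z)`. -/
noncomputable def invIm (c : ℕ) (z : ℂ) : ℝ := z.im / (c ^ 2 * (z.re ^ 2 + z.im ^ 2))

lemma inv_eq (c : ℕ) (z : ℂ) : 1 / ((c : ℂ) ^ 2 * z) = ⟨invRe c z, -invIm c z⟩ := by
  have e : 1 / ((c : ℂ) ^ 2 * z) = (((c : ℝ) ^ 2)⁻¹ : ℝ) * z⁻¹ := by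
    push_cast
    rw [one_div, mul_inv]
  rw [e]
  apply Complex.ext
  · rw [Complex.re_ofReal_mul, Complex.inv_re, Complex.normSq_apply, invRe]
    rw [div_eq_mul_inv, div_eq_mul_inv, mul_inv]
    ring
  · rw [Complex.im_ofReal_mul, Complex.inv_im, Complex.normSq_apply, invIm]
    rw [div_eq_mul_inv, div_eq_mul_inv, mul_inv]
    ring

lemma smul_eq_mk (γ : SL(2, ℤ)) {c : ℕ} (hc : 0 < c) {d₀ a₀ k l : ℤ} (h10 : γ 1 0 = c)
    (h11 : γ 1 1 = d₀ + c * l) (h00 : γ 0 0 = a₀ + c * k) (z : ℍ) : ((γ • z : ℍ) : ℂ) =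
    ⟨(a₀ : ℝ) / c + k - invRe c (z + ((d₀ / c + l : ℝ) : ℂ)),
      invIm c (z + ((d₀ / c + l : ℝ) : ℂ))⟩ := by
  have hc' : (c : ℂ) ≠ 0 := by exact_mod_cast hc.ne'
  have e1 : ((γ 1 1 : ℤ) : ℂ) / ((γ 1 0 : ℤ) : ℂ) = ((d₀ / c + l : ℝ) : ℂ) := by
    rw [h10, h11]; push_cast; field_simp
  have e2 : ((γ 0 0 : ℤ) : ℂ) / ((γ 1 0 : ℤ) : ℂ) = ((a₀ / c + k : ℝ) : ℂ) := by
    rw [h10, h00]; push_cast; field_simp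
  rw [coe_smul_eq γ (by rw [h10]; exact_mod_cast hc.ne'), e1, e2, h10, Int.cast_natCast, inv_eq]
  apply Complex.ext
  · rw [Complex.sub_re, Complex.ofReal_re]
  · rw [Complex.sub_im, Complex.ofReal_im, zero_sub, neg_neg]

/-- The kernel obtained after unfolding both orbit sums at the modulus `c`. -/
noncomputable def kern (μ ν : ℤ) (f g : ℝ → ℝ) (s : ℝ) (c : ℕ) (z : ℂ) : ℂ :=
  if 0 < z.im then ((z.im ^ 2)⁻¹ * (weight f s z.im * weight g s (invIm c z)) : ℝ) *
    Complex.exp (2 * π * Complex.I * (μ * z.re - ν * invRe c z)) else 0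

/-- One translate of the kernel, localised by the partition of unity. -/
noncomputable def kernPiece (μ ν : ℤ) (f g : ℝ → ℝ) (s : ℝ) (c : ℕ) (a₀ d₀ k l : ℤ) (z : ℂ) : ℂ :=
  (unitBump (z.re - d₀ / c - l) * unitBump (a₀ / c - invRe c z + k) : ℝ) * kern μ ν f g s c z

/-- The phase attached to a pair of residues. -/
noncomputable def phase (μ ν : ℤ) (c : ℕ) (a₀ d₀ : ℤ) : ℂ :=
  Complex.exp (2 * π * Complex.I * (((-μ * d₀ + ν * a₀ : ℤ) : ℂ) / (c : ℂ)))

lemma exp_two_pi_I_int_mul (n : ℤ) : Complex.exp (2 * π * Complex.I * n) = 1 := by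
  rw [mul_comm]; exact Complex.exp_int_mul_two_pi_mul_I n

lemma wave_mul_wave_smul (μ ν : ℤ) (f g : ℝ → ℝ) (s : ℝ) (γ : SL(2, ℤ)) {c : ℕ} (hc : 0 < c)
    {d₀ a₀ k l : ℤ} (h10 : γ 1 0 = c) (h11 : γ 1 1 = d₀ + c * l) (h00 : γ 0 0 = a₀ + c * k)
    (z : ℍ) : (z.im ^ 2)⁻¹ • (wave μ f s z * wave ν g s (γ • z : ℍ)) = phase μ ν c a₀ d₀ *
      kernPiece μ ν f g s c a₀ d₀ k l (z + ((d₀ / c + l : ℝ) : ℂ)) := by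
  have hc' : (c : ℂ) ≠ 0 := by exact_mod_cast hc.ne'
  set r : ℝ := d₀ / c + l with hr
  set w : ℂ := z + (r : ℂ) with hw
  have hre : w.re = (z : ℂ).re + r := by simp [hw]
  have him : w.im = (z : ℂ).im := by simp [hw]
  have hzp : 0 < (z : ℂ).im := z.im_pos
  have hwp : 0 < w.im := by rw [him]; exact hzp
  have hγ : 0 < ((γ • z : ℍ) : ℂ).im := (γ • z).im_pos
  rw [wave_of_pos μ f s hzp, wave_of_pos ν g s hγ, kernPiece, kern, if_pos hwp,
    smul_eq_mk γ hc h10 h11 h00 z, phase]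
  dsimp only
  rw [← hr, ← hw, him, show (z : ℂ).re = w.re - r by rw [hre]; ring, Complex.real_smul]
  have e1 : w.re - r = w.re - d₀ / c - l := by rw [hr]; ring
  have e2 : (a₀ : ℝ) / c + k - invRe c w = a₀ / c - invRe c w + k := by ring
  have e3 : Complex.exp (2 * π * Complex.I * (μ * ((w.re - r : ℝ) : ℂ))) *
      Complex.exp (2 * π * Complex.I * (ν * (((a₀ : ℝ) / c + k - invRe c w : ℝ) : ℂ))) =
      Complex.exp (2 * π * Complex.I * (((-μ * d₀ + ν * a₀ : ℤ) : ℂ) / (c : ℂ))) *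
      Complex.exp (2 * π * Complex.I * (μ * w.re - ν * invRe c w)) := by
    rw [← Complex.exp_add, ← Complex.exp_add,
      ← mul_one (Complex.exp (_ + 2 * π * Complex.I * (μ * w.re - ν * invRe c w))),
      ← exp_two_pi_I_int_mul (ν * k - μ * l), ← Complex.exp_add]
    congr 1
    rw [hr]
    push_cast
    field_simp
    ring
  rw [← coe_im, Complex.ofReal_mul, ← e1, ← e2, Complex.ofReal_mul, Complex.ofReal_mul]
  linear_combination ((((z : ℂ).im ^ 2)⁻¹ : ℝ) : ℂ) * (unitBump (w.re - r) : ℂ) *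
    (unitBump ((a₀ : ℝ) / c + k - invRe c w) : ℂ) * (weight f s (z : ℂ).im : ℂ) *
    (weight g s (invIm c w) : ℂ) * e3

/-! ### Enumeration of the modular group by lower-left entry -/

/-- Reduced residues modulo `c`. -/
abbrev Residue (c : ℕ) : Type := {d : ℕ // d ∈ (Finset.range c).filter (fun d => Nat.gcd d c = 1)}

/-- The least nonnegative inverse of a residue. -/
def invResidue (c d : ℕ) : ℤ := (((d : ZMod c)⁻¹ : ZMod c)).val

lemma dvd_invResidue_mul_sub_one {c : ℕ} (hc : 0 < c) (d : Residue c) :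
    (c : ℤ) ∣ invResidue c d * d - 1 := by
  have : NeZero c := ⟨hc.ne'⟩
  rw [← ZMod.intCast_zmod_eq_zero_iff_dvd]
  have h := ZMod.coe_mul_inv_eq_one (n := c) (d : ℕ) (Finset.mem_filter.1 d.2).2
  rw [invResidue]
  push_cast
  rw [ZMod.natCast_zmod_val, mul_comm, h, sub_self]

/-- Indices `(c, d₀, (k, l))` of the matrices with positive lower-left entry. -/
abbrev CellIndex : Type := Σ c : ℕ+, Residue c × (ℤ × ℤ)

/-- The matrix with lower-left entry `c` and diagonal `(a₀ + c k, d₀ + c l)`. -/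
def cellMatrix (c : ℕ+) (d : Residue c) (k l : ℤ) : SL(2, ℤ) :=
  ⟨!![invResidue c d + c * k, ((invResidue c d + c * k) * (d + c * l) - 1) / c;
      (c : ℤ), (d : ℤ) + c * l], by
    have h : (c : ℤ) ∣ (invResidue c d + c * k) * (d + c * l) - 1 := by
      obtain ⟨q, hq⟩ := dvd_invResidue_mul_sub_one c.pos d
      exact ⟨q + k * (d + c * l) + invResidue c d * l, by linear_combination hq⟩
    rw [Matrix.det_fin_two_of, Int.ediv_mul_cancel h]
    ring⟩

lemma cellMatrix_injective :
    Function.Injective (fun i : CellIndex => cellMatrix i.1 i.2.1 i.2.2.1 i.2.2.2) := by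
  rintro ⟨c, d, k, l⟩ ⟨c', d', k', l'⟩ h
  have hij : ∀ i j, (cellMatrix c d k l) i j = (cellMatrix c' d' k' l') i j :=
    fun i j => by
      have h : cellMatrix c d k l = cellMatrix c' d' k' l' := h
      rw [h]
  have h10 : ((c : ℕ) : ℤ) = (c' : ℕ) := hij 1 0
  have hcc : c = c' := by
    apply PNat.coe_injective
    exact_mod_cast h10
  subst hcc
  have h11 : (d : ℤ) + (c : ℕ) * l = d' + (c : ℕ) * l' := hij 1 1
  have h00 : invResidue c d + (c : ℕ) * k = invResidue c d' + (c : ℕ) * k' := hij 0 0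
  have hd : (d : ℕ) < c := Finset.mem_range.1 (Finset.mem_filter.1 d.2).1
  have hd' : (d' : ℕ) < c := Finset.mem_range.1 (Finset.mem_filter.1 d'.2).1
  have hc : (0 : ℤ) < (c : ℕ) := by exact_mod_cast c.pos
  have e1 : (d : ℤ) = d' := by
    have h1 : ((d : ℤ) + (c : ℕ) * l) % (c : ℕ) = d := by
      rw [Int.add_mul_emod_self_left, Int.emod_eq_of_lt (by positivity) (by exact_mod_cast hd)]
    have h2 : ((d' : ℤ) + (c : ℕ) * l') % (c : ℕ) = d' := by
      rw [Int.add_mul_emod_self_left, Int.emod_eq_of_lt (by positivity) (by exact_mod_cast hd')]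
    rw [← h1, h11, h2]
  have e2 : d = d' := Subtype.ext (by exact_mod_cast e1)
  subst e2
  have e3 : l = l' := by
    have := add_left_cancel h11
    exact mul_left_cancel₀ hc.ne' this
  have e4 : k = k' := by
    have := add_left_cancel h00
    exact mul_left_cancel₀ hc.ne' this
  rw [e3, e4]

lemma exists_cellMatrix_eq {γ : SL(2, ℤ)} (hγ : 0 < γ 1 0) :
    ∃ i : CellIndex, cellMatrix i.1 i.2.1 i.2.2.1 i.2.2.2 = γ := by
  have hdet : γ 0 0 * γ 1 1 - γ 0 1 * γ 1 0 = 1 := by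
    have := γ.det_coe
    rwa [Matrix.det_fin_two] at this
  obtain ⟨c, hc⟩ := Int.eq_ofNat_of_zero_le hγ.le
  have hc0 : 0 < c := by rw [hc] at hγ; exact_mod_cast hγ
  have hcz : (c : ℤ) ≠ 0 := by exact_mod_cast hc0.ne'
  obtain ⟨d, hd⟩ := Int.eq_ofNat_of_zero_le (Int.emod_nonneg (γ 1 1) hcz)
  have hdl : γ 1 1 = d + c * (γ 1 1 / c) := by rw [← hd]; exact (Int.emod_add_mul_ediv _ _).symm
  have hdc : d < c := by
    have := Int.emod_lt_of_pos (γ 1 1) (b := (c : ℤ)) (by exact_mod_cast hc0)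
    rw [hd] at this; exact_mod_cast this
  have hcop : Nat.gcd d c = 1 := by
    have h1 : IsCoprime (d : ℤ) c :=
      ⟨γ 0 0, γ 0 0 * (γ 1 1 / c) - γ 0 1, by
        rw [hc] at hdet
        linear_combination hdet - γ 0 0 * hdl⟩
    exact Nat.isCoprime_iff_coprime.1 h1
  let dd : Residue c := ⟨d, Finset.mem_filter.2 ⟨Finset.mem_range.2 hdc, hcop⟩⟩
  obtain ⟨q, hq⟩ := dvd_invResidue_mul_sub_one hc0 dd
  have hdd : ((dd : ℕ) : ℤ) = d := rfl
  set a₀ := invResidue c dd with ha₀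
  have hk : (c : ℤ) ∣ γ 0 0 - a₀ := by
    have h1 : (c : ℤ) ∣ (d : ℤ) * (γ 0 0 - a₀) :=
      ⟨γ 0 1 - q - γ 0 0 * (γ 1 1 / c), by
        rw [hc] at hdet
        rw [hdd] at hq
        linear_combination hdet - hq - γ 0 0 * hdl⟩
    exact (Nat.isCoprime_iff_coprime.2 hcop).symm.dvd_of_dvd_mul_left h1
  obtain ⟨k, hk⟩ := hk
  refine ⟨⟨⟨c, hc0⟩, dd, k, γ 1 1 / c⟩, ?_⟩
  have e00 : a₀ + c * k = γ 0 0 := by rw [← hk]; ring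
  ext i j
  fin_cases i <;> fin_cases j
  · exact e00
  · change ((a₀ + c * k) * (d + c * (γ 1 1 / c)) - 1) / c = γ 0 1
    rw [e00, ← hdl]
    apply Int.ediv_eq_of_eq_mul_left hcz
    rw [← hc]
    linear_combination hdet
  · exact hc.symm
  · exact hdl.symm

lemma tsum_modular_eq {I : SL(2, ℤ) → ℂ} (hI : Summable I) (hneg : ∀ γ, I (-γ) = I γ)
    (h0 : ∀ γ, γ 1 0 = 0 → I γ = 0) : ∑' γ, I γ =
      2 * ∑' c : ℕ+, ∑ d : Residue c, ∑' p : ℤ × ℤ, I (cellMatrix c d p.1 p.2) := by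
  set J : SL(2, ℤ) → ℂ := {γ : SL(2, ℤ) | 0 < γ 1 0}.indicator I with hJ
  have hJs : Summable J := hI.indicator _
  have hn10 : ∀ γ : SL(2, ℤ), (-γ) 1 0 = -(γ 1 0) := fun γ => by simp
  have e : ∀ γ, I γ = J γ + J (-γ) := by
    intro γ
    have := hn10 γ
    rcases lt_trichotomy (γ 1 0) 0 with h | h | h
    · rw [hJ, indicator_of_notMem (by simp only [mem_ofPred_eq]; omega),
        indicator_of_mem (by simp only [mem_ofPred_eq]; omega), zero_add, hneg]
    · rw [h0 γ h, hJ, indicator_of_notMem (by simp only [mem_ofPred_eq]; omega),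
        indicator_of_notMem (by simp only [mem_ofPred_eq]; omega), zero_add]
    · rw [hJ, indicator_of_mem (by simp only [mem_ofPred_eq]; omega),
        indicator_of_notMem (by simp only [mem_ofPred_eq]; omega), add_zero]
  have hJn : ∑' γ, J (-γ) = ∑' γ, J γ := (Equiv.neg SL(2, ℤ)).tsum_eq J
  have hJns : Summable fun γ => J (-γ) := (Equiv.neg SL(2, ℤ)).summable_iff.2 hJs
  have hpos : ∀ (c : ℕ+) (d : Residue c) (k l : ℤ), J (cellMatrix c d k l) =
      I (cellMatrix c d k l) := fun c d k l =>
    indicator_of_mem (s := {γ : SL(2, ℤ) | 0 < γ 1 0})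
      (show 0 < ((c : ℕ) : ℤ) by exact_mod_cast c.pos) _
  have hc : ∑' i : CellIndex, J (cellMatrix i.1 i.2.1 i.2.2.1 i.2.2.2) = ∑' γ, J γ :=
    cellMatrix_injective.tsum_eq fun γ hγ => by
      have : 0 < γ 1 0 := by
        by_contra h
        exact hγ (indicator_of_notMem (s := {γ : SL(2, ℤ) | 0 < γ 1 0}) h _)
      exact exists_cellMatrix_eq this
  have hs : Summable fun i : CellIndex => J (cellMatrix i.1 i.2.1 i.2.2.1 i.2.2.2) :=
    hJs.comp_injective cellMatrix_injective
  rw [tsum_congr e, hJs.tsum_add hJns, hJn, ← two_mul, ← hc, hs.tsum_sigma]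
  congr 1
  refine tsum_congr fun c => ?_
  rw [(hs.sigma_factor c).tsum_prod, tsum_fintype]
  simp_rw [hpos]

/-! ### Unfolding the pairing into Kloosterman sums -/

lemma phase_ne_zero (μ ν : ℤ) (c : ℕ) (a₀ d₀ : ℤ) : phase μ ν c a₀ d₀ ≠ 0 :=
  Complex.exp_ne_zero _

lemma kernPiece_of_not_pos (μ ν : ℤ) (f g : ℝ → ℝ) (s : ℝ) (c : ℕ) (a₀ d₀ k l : ℤ) {z : ℂ}
    (hz : ¬ 0 < z.im) : kernPiece μ ν f g s c a₀ d₀ k l z = 0 := by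
  rw [kernPiece, kern, if_neg hz, mul_zero]

lemma hasSum_unitBump_sub (x : ℝ) : HasSum (fun l : ℤ => unitBump (x - l)) 1 := by
  have := (Equiv.neg ℤ).hasSum_iff.2 (hasSum_unitBump x)
  convert this using 1
  funext l
  simp [sub_eq_add_neg]

lemma hasSum_unitBump_mul (x y : ℝ) :
    HasSum (fun p : ℤ × ℤ => unitBump (x - p.2) * unitBump (y + p.1)) 1 := by
  have h1 := hasSum_unitBump y
  have h2 := hasSum_unitBump_sub x
  have h3 := HasSum.mul (f := fun k : ℤ => unitBump (y + k)) (g := fun l : ℤ => unitBump (x - l))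
    h1 h2 (summable_mul_of_summable_norm (f := fun k : ℤ => unitBump (y + k))
      (g := fun l : ℤ => unitBump (x - l)) h1.summable.norm h2.summable.norm)
  rw [mul_one] at h3
  exact h3.congr_fun fun p => mul_comm _ _

lemma hasSum_kernPiece (μ ν : ℤ) (f g : ℝ → ℝ) (s : ℝ) (c : ℕ) (a₀ d₀ : ℤ) (z : ℂ) :
    HasSum (fun p : ℤ × ℤ => kernPiece μ ν f g s c a₀ d₀ p.1 p.2 z) (kern μ ν f g s c z) := by
  have h := Complex.hasSum_ofReal.2
    (hasSum_unitBump_mul (z.re - d₀ / c) (a₀ / c - invRe c z))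
  have h4 := HasSum.mul_right (kern μ ν f g s c z) h
  rw [Complex.ofReal_one, one_mul] at h4
  exact h4

lemma integrable_wave_mul {f g : ℝ → ℝ} {m n : ℕ} (hf : IsProf m f) (hg : IsProf n g)
    (μ ν : ℤ) (s : ℝ) (γ : SL(2, ℤ)) :
    Integrable (fun z : ℍ => wave μ f s z * wave ν g s (γ • z : ℍ)) := by
  have hk := isTest_wave μ hf s
  have hl := isTest_wave ν hg s
  refine Continuous.integrable_of_hasCompactSupport ((hk.cont.comp continuous_coe).mul
    (hl.cont.comp (continuous_coe.comp (continuous_smul_modular γ)))) ?_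
  refine HasCompactSupport.intro (isCompact_preimage_coe hk.cpt hk.pos) fun z hz => ?_
  rw [image_eq_zero_of_notMem_tsupport hz, zero_mul]

lemma integral_wave_mul_eq {f g : ℝ → ℝ} {m n : ℕ} (hf : IsProf m f) (hg : IsProf n g)
    (μ ν : ℤ) (s : ℝ) (γ : SL(2, ℤ)) {c : ℕ} (hc : 0 < c)
    {d₀ a₀ k l : ℤ} (h10 : γ 1 0 = c) (h11 : γ 1 1 = d₀ + c * l) (h00 : γ 0 0 = a₀ + c * k) :
    Integrable (kernPiece μ ν f g s c a₀ d₀ k l) ∧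
      ∫ z : ℍ, wave μ f s z * wave ν g s (γ • z : ℍ) =
        phase μ ν c a₀ d₀ * ∫ z, kernPiece μ ν f g s c a₀ d₀ k l z := by
  set F : ℂ → ℂ := fun z => wave μ f s z * wave ν g s (mobius γ z) with hF
  set r : ℂ := ((d₀ / c + l : ℝ) : ℂ) with hr
  have e : ∀ z : ℍ, F z = wave μ f s z * wave ν g s (γ • z : ℍ) := fun z => by
    rw [hF]; simp only [mobius_coe]
  have hG : {z : ℂ | 0 < z.im}.indicator (fun z => (z.im ^ 2)⁻¹ • F z) =
      fun z => phase μ ν c a₀ d₀ * kernPiece μ ν f g s c a₀ d₀ k l (z + r) := by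
    funext z
    by_cases hz : 0 < z.im
    · rw [indicator_of_mem (s := {z : ℂ | 0 < z.im}) hz]
      exact (congrArg _ (e ⟨z, hz⟩)).trans
        (wave_mul_wave_smul μ ν f g s γ hc h10 h11 h00 ⟨z, hz⟩)
    · rw [indicator_of_notMem (s := {z : ℂ | 0 < z.im}) hz, kernPiece_of_not_pos, mul_zero]
      simpa [hr] using hz
  have hI : Integrable (fun z : ℍ => F z) := by
    simp_rw [e]; exact integrable_wave_mul hf hg μ ν s γ
  constructor
  · rw [integrable_uhp_iff, ← integrable_indicator_iff measurableSet_im_pos, hG] at hI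
    have h2 := (hI.const_mul (phase μ ν c a₀ d₀)⁻¹).comp_add_right (-r)
    refine h2.congr (Eventually.of_forall fun z => ?_)
    simp only [neg_add_cancel_right]
    rw [inv_mul_cancel_left₀ (phase_ne_zero _ _ _ _ _)]
  · calc _ = ∫ z : ℍ, F z := by simp_rw [e]
      _ = ∫ z, phase μ ν c a₀ d₀ * kernPiece μ ν f g s c a₀ d₀ k l (z + r) := by
        rw [integral_uhp, ← integral_indicator measurableSet_im_pos, hG]
      _ = _ := by
        rw [integral_const_mul, integral_add_right_eq_self (kernPiece μ ν f g s c a₀ d₀ k l)]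

lemma integral_kern {f g : ℝ → ℝ} {m n : ℕ} (hf : IsProf m f) (hg : IsProf n g)
    (μ ν : ℤ) (s : ℝ) (c : ℕ+) (d : Residue c) :
    Integrable (kern μ ν f g s c) ∧
      ∑' p : ℤ × ℤ, ∫ z : ℍ, wave μ f s z * wave ν g s (cellMatrix c d p.1 p.2 • z : ℍ) =
        phase μ ν c (invResidue c d) (d : ℕ) * ∫ z, kern μ ν f g s c z := by
  obtain ⟨S, hS⟩ := (isTest_wave μ hf s).exists_finset_pairing (isTest_wave ν hg s)
  have hinj : Function.Injective fun p : ℤ × ℤ => cellMatrix c d p.1 p.2 := by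
    intro p q h
    have := @cellMatrix_injective ⟨c, d, p⟩ ⟨c, d, q⟩ h
    simpa using this
  set P : Finset (ℤ × ℤ) := S.preimage (fun p : ℤ × ℤ => cellMatrix c d p.1 p.2)
    hinj.injOn with hP
  have key := fun p : ℤ × ℤ => integral_wave_mul_eq hf hg μ ν s (cellMatrix c d p.1 p.2) c.pos
    (d₀ := ((d : ℕ) : ℤ)) (a₀ := invResidue c d) (k := p.1) (l := p.2) rfl rfl rfl
  have hz : ∀ p ∉ P, ∀ z, kernPiece μ ν f g s c (invResidue c d) (d : ℕ) p.1 p.2 z = 0 := by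
    intro p hp z
    by_cases hzp : 0 < z.im
    · set r : ℝ := (((d : ℕ) : ℤ) : ℝ) / (c : ℕ) + p.2 with hr
      have hw : 0 < (z - (r : ℂ)).im := by simpa using hzp
      have h1 := wave_mul_wave_smul μ ν f g s (cellMatrix c d p.1 p.2) c.pos
        (d₀ := ((d : ℕ) : ℤ)) (a₀ := invResidue c d) (k := p.1) (l := p.2) rfl rfl rfl
        ⟨z - (r : ℂ), hw⟩
      have h2 := hS (cellMatrix c d p.1 p.2) (by simpa [hP] using hp) ⟨z - (r : ℂ), hw⟩
      have h3 : wave μ f s ((⟨z - (r : ℂ), hw⟩ : ℍ) : ℂ) *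
          wave ν g s (cellMatrix c d p.1 p.2 • (⟨z - (r : ℂ), hw⟩ : ℍ) : ℍ) = 0 := by
        rcases h2 with h | h
        · rw [h, zero_mul]
        · rw [h, mul_zero]
      rw [h3, smul_zero] at h1
      have h4 := (mul_eq_zero.1 h1.symm).resolve_left (phase_ne_zero _ _ _ _ _)
      have h5 : ((⟨z - (r : ℂ), hw⟩ : ℍ) : ℂ) + (r : ℂ) = z := sub_add_cancel z _
      rwa [← hr, h5] at h4
    · exact kernPiece_of_not_pos _ _ _ _ _ _ _ _ _ _ hzp
  have hk : kern μ ν f g s c = fun z => ∑ p ∈ P,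
      kernPiece μ ν f g s c (invResidue c d) (d : ℕ) p.1 p.2 z := by
    funext z
    exact (hasSum_kernPiece μ ν f g s c (invResidue c d) (d : ℕ) z).unique
      (hasSum_sum_of_ne_finset_zero fun p hp => hz p hp z)
  constructor
  · rw [hk]
    exact integrable_finsetSum _ fun p _ => (key p).1
  · simp_rw [fun p => (key p).2]
    rw [tsum_mul_left, tsum_eq_sum (s := P) (fun p hp => by simp_rw [hz p hp]; simp), hk,
      integral_finsetSum _ fun p _ => (key p).1]

lemma sum_phase (m n : ℤ) (c : ℕ) :
    ∑ d : Residue c, phase (-n) m c (invResidue c d) (d : ℕ) = kloostermanSum n m c := by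
  rw [kloostermanSum]
  refine Eq.trans ?_ (Finset.sum_coe_sort ((Finset.range c).filter fun d => Nat.gcd d c = 1) _)
  refine Finset.sum_congr rfl fun d _ => ?_
  rw [phase, invResidue, neg_neg]

lemma exists_kloosterman_growth {f g : ℝ → ℝ} (hf : IsProf 4 f) (hg : IsProf 4 g)
    (hdisj : ∀ u, f u = 0 ∨ g u = 0) {m n : ℤ} (hm : m ≠ 0) (hn : n ≠ 0) :
    ∃ C, 0 ≤ C ∧ ∀ s, 0 ≤ s → ‖∑' c : ℕ+, kloostermanSum n m c *
      ∫ z, kern (-n) m f g s c z‖ ≤ C * (1 + s) ^ 2 := by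
  obtain ⟨C, hC, h⟩ := exists_wave_pairing_growth hf hg (neg_ne_zero.2 hn) hm
  refine ⟨C, hC, fun s hs => ?_⟩
  specialize h s hs
  obtain ⟨S, hS⟩ := (isTest_wave (-n) hf s).exists_finset_pairing (isTest_wave m hg s)
  have hI : Summable fun γ : SL(2, ℤ) =>
      ∫ z : ℍ, wave (-n) f s z * wave m g s (γ • z : ℍ) :=
    summable_of_ne_finset_zero (s := S) fun γ hγ => by
      have : ∀ z : ℍ, wave (-n) f s z * wave m g s (γ • z : ℍ) = 0 := fun z => by
        rcases hS γ hγ z with h | h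
        · rw [h, zero_mul]
        · rw [h, mul_zero]
      simp_rw [this]; exact integral_zero _ _
  rw [tsum_modular_eq hI] at h
  · have e : ∀ c : ℕ+, ∑ d : Residue c, ∑' p : ℤ × ℤ,
        ∫ z : ℍ, wave (-n) f s z * wave m g s (cellMatrix c d p.1 p.2 • z : ℍ) =
        kloostermanSum n m c * ∫ z, kern (-n) m f g s c z := fun c => by
      simp_rw [fun d => (integral_kern hf hg (-n) m s c d).2]
      rw [← Finset.sum_mul, sum_phase]
    simp_rw [e] at h
    rw [norm_mul, Complex.norm_ofNat] at h
    linarith [norm_nonneg (∑' c : ℕ+, kloostermanSum n m c * ∫ z, kern (-n) m f g s c z)]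
  · intro γ
    refine integral_congr_ae (Eventually.of_forall fun z => ?_)
    change _ * wave m g s (-γ • z : ℍ) = _ * wave m g s (γ • z : ℍ)
    rw [ModularGroup.SL_neg_smul]
  · intro γ hγ
    have hz : ∀ z : ℍ, wave (-n) f s z * wave m g s (γ • z : ℍ) = 0 := by
      intro z
      have him : ((γ • z : ℍ) : ℂ).im = (z : ℂ).im := by
        have h1 := ModularGroup.im_smul_eq_div_normSq γ z
        have hdet : γ 0 0 * γ 1 1 - γ 0 1 * γ 1 0 = 1 := by
          have := γ.det_coe
          rwa [Matrix.det_fin_two] at this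
        rw [hγ, mul_zero, sub_zero] at hdet
        have h2 : (γ 1 1 : ℤ) ^ 2 = 1 := by
          rcases Int.eq_one_or_neg_one_of_mul_eq_one (by rw [mul_comm]; exact hdet) with h | h <;>
            rw [h] <;> norm_num
        have h3 : denom γ z = ((γ 1 1 : ℤ) : ℂ) := by
          rw [ModularGroup.denom_apply, hγ]; simp
        have h4 : Complex.normSq (denom γ z) = 1 := by
          rw [h3, ← Complex.ofReal_intCast, Complex.normSq_ofReal, ← sq]
          exact_mod_cast h2
        rw [h4, div_one] at h1
        exact h1
      have hzp : 0 < (z : ℂ).im := z.im_pos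
      rw [wave_of_pos _ _ _ hzp, wave_of_pos _ _ _ (by rw [him]; exact hzp), him, weight, weight]
      rcases hdisj (Real.exp (-s) / (z : ℂ).im) with h | h
      · rw [h]; simp
      · rw [h]; simp
    simp_rw [hz]; exact integral_zero _ _

/-! ### Evaluation of the main term -/

lemma contDiff_iteratedDeriv_of_top {Φ : ℝ → ℝ} (hΦ : ContDiff ℝ (⊤ : ℕ∞) Φ) (k : ℕ) :
    ContDiff ℝ (⊤ : ℕ∞) (iteratedDeriv k Φ) := by
  rw [iteratedDeriv_eq_iterate]
  exact ContDiff.iterate_deriv k hΦ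

lemma tsupport_iteratedDeriv_subset (Φ : ℝ → ℝ) (k : ℕ) :
    tsupport (iteratedDeriv k Φ) ⊆ tsupport Φ := by
  induction k with
  | zero => rw [iteratedDeriv_zero]
  | succ k ih =>
    rw [iteratedDeriv_succ]
    exact (closure_minimal support_deriv_subset (isClosed_tsupport _)).trans ih

lemma hasCompactSupport_iteratedDeriv {Φ : ℝ → ℝ} (hΦ : HasCompactSupport Φ) (k : ℕ) :
    HasCompactSupport (iteratedDeriv k Φ) :=
  hΦ.of_isClosed_subset (isClosed_tsupport _) (tsupport_iteratedDeriv_subset Φ k)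

/-- Taylor's formula with integral remainder for a compactly supported function. -/
lemma integral_pow_mul_iteratedDeriv {Φ : ℝ → ℝ} (hΦ : ContDiff ℝ (⊤ : ℕ∞) Φ)
    (hc : HasCompactSupport Φ) (a : ℝ) (k : ℕ) :
    ∫ x in Ioi a, (x - a) ^ k * iteratedDeriv (k + 1) Φ x =
      (-1) ^ (k + 1) * k.factorial * Φ a := by
  induction k with
  | zero =>
    simp_rw [pow_zero, one_mul, zero_add, iteratedDeriv_one]
    rw [hc.integral_Ioi_deriv_eq (hΦ.of_le (by exact_mod_cast le_top))]
    simp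
  | succ k ih =>
    have h1 := contDiff_iteratedDeriv_of_top hΦ (k + 1)
    have h2 := hasCompactSupport_iteratedDeriv hc (k + 1)
    have h3 := contDiff_iteratedDeriv_of_top hΦ (k + 2)
    have h4 := hasCompactSupport_iteratedDeriv hc (k + 2)
    set H : ℝ → ℝ := fun x => (x - a) ^ (k + 1) * iteratedDeriv (k + 1) Φ x with hH
    have hHs : ContDiff ℝ 1 H :=
      ((contDiff_id.sub contDiff_const).pow _).mul (h1.of_le (by exact_mod_cast le_top))
    have hHc : HasCompactSupport H := h2.mul_left
    have hd : deriv H = fun x => ((k + 1 : ℕ) : ℝ) * ((x - a) ^ k * iteratedDeriv (k + 1) Φ x) +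
        (x - a) ^ (k + 1) * iteratedDeriv (k + 2) Φ x := by
      funext x
      have e1 : HasDerivAt (fun x : ℝ => (x - a) ^ (k + 1)) (((k + 1 : ℕ) : ℝ) * (x - a) ^ k * 1) x :=
        ((hasDerivAt_id x).sub_const a).pow (k + 1)
      have e2 : HasDerivAt (iteratedDeriv (k + 1) Φ) (iteratedDeriv (k + 2) Φ x) x := by
        have := (h1.differentiable (by simp) x).hasDerivAt
        rwa [← iteratedDeriv_succ] at this
      refine (e1.fun_mul e2).deriv.trans ?_
      ring
    have h_int := hHc.integral_Ioi_deriv_eq hHs a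
    rw [hd] at h_int
    have i1 : IntegrableOn (fun x => ((k + 1 : ℕ) : ℝ) * ((x - a) ^ k * iteratedDeriv (k + 1) Φ x))
        (Ioi a) := by
      refine (Continuous.integrable_of_hasCompactSupport ?_ ?_).integrableOn
      · exact continuous_const.mul (((continuous_id.sub continuous_const).pow k).mul h1.continuous)
      · exact (HasCompactSupport.mul_left h2).mul_left
    have i2 : IntegrableOn (fun x => (x - a) ^ (k + 1) * iteratedDeriv (k + 2) Φ x) (Ioi a) := by
      refine (Continuous.integrable_of_hasCompactSupport ?_ ?_).integrableOn
      · exact ((continuous_id.sub continuous_const).pow (k + 1)).mul h3.continuous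
      · exact HasCompactSupport.mul_left h4
    rw [integral_add i1 i2, integral_const_mul, ih] at h_int
    have hHa : H a = 0 := by simp [hH]
    rw [hHa] at h_int
    rw [Nat.factorial_succ]
    push_cast at h_int ⊢
    linear_combination h_int

/-- The truncated power weight. -/
noncomputable def truncPow (κ u : ℝ) : ℝ := (1 - κ * u) ^ (9 / 2 : ℝ)

lemma rpow_nine_half_of_nonpos {x : ℝ} (hx : x ≤ 0) : x ^ (9 / 2 : ℝ) = 0 := by
  rcases hx.lt_or_eq with h | h
  · rw [Real.rpow_def_of_neg h, show (9 / 2 : ℝ) * π = π / 2 + (2 : ℕ) * (2 * π) by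
      push_cast; ring, Real.cos_add_nat_mul_two_pi, Real.cos_pi_div_two, mul_zero]
  · rw [h, Real.zero_rpow (by norm_num)]

lemma truncPow_eq_zero {κ u : ℝ} (h : 1 ≤ κ * u) : truncPow κ u = 0 :=
  rpow_nine_half_of_nonpos (by linarith)

lemma contDiff_rpow_of_le {p : ℝ} (hp : 4 ≤ p) : ContDiff ℝ 4 fun x : ℝ => x ^ p := by
  have := Real.contDiff_rpow_const_of_le (p := p) (n := 4) (by exact_mod_cast hp)
  exact_mod_cast this

lemma isProf_truncPow {κ : ℝ} (hκ : 0 < κ) : IsProf 4 (truncPow κ) where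
  smooth := by
    have := (contDiff_rpow_of_le (p := 9 / 2) (by norm_num)).comp
      ((contDiff_const (c := (1 : ℝ))).sub ((contDiff_const (c := κ)).mul contDiff_id))
    exact_mod_cast this
  zero := ⟨1 / κ, by positivity, fun u hu => truncPow_eq_zero (by
    rw [div_le_iff₀ hκ] at hu; linarith)⟩

/-- The normalising constant of the truncated power weight. -/
noncomputable def bellConst : ℝ := ∫ t : ℝ, (1 - t ^ 2) ^ (9 / 2 : ℝ)

lemma bellConst_pos : 0 < bellConst := by
  have hc : Continuous fun t : ℝ => (1 - t ^ 2) ^ (9 / 2 : ℝ) :=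
    (continuous_const.sub (continuous_id.pow 2)).rpow_const fun _ => Or.inr (by norm_num)
  have h0 : ∀ t : ℝ, 0 ≤ (1 - t ^ 2) ^ (9 / 2 : ℝ) := fun t => by
    rcases le_total (1 - t ^ 2) 0 with h | h
    · rw [rpow_nine_half_of_nonpos h]
    · exact Real.rpow_nonneg h _
  refine hc.integral_pos_of_hasCompactSupport_nonneg_nonzero ?_ h0 (x := 0) (by simp)
  refine HasCompactSupport.intro (isCompact_Icc (a := (-1 : ℝ)) (b := 1)) fun t ht => ?_
  refine rpow_nine_half_of_nonpos ?_
  by_contra h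
  push Not at h
  exact ht ⟨by nlinarith, by nlinarith⟩

lemma integral_quadratic_rpow {A θ : ℝ} (hθ : 0 < θ) :
    ∫ x : ℝ, (A - θ * x ^ 2) ^ (9 / 2 : ℝ) = bellConst * (max A 0 ^ 5 / √θ) := by
  rcases le_or_gt A 0 with hA | hA
  · rw [max_eq_right hA]
    have : ∀ x : ℝ, (A - θ * x ^ 2) ^ (9 / 2 : ℝ) = 0 := fun x =>
      rpow_nine_half_of_nonpos (by nlinarith [mul_nonneg hθ.le (sq_nonneg x)])
    simp_rw [this]
    simp
  · rw [max_eq_left hA.le]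
    have hr : 0 < √θ / √A := by positivity
    have e : ∀ x : ℝ, (A - θ * x ^ 2) ^ (9 / 2 : ℝ) =
        A ^ (9 / 2 : ℝ) * (1 - (√θ / √A * x) ^ 2) ^ (9 / 2 : ℝ) := fun x => by
      have e1 : A - θ * x ^ 2 = A * (1 - (√θ / √A * x) ^ 2) := by
        rw [mul_pow, div_pow, Real.sq_sqrt hθ.le, Real.sq_sqrt hA.le]
        field_simp
      rw [e1]
      rcases le_total (1 - (√θ / √A * x) ^ 2) 0 with h | h
      · rw [rpow_nine_half_of_nonpos h, mul_zero,
          rpow_nine_half_of_nonpos (mul_nonpos_of_nonneg_of_nonpos hA.le h)]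
      · rw [Real.mul_rpow hA.le h]
    simp_rw [e]
    rw [integral_const_mul, Measure.integral_comp_mul_left
      (fun t : ℝ => (1 - t ^ 2) ^ (9 / 2 : ℝ)), abs_of_pos (inv_pos.2 hr), smul_eq_mul, inv_div]
    change A ^ (9 / 2 : ℝ) * (√A / √θ * bellConst) = _
    have e2 : A ^ (9 / 2 : ℝ) * √A = A ^ 5 := by
      rw [Real.sqrt_eq_rpow, ← Real.rpow_add hA, ← Real.rpow_natCast]
      norm_num
    rw [← e2]
    ring

/-- The kernel without phase and cut-off. -/
noncomputable def mainKern (f g : ℝ → ℝ) (s : ℝ) (c : ℕ) (z : ℂ) : ℝ :=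
  if 0 < z.im then (z.im ^ 2)⁻¹ * (Real.exp (-s) *
    (f (Real.exp (-s) / z.im) * g (Real.exp (-s) / invIm c z))) else 0

lemma integral_mainKern_inner {κ : ℝ} (hκ : 0 < κ) (Ψ : ℝ → ℝ) (s : ℝ) {c : ℕ} (hc : 0 < c)
    {y : ℝ} (hy : 0 < y) :
    ∫ x : ℝ, mainKern (fun v => v ^ (11 / 2 : ℝ) * Ψ v) (truncPow κ) s c ⟨x, y⟩ =
      Real.exp (-s) * (bellConst / (√κ * c)) * ((y ^ 2)⁻¹ *
        (max (Real.exp (-s) / y - κ * (c * Real.exp (-s)) ^ 2) 0 ^ 5 *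
          Ψ (Real.exp (-s) / y))) := by
  set q := Real.exp (-s) with hq
  have hq0 : 0 < q := Real.exp_pos _
  have hc' : (0 : ℝ) < c := by exact_mod_cast hc
  set v := q / y with hv
  have hv0 : 0 < v := by positivity
  have hyv : y = q / v := by rw [hv]; field_simp
  set A := 1 - κ * (c * q) ^ 2 / v with hA
  set θ := κ * c ^ 2 * v with hθ
  have hθ0 : 0 < θ := by positivity
  have e : ∀ x : ℝ, mainKern (fun v => v ^ (11 / 2 : ℝ) * Ψ v) (truncPow κ) s c ⟨x, y⟩ =
      ((y ^ 2)⁻¹ * (q * (v ^ (11 / 2 : ℝ) * Ψ v))) * (A - θ * x ^ 2) ^ (9 / 2 : ℝ) := by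
    intro x
    have h1 : 1 - κ * (q / invIm c ⟨x, y⟩) = A - θ * x ^ 2 := by
      rw [invIm, hA, hθ]
      simp only
      rw [hyv]
      have : x ^ 2 + (q / v) ^ 2 ≠ 0 := by positivity
      field_simp
      ring
    simp only [mainKern]
    rw [if_pos hy, truncPow, ← hq, h1]
    ring
  simp_rw [e]
  rw [integral_const_mul, integral_quadratic_rpow hθ0]
  have h2 : √θ = √κ * c * √v := by
    rw [hθ, Real.sqrt_mul (by positivity), Real.sqrt_mul hκ.le, Real.sqrt_sq hc'.le]
  have h3 : v ^ (11 / 2 : ℝ) = v ^ 5 * √v := by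
    rw [Real.sqrt_eq_rpow, ← Real.rpow_natCast v 5, ← Real.rpow_add hv0]
    norm_num
  have h4 : max (v - κ * (c * q) ^ 2) 0 = v * max A 0 := by
    rw [mul_max_of_nonneg _ _ hv0.le, mul_zero, hA]
    congr 1
    field_simp
  have hsv : √v ≠ 0 := by positivity
  have hsκ : √κ ≠ 0 := by positivity
  rw [h2, h3, h4]
  field_simp

lemma integral_mainKern {κ : ℝ} (hκ : 0 < κ) {Φ : ℝ → ℝ} (hΦ : ContDiff ℝ (⊤ : ℕ∞) Φ)
    (hΦc : HasCompactSupport Φ) (s : ℝ) {c : ℕ} (hc : 0 < c)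
    (h_int : Integrable (mainKern (fun v => v ^ (11 / 2 : ℝ) * iteratedDeriv 6 Φ v)
      (truncPow κ) s c)) :
    ∫ z, mainKern (fun v => v ^ (11 / 2 : ℝ) * iteratedDeriv 6 Φ v) (truncPow κ) s c z =
      120 * bellConst / (√κ * c) * Φ (κ * (c * Real.exp (-s)) ^ 2) := by
  set q := Real.exp (-s) with hq
  have hq0 : 0 < q := Real.exp_pos _
  set ρ := κ * (c * q) ^ 2 with hρ
  have hρ0 : 0 < ρ := by
    have hc' : (0 : ℝ) < c := by exact_mod_cast hc
    positivity
  set h : ℝ → ℝ := fun v => max (v - ρ) 0 ^ 5 * iteratedDeriv 6 Φ v with hh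
  rw [integral_complex_eq_prod]
  have hi2 := (integrable_complex_iff_prod _).1 h_int
  refine (integral_prod_symm _ hi2).trans ?_
  simp only
  have e1 : (fun y : ℝ => ∫ x : ℝ, mainKern (fun v => v ^ (11 / 2 : ℝ) * iteratedDeriv 6 Φ v)
      (truncPow κ) s c ⟨x, y⟩) = (Ioi 0).indicator fun y =>
        q * (bellConst / (√κ * c)) * ((y ^ 2)⁻¹ * h (q / y)) := by
    funext y
    by_cases hy : 0 < y
    · rw [indicator_of_mem (s := Ioi (0 : ℝ)) hy, integral_mainKern_inner hκ _ s hc hy]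
    · rw [indicator_of_notMem (s := Ioi (0 : ℝ)) hy]
      simp [mainKern, hy]
  rw [e1, integral_indicator measurableSet_Ioi, integral_const_mul]
  have e2 : ∫ y in Ioi (0 : ℝ), (y ^ 2)⁻¹ * h (q / y) = q⁻¹ * ∫ v in Ioi 0, h v := by
    have h1 := integral_comp_rpow_Ioi (fun v => h (q * v)) (p := -1) (by norm_num)
    have h2 := integral_comp_mul_left_Ioi h 0 hq0
    rw [mul_zero] at h2
    rw [h2, smul_eq_mul] at h1
    rw [← h1]
    refine setIntegral_congr_fun measurableSet_Ioi fun y hy => ?_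
    have hy0 : (0 : ℝ) < y := hy
    simp only [smul_eq_mul]
    rw [Real.rpow_neg_one, abs_neg, abs_one, one_mul, show (-1 - 1 : ℝ) = -(2 : ℕ) by norm_num,
      Real.rpow_neg hy0.le, Real.rpow_natCast, div_eq_mul_inv]
  have e3 : ∫ v in Ioi 0, h v = 120 * Φ ρ := by
    have h1 := integral_pow_mul_iteratedDeriv hΦ hΦc ρ 5
    have h2 : ∫ v in Ioi 0, h v = ∫ v in Ioi ρ, h v := by
      refine (setIntegral_eq_of_subset_of_forall_sdiff_eq_zero measurableSet_Ioi
        (Ioi_subset_Ioi hρ0.le) fun v hv => ?_)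
      have : v ≤ ρ := not_lt.1 hv.2
      simp [hh, max_eq_right (sub_nonpos.2 this)]
    rw [h2]
    have h3 : ∫ v in Ioi ρ, h v = ∫ x in Ioi ρ, (x - ρ) ^ 5 * iteratedDeriv (5 + 1) Φ x := by
      refine setIntegral_congr_fun measurableSet_Ioi fun v hv => ?_
      have : ρ < v := hv
      simp only [hh]
      rw [max_eq_left (sub_pos.2 this).le]
    rw [h3, h1]
    norm_num [Nat.factorial]
  rw [e2, e3]
  field_simp

/-! ### Comparison of the kernel with the main term -/

lemma integral_abs_div_sq_add_sq {a L : ℝ} (ha : 0 < a) (hL : 0 ≤ L) :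
    ∫ x in Icc (-L) L, |x| / (x ^ 2 + a ^ 2) = Real.log (1 + L ^ 2 / a ^ 2) := by
  have hc : Continuous fun x : ℝ => x / (x ^ 2 + a ^ 2) :=
    continuous_id.div (by fun_prop) fun x => by positivity
  have h1 : ∫ x in (0 : ℝ)..L, x / (x ^ 2 + a ^ 2) =
      Real.log (L ^ 2 + a ^ 2) / 2 - Real.log (0 ^ 2 + a ^ 2) / 2 := by
    refine intervalIntegral.integral_eq_sub_of_hasDerivAt
      (f := fun x => Real.log (x ^ 2 + a ^ 2) / 2) (fun x _ => ?_)
      (hc.intervalIntegrable _ _)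
    have h : HasDerivAt (fun x : ℝ => x ^ 2 + a ^ 2) (2 * x) x := by
      simpa using (hasDerivAt_pow 2 x).add_const (a ^ 2)
    refine ((h.log (by positivity)).div_const 2).congr_deriv ?_
    field_simp
  have h2 := integral_comp_abs (f := (Iic L).indicator fun t => t / (t ^ 2 + a ^ 2))
  have h3 : ∫ x : ℝ, (Iic L).indicator (fun t => t / (t ^ 2 + a ^ 2)) |x| =
      ∫ x in Icc (-L) L, |x| / (x ^ 2 + a ^ 2) := by
    rw [← integral_indicator measurableSet_Icc]
    congr 1
    funext x
    by_cases h : |x| ≤ L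
    · rw [indicator_of_mem (s := Iic L) h, indicator_of_mem (s := Icc (-L) L) (abs_le.1 h), sq_abs]
    · rw [indicator_of_notMem (s := Iic L) h,
        indicator_of_notMem (s := Icc (-L) L) (fun h' => h (abs_le.2 h'))]
  have h4 : ∫ x in Ioi (0 : ℝ), (Iic L).indicator (fun t => t / (t ^ 2 + a ^ 2)) x =
      ∫ x in (0 : ℝ)..L, x / (x ^ 2 + a ^ 2) := by
    rw [setIntegral_indicator measurableSet_Iic, Ioi_inter_Iic,
      intervalIntegral.integral_of_le hL]
  rw [← h3, h2, h4, h1, show 1 + L ^ 2 / a ^ 2 = (L ^ 2 + a ^ 2) / a ^ 2 by field_simp; ring,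
    Real.log_div (by positivity) (by positivity), zero_pow two_ne_zero, zero_add]
  ring

lemma integral_inv_sq_add_sq_le {a L : ℝ} (ha : 0 < a) (hL : 0 ≤ L) :
    ∫ x in Icc (-L) L, 1 / (x ^ 2 + a ^ 2) ≤ π / a := by
  have hc : Continuous fun x : ℝ => 1 / (x ^ 2 + a ^ 2) :=
    continuous_const.div (by fun_prop) fun x => by positivity
  rw [integral_Icc_eq_integral_Ioc, ← intervalIntegral.integral_of_le (by linarith)]
  have h1 : ∫ x in (-L)..L, 1 / (x ^ 2 + a ^ 2) =
      Real.arctan (L / a) / a - Real.arctan (-L / a) / a := by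
    refine intervalIntegral.integral_eq_sub_of_hasDerivAt
      (f := fun x => Real.arctan (x / a) / a) (fun x _ => ?_) (hc.intervalIntegrable _ _)
    refine ((((hasDerivAt_id x).div_const a).arctan).div_const a).congr_deriv ?_
    simp only [id]
    field_simp
    ring
  rw [h1, ← sub_div]
  have := Real.arctan_lt_pi_div_two (L / a)
  have := Real.neg_pi_div_two_lt_arctan (-L / a)
  gcongr
  linarith

/-- Standing assumptions on a pair of profiles. -/
structure IsPair (f g : ℝ → ℝ) (B u₀ v₁ v₂ : ℝ) : Prop where
  cont_left : Continuous f
  cont_right : Continuous g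
  one_le : 1 ≤ v₁
  le : v₁ ≤ v₂
  pos : 0 < u₀
  supp_left : ∀ v, f v ≠ 0 → v₁ ≤ v ∧ v ≤ v₂
  supp_right : ∀ u, u₀ ≤ u → g u = 0
  bound : ∀ u v, 0 ≤ u → |f v * g u| ≤ B

section

variable {f g : ℝ → ℝ} {B u₀ v₁ v₂ : ℝ}

lemma IsPair.support (h : IsPair f g B u₀ v₁ v₂) {s : ℝ} {c : ℕ} (hc : 0 < c) {z : ℂ}
    (hz : 0 < z.im) (hne : f (Real.exp (-s) / z.im) * g (Real.exp (-s) / invIm c z) ≠ 0) :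
    Real.exp (-s) / v₂ ≤ z.im ∧ z.im ≤ Real.exp (-s) / v₁ ∧ |z.re| ≤ √(u₀ / v₁) / c ∧
      (c * Real.exp (-s)) ^ 2 ≤ u₀ * v₂ := by
  set q := Real.exp (-s) with hq
  have hq0 : 0 < q := Real.exp_pos _
  have hv1 : 0 < v₁ := by linarith [h.one_le]
  have hv2 : 0 < v₂ := by linarith [h.le]
  have hc' : (0 : ℝ) < c := by exact_mod_cast hc
  obtain ⟨ha, hb⟩ := h.supp_left _ (left_ne_zero_of_mul hne)
  have hg : q / invIm c z < u₀ := by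
    by_contra h'
    exact right_ne_zero_of_mul hne (h.supp_right _ (not_lt.1 h'))
  rw [le_div_iff₀ hz] at ha
  rw [div_le_iff₀ hz] at hb
  have hy1 : z.im ≤ q / v₁ := by rw [le_div_iff₀ hv1]; linarith
  have hy2 : q / v₂ ≤ z.im := by rw [div_le_iff₀ hv2]; linarith
  rw [invIm, div_div_eq_mul_div, div_lt_iff₀ hz] at hg
  have e1 : q * (c ^ 2 * z.re ^ 2) ≤ q * (u₀ / v₁) := by
    have h1 : q * (c ^ 2 * z.re ^ 2) ≤ u₀ * z.im := by
      have : 0 ≤ q * (c ^ 2 * z.im ^ 2) := by positivity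
      nlinarith
    calc _ ≤ u₀ * z.im := h1
      _ ≤ u₀ * (q / v₁) := mul_le_mul_of_nonneg_left hy1 h.pos.le
      _ = _ := by ring
  have e2 := le_of_mul_le_mul_left e1 hq0
  refine ⟨hy2, hy1, ?_, ?_⟩
  · rw [le_div_iff₀ hc']
    refine Real.le_sqrt_of_sq_le ?_
    rw [mul_pow, sq_abs]
    linarith
  · have h1 : (q * c ^ 2 * z.im) * z.im ≤ u₀ * z.im := by
      have : 0 ≤ q * (c ^ 2 * z.re ^ 2) := by positivity
      nlinarith
    have h2 := le_of_mul_le_mul_right h1 hz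
    have h3 : q * c ^ 2 * (q / v₂) ≤ u₀ :=
      (mul_le_mul_of_nonneg_left hy2 (by positivity)).trans h2
    rw [← mul_div_assoc, div_le_iff₀ hv2] at h3
    linarith

lemma IsPair.bound_nonneg (h : IsPair f g B u₀ v₁ v₂) : 0 ≤ B :=
  (abs_nonneg _).trans (h.bound 0 0 le_rfl)

lemma invIm_nonneg (c : ℕ) {z : ℂ} (hz : 0 < z.im) : 0 ≤ invIm c z := by
  rw [invIm]; positivity

lemma IsPair.abs_mainKern_le (h : IsPair f g B u₀ v₁ v₂) (s : ℝ) {c : ℕ} (hc : 0 < c) {z : ℂ}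
    (hz : 0 < z.im) (hne : f (Real.exp (-s) / z.im) * g (Real.exp (-s) / invIm c z) ≠ 0) :
    |mainKern f g s c z| ≤ B * v₂ ^ 2 / Real.exp (-s) := by
  obtain ⟨h1, -⟩ := h.support hc hz hne
  set q := Real.exp (-s) with hq
  have hq0 : 0 < q := Real.exp_pos _
  have hv2 : 0 < v₂ := by linarith [h.le, h.one_le]
  rw [mainKern, if_pos hz, ← hq, abs_mul, abs_mul, abs_of_pos hq0, abs_of_pos (by positivity)]
  have h2 := h.bound (q / invIm c z) (q / z.im) (div_nonneg hq0.le (invIm_nonneg c hz))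
  have h3 : (z.im ^ 2)⁻¹ ≤ ((q / v₂) ^ 2)⁻¹ := by
    have : 0 < q / v₂ := by positivity
    gcongr
  calc (z.im ^ 2)⁻¹ * (q * |f (q / z.im) * g (q / invIm c z)|) ≤
      ((q / v₂) ^ 2)⁻¹ * (q * B) := by gcongr
    _ = _ := by field_simp

lemma IsPair.norm_kern_sub_le (h : IsPair f g B u₀ v₁ v₂) (μ ν : ℤ) {s : ℝ} (hs : 0 ≤ s) {c : ℕ}
    (hc : 0 < c) {z : ℂ} (hz : 0 < z.im)
    (hne : f (Real.exp (-s) / z.im) * g (Real.exp (-s) / invIm c z) ≠ 0) :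
    ‖kern μ ν f g s c z - mainKern f g s c z‖ ≤ B * v₂ ^ 2 / Real.exp (-s) *
      (2 * π * |(μ : ℝ)| * |z.re| + (2 * π * |(ν : ℝ)| * |z.re| + z.im) /
        (c ^ 2 * (z.re ^ 2 + z.im ^ 2))) := by
  obtain ⟨-, h2, -⟩ := h.support hc hz hne
  have hv1 : 0 < v₁ := by linarith [h.one_le]
  have hy1 : z.im ≤ 1 := h2.trans (by
    rw [div_le_one hv1]
    exact (Real.exp_le_one_iff.2 (by linarith)).trans h.one_le)
  set E := Complex.exp (2 * π * Complex.I * (μ * z.re - ν * invRe c z)) with hE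
  have e1 : kern μ ν f g s c z - mainKern f g s c z = (mainKern f g s c z : ℂ) *
      ((cutoff (invIm c z) : ℂ) * (E - 1) - ((1 - cutoff (invIm c z) : ℝ) : ℂ)) := by
    have hq : Real.exp (-s) = Real.exp (-s / 2) * Real.exp (-s / 2) := by
      rw [← Real.exp_add]; ring_nf
    rw [kern, mainKern, if_pos hz, if_pos hz, weight, weight, cutoff_of_le_one hy1, ← hE]
    generalize f (Real.exp (-s) / z.im) = F
    generalize g (Real.exp (-s) / invIm c z) = G
    rw [hq]
    push_cast
    ring
  have e2 : ‖E - 1‖ ≤ 2 * π * (|(μ : ℝ)| * |z.re| + |(ν : ℝ)| * |invRe c z|) := by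
    have e3 : E = Complex.exp (Complex.I * ((2 * π * (μ * z.re - ν * invRe c z) : ℝ) : ℂ)) := by
      rw [hE]; congr 1; push_cast; ring
    rw [e3]
    refine (Real.norm_exp_I_mul_ofReal_sub_one_le).trans ?_
    rw [Real.norm_eq_abs, abs_mul, abs_of_pos (by positivity : (0 : ℝ) < 2 * π)]
    gcongr
    rw [← abs_mul, ← abs_mul]
    exact abs_sub _ _
  have e4 : 1 - cutoff (invIm c z) ≤ invIm c z := by
    rcases le_total (invIm c z) 1 with h' | h'
    · rw [cutoff_of_le_one h', sub_self]; exact invIm_nonneg c hz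
    · linarith [cutoff_nonneg (invIm c z)]
  have e5 : |invRe c z| = |z.re| / (c ^ 2 * (z.re ^ 2 + z.im ^ 2)) := by
    rw [invRe, abs_div, abs_of_nonneg (a := (c : ℝ) ^ 2 * (z.re ^ 2 + z.im ^ 2)) (by positivity)]
  rw [e1, norm_mul, Complex.norm_real, Real.norm_eq_abs]
  refine mul_le_mul (h.abs_mainKern_le s hc hz hne) ?_ (norm_nonneg _)
    (by have := h.bound_nonneg; positivity)
  refine (norm_sub_le _ _).trans ?_
  rw [norm_mul, Complex.norm_real, Complex.norm_real, Real.norm_eq_abs, Real.norm_eq_abs,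
    abs_of_nonneg (cutoff_nonneg _), abs_of_nonneg (sub_nonneg.2 (cutoff_le_one _))]
  calc cutoff (invIm c z) * ‖E - 1‖ + (1 - cutoff (invIm c z)) ≤
      1 * (2 * π * (|(μ : ℝ)| * |z.re| + |(ν : ℝ)| * |invRe c z|)) + invIm c z := by
        gcongr
        exact cutoff_le_one _
    _ = _ := by rw [e5, invIm]; ring

lemma mainKern_eq_zero (s : ℝ) (c : ℕ) {z : ℂ}
    (hz : 0 < z.im → f (Real.exp (-s) / z.im) * g (Real.exp (-s) / invIm c z) = 0) :
    mainKern f g s c z = 0 := by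
  rw [mainKern]
  split_ifs with h
  · rw [hz h]; ring
  · rfl

lemma kern_eq_zero (μ ν : ℤ) (s : ℝ) (c : ℕ) {z : ℂ}
    (hz : 0 < z.im → f (Real.exp (-s) / z.im) * g (Real.exp (-s) / invIm c z) = 0) :
    kern μ ν f g s c z = 0 := by
  rw [kern]
  split_ifs with h
  · rw [weight, weight]
    rcases mul_eq_zero.1 (hz h) with h' | h' <;> rw [h'] <;> simp
  · rfl

end

/-- The majorant in the horizontal variable. -/
noncomputable def horizMajorant (a b L K₁ K₂ K₃ x : ℝ) : ℝ :=
  (Icc (-b) b).indicator (fun _ => K₁) x +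
    ((Icc (-L) L).indicator (fun x => K₂ * (|x| / (x ^ 2 + a ^ 2))) x +
      (Icc (-L) L).indicator (fun x => K₃ * (1 / (x ^ 2 + a ^ 2))) x)

lemma integrable_horizMajorant {a : ℝ} (ha : 0 < a) (b L K₁ K₂ K₃ : ℝ) :
    Integrable (horizMajorant a b L K₁ K₂ K₃) := by
  have c1 : Continuous fun x : ℝ => K₂ * (|x| / (x ^ 2 + a ^ 2)) :=
    continuous_const.mul (continuous_abs.div (by fun_prop) fun x => by positivity)
  have c2 : Continuous fun x : ℝ => K₃ * (1 / (x ^ 2 + a ^ 2)) :=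
    continuous_const.mul (continuous_const.div (by fun_prop) fun x => by positivity)
  refine Integrable.add ?_ (Integrable.add ?_ ?_)
  · rw [integrable_indicator_iff measurableSet_Icc]
    exact continuous_const.continuousOn.integrableOn_compact isCompact_Icc
  · rw [integrable_indicator_iff measurableSet_Icc]
    exact c1.continuousOn.integrableOn_compact isCompact_Icc
  · rw [integrable_indicator_iff measurableSet_Icc]
    exact c2.continuousOn.integrableOn_compact isCompact_Icc

lemma integral_horizMajorant_le {a b L K₁ K₂ K₃ : ℝ} (ha : 0 < a) (hb : 0 ≤ b) (hL : 0 ≤ L)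
    (h3 : 0 ≤ K₃) : ∫ x, horizMajorant a b L K₁ K₂ K₃ x ≤
      2 * b * K₁ + (K₂ * Real.log (1 + L ^ 2 / a ^ 2) + K₃ * (π / a)) := by
  have c1 : Continuous fun x : ℝ => K₂ * (|x| / (x ^ 2 + a ^ 2)) :=
    continuous_const.mul (continuous_abs.div (by fun_prop) fun x => by positivity)
  have c2 : Continuous fun x : ℝ => K₃ * (1 / (x ^ 2 + a ^ 2)) :=
    continuous_const.mul (continuous_const.div (by fun_prop) fun x => by positivity)
  have i1 : Integrable fun x : ℝ => (Icc (-b) b).indicator (fun _ => K₁) x := by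
    rw [integrable_indicator_iff measurableSet_Icc]
    exact continuous_const.continuousOn.integrableOn_compact isCompact_Icc
  have i2 : Integrable fun x : ℝ =>
      (Icc (-L) L).indicator (fun x => K₂ * (|x| / (x ^ 2 + a ^ 2))) x := by
    rw [integrable_indicator_iff measurableSet_Icc]
    exact c1.continuousOn.integrableOn_compact isCompact_Icc
  have i3 : Integrable fun x : ℝ =>
      (Icc (-L) L).indicator (fun x => K₃ * (1 / (x ^ 2 + a ^ 2))) x := by
    rw [integrable_indicator_iff measurableSet_Icc]
    exact c2.continuousOn.integrableOn_compact isCompact_Icc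
  have i23 : Integrable fun x : ℝ =>
      (Icc (-L) L).indicator (fun x => K₂ * (|x| / (x ^ 2 + a ^ 2))) x +
      (Icc (-L) L).indicator (fun x => K₃ * (1 / (x ^ 2 + a ^ 2))) x := i2.add i3
  simp_rw [horizMajorant]
  rw [integral_add i1 i23, integral_add i2 i3, integral_indicator measurableSet_Icc,
    integral_indicator measurableSet_Icc, integral_indicator measurableSet_Icc,
    integral_const_mul, integral_const_mul, integral_abs_div_sq_add_sq ha hL, setIntegral_const,
    Real.volume_real_Icc_of_le (by linarith), smul_eq_mul]
  have := mul_le_mul_of_nonneg_left (integral_inv_sq_add_sq_le ha hL) h3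
  linarith

section

variable {f g : ℝ → ℝ} {B u₀ v₁ v₂ : ℝ}

lemma integrable_re_mul_im {G H : ℝ → ℝ} (hG : Integrable G) (hH : Integrable H) :
    Integrable fun z : ℂ => G z.re * H z.im := by
  rw [integrable_complex_iff_prod]
  exact hG.mul_prod hH

lemma integral_re_mul_im (G H : ℝ → ℝ) :
    ∫ z : ℂ, G z.re * H z.im = (∫ x, G x) * ∫ y, H y := by
  rw [integral_complex_eq_prod]
  exact integral_prod_mul G H

lemma measurable_mainKern (hf : Continuous f) (hg : Continuous g) (s : ℝ) (c : ℕ) :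
    Measurable (mainKern f g s c) := by
  have hf' := hf.measurable
  have hg' := hg.measurable
  have h1 := Complex.measurable_im
  have h2 := Complex.measurable_re
  have h3 : Measurable (invIm c) :=
    h1.div (((h2.pow_const 2).add (h1.pow_const 2)).const_mul _)
  refine Measurable.ite measurableSet_im_pos ?_ measurable_const
  exact (h1.pow_const 2).inv.mul (((hf'.comp (measurable_const.div h1)).mul
    (hg'.comp (measurable_const.div h3))).const_mul _)

lemma integrable_indicator_Icc (a b : ℝ) :
    Integrable fun x : ℝ => (Icc a b).indicator (fun _ => (1 : ℝ)) x := by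
  rw [integrable_indicator_iff measurableSet_Icc]
  exact continuous_const.continuousOn.integrableOn_compact isCompact_Icc

lemma IsPair.integrable_mainKern (h : IsPair f g B u₀ v₁ v₂) (s : ℝ) {c : ℕ} (hc : 0 < c) :
    Integrable (mainKern f g s c) := by
  set q := Real.exp (-s) with hq
  have hB := h.bound_nonneg
  have hq0 : 0 < q := Real.exp_pos _
  have hi := (integrable_re_mul_im (integrable_indicator_Icc (-(√(u₀ / v₁) / c)) (√(u₀ / v₁) / c))
    (integrable_indicator_Icc (q / v₂) (q / v₁))).const_mul (B * v₂ ^ 2 / q)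
  refine hi.mono' (measurable_mainKern h.cont_left h.cont_right s c).aestronglyMeasurable
    (Eventually.of_forall fun z => ?_)
  by_cases hz : 0 < z.im ∧ f (q / z.im) * g (q / invIm c z) ≠ 0
  · obtain ⟨h1, h2, h3, -⟩ := h.support hc hz.1 hz.2
    rw [indicator_of_mem (s := Icc _ _) (abs_le.1 h3), indicator_of_mem (s := Icc _ _) ⟨h1, h2⟩,
      mul_one, mul_one]
    exact h.abs_mainKern_le s hc hz.1 hz.2
  · rw [mainKern_eq_zero s c fun h0 => by_contra fun hne => hz ⟨h0, hne⟩, norm_zero]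
    have h0 : ∀ (S : Set ℝ) x, 0 ≤ S.indicator (fun _ => (1 : ℝ)) x := fun S x =>
      indicator_nonneg (fun _ _ => zero_le_one) x
    have := h0 (Icc (-(√(u₀ / v₁) / c)) (√(u₀ / v₁) / c)) z.re
    have := h0 (Icc (q / v₂) (q / v₁)) z.im
    positivity

lemma IsPair.integral_eq_zero (h : IsPair f g B u₀ v₁ v₂) (μ ν : ℤ) (s : ℝ) {c : ℕ} (hc : 0 < c)
    (hlt : u₀ * v₂ < (c * Real.exp (-s)) ^ 2) :
    ∫ z, kern μ ν f g s c z = 0 ∧ ∫ z, mainKern f g s c z = 0 := by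
  have key : ∀ z : ℂ, 0 < z.im → f (Real.exp (-s) / z.im) * g (Real.exp (-s) / invIm c z) = 0 := by
    intro z hz
    by_contra hne
    exact hlt.not_ge (h.support hc hz hne).2.2.2
  constructor
  · simp_rw [fun z => kern_eq_zero μ ν s c (key z)]
    exact integral_zero _ _
  · simp_rw [fun z => mainKern_eq_zero s c (key z)]
    exact integral_zero _ _

lemma IsPair.norm_integral_sub_le (h : IsPair f g B u₀ v₁ v₂) (μ ν : ℤ) : ∃ C, 0 ≤ C ∧
    ∀ s, 0 ≤ s → ∀ c : ℕ, 0 < c → Integrable (kern μ ν f g s c) →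
      ‖(∫ z, kern μ ν f g s c z) - ((∫ z, mainKern f g s c z : ℝ) : ℂ)‖ ≤
        C * (1 + s) / c ^ 2 := by
  have hB := h.bound_nonneg
  have hv1 : 0 < v₁ := by linarith [h.one_le]
  have hv2 : 0 < v₂ := by linarith [h.le]
  have hu := h.pos
  set L := √(u₀ / v₁) with hL
  have hL0 : 0 ≤ L := Real.sqrt_nonneg _
  set D := Real.log (1 + L ^ 2 * v₂ ^ 2) with hD
  have hD0 : 0 ≤ D := Real.log_nonneg (by nlinarith [mul_nonneg (sq_nonneg L) (sq_nonneg v₂)])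
  refine ⟨B * v₂ ^ 2 / v₁ * (2 * L * (2 * π * |(μ : ℝ)| * L) +
    (2 * π * |(ν : ℝ)| * (D + 2) + π * v₂ / v₁)), by positivity, fun s hs c hc hk => ?_⟩
  set q := Real.exp (-s) with hq
  have hq0 : 0 < q := Real.exp_pos _
  have hc0 : (0 : ℝ) < c := by exact_mod_cast hc
  have hc1 : (1 : ℝ) ≤ c := by exact_mod_cast hc
  have ha : 0 < q / v₂ := by positivity
  set M := B * v₂ ^ 2 / q with hM
  set G := horizMajorant (q / v₂) (L / c) L (2 * π * |(μ : ℝ)| * (L / c))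
    (2 * π * |(ν : ℝ)| / c ^ 2) (q / v₁ / c ^ 2) with hG
  have hGi : Integrable G := integrable_horizMajorant ha _ _ _ _ _
  set J : ℝ → ℝ := fun y => (Icc (q / v₂) (q / v₁)).indicator (fun _ => (1 : ℝ)) y with hJ
  have hJi : Integrable J := integrable_indicator_Icc _ _
  have hm := h.integrable_mainKern s hc
  have hm' : Integrable fun z => (mainKern f g s c z : ℂ) := hm.ofReal
  rw [← integral_complex_ofReal, ← integral_sub hk hm']
  have hbd : ∀ z, ‖kern μ ν f g s c z - (mainKern f g s c z : ℂ)‖ ≤ M * (G z.re * J z.im) := by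
    intro z
    by_cases hz : 0 < z.im ∧ f (q / z.im) * g (q / invIm c z) ≠ 0
    · obtain ⟨h1, h2, h3, -⟩ := h.support hc hz.1 hz.2
      have h4 : |z.re| ≤ L := h3.trans (div_le_self hL0 hc1)
      refine (h.norm_kern_sub_le μ ν hs hc hz.1 hz.2).trans ?_
      rw [hJ, hG, horizMajorant]
      simp only
      rw [indicator_of_mem (s := Icc (-(L / c)) (L / c)) (abs_le.1 h3),
        indicator_of_mem (s := Icc (-L) L) (abs_le.1 h4),
        indicator_of_mem (s := Icc (-L) L) (abs_le.1 h4),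
        indicator_of_mem (s := Icc (q / v₂) (q / v₁)) ⟨h1, h2⟩, mul_one]
      refine mul_le_mul_of_nonneg_left (add_le_add ?_ ?_) (by positivity)
      · gcongr
      · have hpos : 0 < z.re ^ 2 + (q / v₂) ^ 2 := by positivity
        calc (2 * π * |(ν : ℝ)| * |z.re| + z.im) / (c ^ 2 * (z.re ^ 2 + z.im ^ 2)) ≤
            (2 * π * |(ν : ℝ)| * |z.re| + q / v₁) / (c ^ 2 * (z.re ^ 2 + (q / v₂) ^ 2)) := by
              gcongr
          _ = _ := by field_simp
    · have hz' : 0 < z.im → f (q / z.im) * g (q / invIm c z) = 0 :=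
        fun h0 => by_contra fun hne => hz ⟨h0, hne⟩
      rw [kern_eq_zero μ ν s c hz', mainKern_eq_zero s c hz', Complex.ofReal_zero, sub_zero,
        norm_zero]
      have hJ0 : 0 ≤ J z.im := indicator_nonneg (fun _ _ => zero_le_one) _
      have hG0 : 0 ≤ G z.re := by
        rw [hG, horizMajorant]
        refine add_nonneg (indicator_nonneg (fun _ _ => by positivity) _)
          (add_nonneg (indicator_nonneg (fun _ _ => by positivity) _)
            (indicator_nonneg (fun _ _ => by positivity) _))
      positivity
  refine (norm_integral_le_of_norm_le ((integrable_re_mul_im hGi hJi).const_mul M)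
    (Eventually.of_forall hbd)).trans ?_
  rw [integral_const_mul, integral_re_mul_im]
  have hJv : ∫ y, J y ≤ q / v₁ := by
    rw [hJ, integral_indicator measurableSet_Icc, setIntegral_const, smul_eq_mul, mul_one,
      Real.volume_real_Icc_of_le (div_le_div_of_nonneg_left hq0.le hv1 h.le)]
    linarith
  have hJ0 : 0 ≤ ∫ y, J y := integral_nonneg fun y => indicator_nonneg (fun _ _ => zero_le_one) _
  have hGv := integral_horizMajorant_le (a := q / v₂) (b := L / c) (L := L)
    (K₁ := 2 * π * |(μ : ℝ)| * (L / c)) (K₂ := 2 * π * |(ν : ℝ)| / c ^ 2)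
    (K₃ := q / v₁ / c ^ 2) ha (by positivity) hL0 (by positivity)
  have hlog : Real.log (1 + L ^ 2 / (q / v₂) ^ 2) ≤ D + 2 * s := by
    have e1 : D + 2 * s = Real.log ((1 + L ^ 2 * v₂ ^ 2) * (Real.exp s) ^ 2) := by
      rw [Real.log_mul (by positivity) (by positivity), Real.log_pow, Real.log_exp]
      norm_num
      rfl
    rw [e1]
    refine Real.log_le_log (by positivity) ?_
    have e2 : L ^ 2 / (q / v₂) ^ 2 = L ^ 2 * v₂ ^ 2 * Real.exp s ^ 2 := by
      rw [hq, Real.exp_neg]; field_simp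
    have e3 : 1 ≤ Real.exp s ^ 2 := one_le_pow₀ (Real.one_le_exp hs)
    rw [e2]; linarith
  have hlog2 : D + 2 * s ≤ (D + 2) * (1 + s) := by nlinarith
  have h5 : ∫ x, G x ≤ (1 + s) / c ^ 2 * (2 * L * (2 * π * |(μ : ℝ)| * L) +
      (2 * π * |(ν : ℝ)| * (D + 2) + π * v₂ / v₁)) := by
    refine hGv.trans ?_
    have t1 : 2 * (L / c) * (2 * π * |(μ : ℝ)| * (L / c)) ≤
        (1 + s) / c ^ 2 * (2 * L * (2 * π * |(μ : ℝ)| * L)) := by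
      have : 2 * (L / c) * (2 * π * |(μ : ℝ)| * (L / c)) =
        1 / c ^ 2 * (2 * L * (2 * π * |(μ : ℝ)| * L)) := by field_simp
      rw [this]
      gcongr
      linarith
    have t2 : 2 * π * |(ν : ℝ)| / c ^ 2 * Real.log (1 + L ^ 2 / (q / v₂) ^ 2) ≤
        (1 + s) / c ^ 2 * (2 * π * |(ν : ℝ)| * (D + 2)) := by
      calc _ ≤ 2 * π * |(ν : ℝ)| / c ^ 2 * ((D + 2) * (1 + s)) :=
            mul_le_mul_of_nonneg_left (hlog.trans hlog2) (by positivity)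
        _ = _ := by ring
    have t3 : q / v₁ / c ^ 2 * (π / (q / v₂)) ≤ (1 + s) / c ^ 2 * (π * v₂ / v₁) := by
      have : q / v₁ / c ^ 2 * (π / (q / v₂)) = 1 / c ^ 2 * (π * v₂ / v₁) := by field_simp
      rw [this]
      gcongr
      linarith
    linarith
  have h6 : 0 ≤ (1 + s) / (c : ℝ) ^ 2 * (2 * L * (2 * π * |(μ : ℝ)| * L) +
      (2 * π * |(ν : ℝ)| * (D + 2) + π * v₂ / v₁)) := by positivity
  calc M * ((∫ x, G x) * ∫ y, J y) ≤ M * (((1 + s) / c ^ 2 * (2 * L * (2 * π * |(μ : ℝ)| * L) +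
      (2 * π * |(ν : ℝ)| * (D + 2) + π * v₂ / v₁))) * (q / v₁)) := by
        refine mul_le_mul_of_nonneg_left (mul_le_mul h5 hJv hJ0 h6) (by positivity)
    _ = _ := by rw [hM]; field_simp

end

/-! ### The bound for sums of Kloosterman sums -/

lemma norm_kloostermanSum_le (n m : ℤ) (c : ℕ) : ‖kloostermanSum n m c‖ ≤ c := by
  rw [← sum_phase]
  refine (norm_sum_le _ _).trans ?_
  have h1 : ∀ a d : ℤ, ‖phase (-n) m c a d‖ = 1 := fun a d => by
    rw [phase, show 2 * π * Complex.I * (((- -n * d + m * a : ℤ) : ℂ) / (c : ℂ)) =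
      ((2 * π * ((- -n * d + m * a : ℤ) / c) : ℝ) : ℂ) * Complex.I by push_cast; ring,
      Complex.norm_exp_ofReal_mul_I]
  simp_rw [h1]
  rw [Finset.sum_const, nsmul_eq_mul, mul_one, Finset.card_univ, Fintype.card_coe]
  exact_mod_cast (Finset.card_filter_le _ _).trans (Finset.card_range c).le

lemma exists_support_Icc {W : ℝ → ℝ} (hW : HasCompactSupport W) (hpos : tsupport W ⊆ Ioi 0) :
    ∃ t₁ t₂, 0 < t₁ ∧ t₁ ≤ t₂ ∧ ∀ t, W t ≠ 0 → t₁ ≤ t ∧ t ≤ t₂ := by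
  have hK : IsCompact (tsupport W) := hW
  rcases (tsupport W).eq_empty_or_nonempty with h | h
  · refine ⟨1, 1, one_pos, le_rfl, fun t ht => ?_⟩
    have := subset_tsupport W ht
    rw [h] at this
    exact this.elim
  · obtain ⟨t₁, h1, h1'⟩ := hK.exists_isLeast h
    obtain ⟨t₂, h2, h2'⟩ := hK.exists_isGreatest h
    exact ⟨t₁, t₂, hpos h1, h1' h2, fun t ht =>
      ⟨h1' (subset_tsupport W ht), h2' (subset_tsupport W ht)⟩⟩

/-- The weight transported to the squared variable. -/
noncomputable def sqrtWeight (W : ℝ → ℝ) (κ v : ℝ) : ℝ := √(v / κ) * W √(v / κ)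

section

variable {W : ℝ → ℝ} {t₁ t₂ κ : ℝ}

lemma sqrtWeight_support (h1 : 0 < t₁) (hW : ∀ t, W t ≠ 0 → t₁ ≤ t ∧ t ≤ t₂) (hκ : 0 < κ)
    {v : ℝ} (hv : sqrtWeight W κ v ≠ 0) : v ∈ Icc (κ * t₁ ^ 2) (κ * t₂ ^ 2) := by
  obtain ⟨ha, hb⟩ := hW _ (right_ne_zero_of_mul hv)
  have h0 : 0 ≤ v / κ := by
    by_contra h
    rw [Real.sqrt_eq_zero_of_nonpos (le_of_not_ge h)] at ha
    linarith
  have ht2 : 0 ≤ t₂ := by linarith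
  rw [Real.le_sqrt h1.le h0, le_div_iff₀ hκ] at ha
  rw [Real.sqrt_le_left ht2, div_le_iff₀ hκ] at hb
  constructor <;> linarith

lemma tsupport_sqrtWeight (h1 : 0 < t₁) (hW : ∀ t, W t ≠ 0 → t₁ ≤ t ∧ t ≤ t₂) (hκ : 0 < κ) :
    tsupport (sqrtWeight W κ) ⊆ Icc (κ * t₁ ^ 2) (κ * t₂ ^ 2) :=
  closure_minimal (fun _ hv => sqrtWeight_support h1 hW hκ hv) isClosed_Icc

lemma contDiff_sqrtWeight (hs : ContDiff ℝ (⊤ : ℕ∞) W) (h1 : 0 < t₁)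
    (hW : ∀ t, W t ≠ 0 → t₁ ≤ t ∧ t ≤ t₂) (hκ : 0 < κ) :
    ContDiff ℝ (⊤ : ℕ∞) (sqrtWeight W κ) := by
  rw [contDiff_iff_contDiffAt]
  intro v
  rcases lt_or_ge 0 v with hv | hv
  · have hq : ContDiffAt ℝ (⊤ : ℕ∞) (fun v : ℝ => √(v / κ)) v :=
      (contDiffAt_id.div_const κ).sqrt (by simp only [id]; positivity)
    exact hq.mul (hs.contDiffAt.comp v hq)
  · have h0 : v < κ * t₁ ^ 2 := hv.trans_lt (by positivity)
    have : sqrtWeight W κ =ᶠ[𝓝 v] fun _ => 0 := by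
      filter_upwards [Iio_mem_nhds h0] with u hu
      by_contra h
      exact (sqrtWeight_support h1 hW hκ h).1.not_gt hu
    exact contDiffAt_const.congr_of_eventuallyEq this

end

lemma sum_Icc_pnat_inv_le (P : ℕ+) :
    ∑ c ∈ Finset.Icc (1 : ℕ+) P, (1 : ℝ) / (c : ℕ) ≤ 1 + Real.log P := by
  have h := harmonic_le_one_add_log P
  rw [harmonic_eq_sum_Icc] at h
  refine le_trans (le_of_eq ?_) h
  push_cast
  refine Finset.sum_bij (fun c _ => (c : ℕ)) (fun c hc => ?_) (fun c _ d _ h => PNat.coe_injective h)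
    (fun k hk => ?_) (fun c _ => one_div _)
  · have := Finset.mem_Icc.1 hc
    exact Finset.mem_Icc.2 ⟨c.pos, PNat.coe_le_coe _ _ |>.2 this.2⟩
  · have := Finset.mem_Icc.1 hk
    exact ⟨⟨k, this.1⟩, Finset.mem_Icc.2 ⟨this.1, this.2⟩, rfl⟩

lemma one_add_log_le {X ε : ℝ} (hX : 1 ≤ X) (hε : 0 < ε) :
    (1 + Real.log X) ^ 2 ≤ (1 + 2 / ε) ^ 2 * X ^ ε := by
  have h1 : 1 ≤ X ^ (ε / 2) := Real.one_le_rpow hX (by positivity)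
  have h2 := Real.log_le_rpow_div (by linarith : 0 ≤ X) (half_pos hε)
  have h3 : X ^ ε = (X ^ (ε / 2)) ^ 2 := by
    rw [← Real.rpow_natCast, ← Real.rpow_mul (by linarith)]
    norm_num
  rw [h3, ← mul_pow]
  have h4 := Real.log_nonneg hX
  have h5 : X ^ (ε / 2) / (ε / 2) = 2 / ε * X ^ (ε / 2) := by field_simp
  refine pow_le_pow_left₀ (by positivity) ?_ 2
  rw [h5] at h2
  linarith

/-- The logarithmic form of the bound. -/
theorem exists_sum_kloosterman_log_bound {m n : ℤ} (hm : m ≠ 0) (hn : n ≠ 0) {W : ℝ → ℝ}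
    (hs : ContDiff ℝ (⊤ : ℕ∞) W) (hW : HasCompactSupport W) (hpos : tsupport W ⊆ Ioi 0) :
    ∃ C, 0 ≤ C ∧ ∀ X : ℝ, 1 ≤ X →
      ‖∑' c : ℕ+, kloostermanSum n m c * (W ((c : ℝ) / X) : ℂ)‖ ≤
        C * X * (1 + Real.log X) ^ 2 := by
  obtain ⟨t₁, t₂, ht₁, ht, hWt⟩ := exists_support_Icc hW hpos
  set κ := max 1 (1 / t₁ ^ 2) with hκdef
  have hκ1 : 1 ≤ κ := le_max_left _ _
  have hκ : 0 < κ := by linarith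
  have hv1 : 1 ≤ κ * t₁ ^ 2 := by
    have := le_max_right 1 (1 / t₁ ^ 2)
    rwa [← hκdef, div_le_iff₀ (by positivity)] at this
  set v₂ := κ * t₂ ^ 2 with hv2
  set Φ := sqrtWeight W κ with hΦ
  have hΦs : ContDiff ℝ (⊤ : ℕ∞) Φ := contDiff_sqrtWeight hs ht₁ hWt hκ
  have hΦt : tsupport Φ ⊆ Icc (κ * t₁ ^ 2) v₂ := tsupport_sqrtWeight ht₁ hWt hκ
  have hΦc : HasCompactSupport Φ := isCompact_Icc.of_isClosed_subset (isClosed_tsupport _) hΦt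
  set f : ℝ → ℝ := fun v => v ^ (11 / 2 : ℝ) * iteratedDeriv 6 Φ v with hf
  set g := truncPow κ with hg
  have hfsupp : ∀ v, f v ≠ 0 → κ * t₁ ^ 2 ≤ v ∧ v ≤ v₂ := fun v hv =>
    hΦt (tsupport_iteratedDeriv_subset Φ 6 (subset_tsupport _ (right_ne_zero_of_mul hv)))
  have hfs : ContDiff ℝ 4 f := (contDiff_rpow_of_le (by norm_num)).mul
    ((contDiff_iteratedDeriv_of_top hΦs 6).of_le
      (WithTop.coe_le_coe.2 (le_top : (4 : ℕ∞) ≤ ⊤)))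
  have hfp : IsProf 4 f := by
    refine ⟨by exact_mod_cast hfs, v₂ + 1, by positivity, fun u hu => ?_⟩
    by_contra h
    linarith [(hfsupp u h).2]
  have hgp : IsProf 4 g := isProf_truncPow hκ
  have hgz : ∀ u, 1 / κ ≤ u → g u = 0 := fun u hu => truncPow_eq_zero (by
    rw [div_le_iff₀ hκ] at hu; linarith)
  obtain ⟨Mf, hMf, hMf'⟩ := hfp.exists_bound
  obtain ⟨Mg, hMg, hMg'⟩ := hgp.exists_bound
  have hpair : IsPair f g (Mf * Mg) (1 / κ) (κ * t₁ ^ 2) v₂ := {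
    cont_left := hfs.continuous
    cont_right := hgp.smooth.continuous
    one_le := hv1
    le := mul_le_mul_of_nonneg_left (pow_le_pow_left₀ ht₁.le ht 2) hκ.le
    pos := by positivity
    supp_left := hfsupp
    supp_right := hgz
    bound := fun u v hu => by
      rw [abs_mul]
      refine mul_le_mul ?_ (hMg' u hu) (abs_nonneg _) hMf
      by_cases h : f v = 0
      · rw [h, abs_zero]; exact hMf
      · exact hMf' v (by linarith [(hfsupp v h).1]) }
  have hdisj : ∀ u, f u = 0 ∨ g u = 0 := fun u => by
    by_cases h : f u = 0
    · exact Or.inl h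
    · refine Or.inr (hgz u ?_)
      have h1 := (hfsupp u h).1
      have h2 : 1 / κ ≤ 1 := by rw [div_le_one hκ]; exact hκ1
      linarith
  obtain ⟨C₁, hC₁, hb₁⟩ := exists_kloosterman_growth hfp hgp hdisj hm hn
  obtain ⟨C₂, hC₂, hb₂⟩ := hpair.norm_integral_sub_le (-n) m
  set R := √(1 / κ * v₂) with hR
  have hR0 : 0 ≤ R := Real.sqrt_nonneg _
  set b := 120 * bellConst / √κ with hb
  have hb0 : 0 < b := by have := bellConst_pos; positivity
  have hlogR : 0 ≤ Real.log (R + 1) := Real.log_nonneg (by linarith)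
  refine ⟨(C₁ + C₂ * (1 + Real.log (R + 1))) / b, by positivity, fun X hX => ?_⟩
  have hX0 : 0 < X := by linarith
  set s := Real.log X with hsX
  have hs0 : 0 ≤ s := Real.log_nonneg hX
  have hexp : Real.exp (-s) = X⁻¹ := by rw [Real.exp_neg, hsX, Real.exp_log hX0]
  set P : ℕ+ := ⟨⌊R * X⌋₊ + 1, Nat.succ_pos _⟩ with hP
  set N : ℕ+ → ℂ := fun c => ∫ z, kern (-n) m f g s c z with hN
  set M : ℕ+ → ℂ := fun c => ((∫ z, mainKern f g s c z : ℝ) : ℂ) with hM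
  have hMv : ∀ c : ℕ+, M c = (b / X : ℝ) * (W ((c : ℝ) / X) : ℂ) := fun c => by
    have hc0 : (0 : ℝ) < (c : ℕ) := by exact_mod_cast c.pos
    have h1 := integral_mainKern hκ hΦs hΦc s c.pos (hpair.integrable_mainKern s c.pos)
    have h2 : Φ (κ * ((c : ℕ) * Real.exp (-s)) ^ 2) = (c : ℕ) / X * W ((c : ℕ) / X) := by
      rw [hΦ, sqrtWeight, mul_div_cancel_left₀ _ hκ.ne', Real.sqrt_sq (by positivity), hexp,
        ← div_eq_mul_inv]
    rw [h2] at h1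
    simp only [hM]
    rw [h1, ← Complex.ofReal_mul]
    congr 1
    rw [hb]
    field_simp
  have hzero : ∀ c ∉ Finset.Icc (1 : ℕ+) P, N c = 0 ∧ M c = 0 := by
    intro c hc
    have hPc : P < c := by
      by_contra h
      exact hc (Finset.mem_Icc.2 ⟨PNat.pos c, not_lt.1 h⟩)
    have h1 : R * X < (c : ℕ) := by
      have h2 : ⌊R * X⌋₊ + 1 < (c : ℕ) := hPc
      have h3 := Nat.lt_floor_add_one (R * X)
      have h4 : ((⌊R * X⌋₊ + 1 : ℕ) : ℝ) < (c : ℕ) := by exact_mod_cast h2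
      push_cast at h4
      linarith
    have h5 : 1 / κ * v₂ < ((c : ℕ) * Real.exp (-s)) ^ 2 := by
      rw [hexp, ← div_eq_mul_inv]
      refine Real.lt_sq_of_sqrt_lt ?_
      rwa [lt_div_iff₀ hX0]
    obtain ⟨ha, hb⟩ := hpair.integral_eq_zero (-n) m s c.pos h5
    exact ⟨ha, by simp only [hM]; rw [hb, Complex.ofReal_zero]⟩
  have hsumN : ∑' c : ℕ+, kloostermanSum n m c * N c =
      ∑ c ∈ Finset.Icc (1 : ℕ+) P, kloostermanSum n m c * N c :=
    tsum_eq_sum fun c hc => by rw [(hzero c hc).1, mul_zero]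
  have hsumM : ∑' c : ℕ+, kloostermanSum n m c * M c =
      ∑ c ∈ Finset.Icc (1 : ℕ+) P, kloostermanSum n m c * M c :=
    tsum_eq_sum fun c hc => by rw [(hzero c hc).2, mul_zero]
  have hdiff : ‖∑ c ∈ Finset.Icc (1 : ℕ+) P, kloostermanSum n m c * (N c - M c)‖ ≤
      C₂ * (1 + s) * (1 + Real.log P) := by
    calc _ ≤ ∑ c ∈ Finset.Icc (1 : ℕ+) P, C₂ * (1 + s) * ((1 : ℝ) / (c : ℕ)) := by
          refine norm_sum_le_of_le _ fun c _ => ?_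
          have hc0 : (0 : ℝ) < (c : ℕ) := by exact_mod_cast c.pos
          rw [norm_mul]
          have hk : Integrable (kern (-n) m f g s c) := by
            have hd : (1 : ℕ) % c ∈ (Finset.range c).filter (fun d => Nat.gcd d c = 1) := by
              refine Finset.mem_filter.2 ⟨Finset.mem_range.2 (Nat.mod_lt _ c.pos), ?_⟩
              exact (Nat.gcd_rec (c : ℕ) 1).symm.trans (Nat.gcd_one_right _)
            exact (integral_kern hfp hgp (-n) m s c ⟨_, hd⟩).1
          calc _ ≤ ((c : ℕ) : ℝ) * (C₂ * (1 + s) / (c : ℕ) ^ 2) :=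
                mul_le_mul (norm_kloostermanSum_le n m c) (hb₂ s hs0 c c.pos hk)
                  (norm_nonneg _) hc0.le
            _ = _ := by field_simp
      _ = C₂ * (1 + s) * ∑ c ∈ Finset.Icc (1 : ℕ+) P, (1 : ℝ) / (c : ℕ) := by
          rw [Finset.mul_sum]
      _ ≤ _ := mul_le_mul_of_nonneg_left (sum_Icc_pnat_inv_le P) (by positivity)
  have hlogP : Real.log P ≤ Real.log (R + 1) + s := by
    rw [hsX, ← Real.log_mul (by positivity) hX0.ne']
    refine Real.log_le_log (by exact_mod_cast P.pos) ?_
    have h1 := Nat.floor_le (by positivity : 0 ≤ R * X)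
    have h2 : ((P : ℕ) : ℝ) = ⌊R * X⌋₊ + 1 := by simp [hP]
    rw [h2]
    linarith
  have hMbound : ‖∑' c : ℕ+, kloostermanSum n m c * M c‖ ≤
      (C₁ + C₂ * (1 + Real.log (R + 1))) * (1 + s) ^ 2 := by
    have e : ∑' c : ℕ+, kloostermanSum n m c * M c = ∑' c : ℕ+, kloostermanSum n m c * N c -
        ∑ c ∈ Finset.Icc (1 : ℕ+) P, kloostermanSum n m c * (N c - M c) := by
      rw [hsumN, hsumM, ← Finset.sum_sub_distrib]
      exact Finset.sum_congr rfl fun c _ => by ring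
    rw [e]
    refine (norm_sub_le _ _).trans ?_
    have h1 := hb₁ s hs0
    have h2 : C₂ * (1 + s) * (1 + Real.log P) ≤
        C₂ * (1 + s) * ((1 + Real.log (R + 1)) * (1 + s)) := by
      refine mul_le_mul_of_nonneg_left ?_ (by positivity)
      nlinarith
    calc _ ≤ C₁ * (1 + s) ^ 2 + C₂ * (1 + s) * ((1 + Real.log (R + 1)) * (1 + s)) :=
          add_le_add h1 (hdiff.trans h2)
      _ = _ := by ring
  have hfin : ∑' c : ℕ+, kloostermanSum n m c * M c =
      (b / X : ℝ) * ∑' c : ℕ+, kloostermanSum n m c * (W ((c : ℝ) / X) : ℂ) := by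
    rw [← tsum_mul_left]
    refine tsum_congr fun c => ?_
    rw [hMv]; ring
  rw [hfin, norm_mul, Complex.norm_real, Real.norm_eq_abs, abs_of_pos (by positivity)] at hMbound
  have h3 := mul_le_mul_of_nonneg_left hMbound (by positivity : 0 ≤ X / b)
  rw [← mul_assoc, div_mul_div_cancel₀' (by positivity), div_self (by positivity), one_mul] at h3
  refine h3.trans (le_of_eq ?_)
  ring

end LinnikSums

/-- Cancellation in sums of Kloosterman sums over the modulus (Linnik's problem):
for fixed nonzero integers `m, n`, a fixed smooth weight `W` compactly supported in
`(0, ∞)`, and any `ε > 0`, one has `∑_{c ≥ 1} S(n, m, c) W(c/X) ≪ X^{1+ε}`. -/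
theorem sum_of_kloosterman_sums_bound
    (m n : ℤ) (hm : m ≠ 0) (hn : n ≠ 0)
    (W : ℝ → ℝ) (hW_smooth : ContDiff ℝ (⊤ : ℕ∞) W) (hW_supp : HasCompactSupport W)
    (hW_pos : tsupport W ⊆ Set.Ioi (0 : ℝ))
    (ε : ℝ) (hε : 0 < ε) :
    ∃ C : ℝ, ∀ X : ℝ, 1 ≤ X →
      ‖∑' c : ℕ+, kloostermanSum n m c * (W ((c : ℝ) / X) : ℂ)‖ ≤ C * X ^ (1 + ε) := by
  obtain ⟨C, hC, h⟩ := LinnikSums.exists_sum_kloosterman_log_bound hm hn hW_smooth hW_supp hW_pos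
  refine ⟨C * (1 + 2 / ε) ^ 2, fun X hX => (h X hX).trans ?_⟩
  have hX0 : 0 < X := by linarith
  calc C * X * (1 + Real.log X) ^ 2 ≤ C * X * ((1 + 2 / ε) ^ 2 * X ^ ε) :=
        mul_le_mul_of_nonneg_left (LinnikSums.one_add_log_le hX hε) (by positivity)
    _ = _ := by rw [Real.rpow_add hX0, Real.rpow_one]; ring
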